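/- Let G be an affine reductive algebraic group over an algebraically closed field k of characteristic zero and X an affine G-variety. A point x ∈ X is polystable if and only if x is 1PS polystable, i.e. λ^+x ∈ G·x for every one-parameter subgroup λ of G such that λ^+x exists. -/

import Mathlib

open scoped MatrixGroups

namespace PaperGIT

variable {k : Type} [Field k]

/-- The zero locus in affine space `k^σ` of a set of polynomials. -/
def zeroLocus {σ : Type} (I : Set (MvPolynomial σ k)) : Set (σ → k) :=
  {x | ∀ f ∈ I, MvPolynomial.eval x f = 0}

/-- A subset of affine space is Zariski closed if it is the zero locus of a set
of polynomials. -/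
def IsZClosed {σ : Type} (S : Set (σ → k)) : Prop :=
  ∃ I : Set (MvPolynomial σ k), S = zeroLocus I

/-- The Zariski closure of a subset of affine space. -/
def zClosure {σ : Type} (S : Set (σ → k)) : Set (σ → k) :=
  ⋂₀ {C | IsZClosed C ∧ S ⊆ C}

/-- A matrix viewed as a point of affine space. -/
def mat2pt {n : ℕ} (A : Matrix (Fin n) (Fin n) k) : Fin n × Fin n → k :=
  fun p => A p.1 p.2

/-- An affine algebraic group over `k`, realized (as is always possible) as a
Zariski closed subgroup of some `GL n k`. -/
structure AlgGroup (k : Type) [Field k] where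
  n : ℕ
  toSubgroup : Subgroup (GL (Fin n) k)
  closed : ∃ I : Set (MvPolynomial (Fin n × Fin n) k),
    ∀ A : GL (Fin n) k, A ∈ toSubgroup ↔
      mat2pt (A : Matrix (Fin n) (Fin n) k) ∈ zeroLocus I

/-- A one-parameter subgroup (cocharacter) of `G`: a group homomorphism
`k^× → G` whose matrix entries are Laurent polynomials in the parameter. -/
structure OnePS (G : AlgGroup k) where
  toFun : kˣ →* GL (Fin G.n) k
  mem : ∀ t : kˣ, toFun t ∈ G.toSubgroup
  regular : ∃ p : Fin G.n × Fin G.n → MvPolynomial Bool k,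
    ∀ (t : kˣ) (ij : Fin G.n × Fin G.n),
      (toFun t : Matrix (Fin G.n) (Fin G.n) k) ij.1 ij.2 =
        MvPolynomial.eval (fun b => if b then (t : k) else ((t⁻¹ : kˣ) : k)) (p ij)

/-- `GLimit lam g h` says that the morphism `t ↦ lam(t) * g * lam(t)⁻¹` of `k^×`
into `G` extends to a morphism `k → G` with value `h` at `t = 0`; i.e. that
`lam⁺g = lim_{t→0} lam(t) g lam(t)⁻¹` exists and equals `h`. -/
def GLimit {G : AlgGroup k} (lam : OnePS G) (g h : GL (Fin G.n) k) : Prop :=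
  h ∈ G.toSubgroup ∧
  ∃ q : Fin G.n × Fin G.n → Polynomial k,
    (∀ (t : kˣ) (ij : Fin G.n × Fin G.n),
      ((lam.toFun t * g * (lam.toFun t)⁻¹ : GL (Fin G.n) k) :
          Matrix (Fin G.n) (Fin G.n) k) ij.1 ij.2 = (q ij).eval (t : k)) ∧
    ∀ ij : Fin G.n × Fin G.n,
      (h : Matrix (Fin G.n) (Fin G.n) k) ij.1 ij.2 = (q ij).eval 0

/-- The R-parabolic subgroup `P(λ) = {g ∈ G : lim_{t→0} λ(t) g λ(t)⁻¹ exists}`. -/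
def Pset {G : AlgGroup k} (lam : OnePS G) : Set (GL (Fin G.n) k) :=
  {g | g ∈ G.toSubgroup ∧ ∃ h, GLimit lam g h}

/-- The R-Levi subgroup `L(λ) = {g ∈ G : lim_{t→0} λ(t) g λ(t)⁻¹ = g}`. -/
def Lset {G : AlgGroup k} (lam : OnePS G) : Set (GL (Fin G.n) k) :=
  {g | g ∈ G.toSubgroup ∧ GLimit lam g g}

/-- `L` is an R-Levi subgroup of the R-parabolic subgroup `P`, i.e. `L = L(μ)`
for some one-parameter subgroup `μ` with `P(μ) = P`. -/
def IsRLeviOf {G : AlgGroup k} (L P : Set (GL (Fin G.n) k)) : Prop :=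
  ∃ mu : OnePS G, Pset mu = P ∧ Lset mu = L

/-- `P` is an R-parabolic subgroup of `G`. -/
def IsRParabolic {G : AlgGroup k} (P : Set (GL (Fin G.n) k)) : Prop :=
  ∃ lam : OnePS G, P = Pset lam

/-- Two one-parameter subgroups are opposite if `P(λ) ∩ P(λ')` is an R-Levi
subgroup of both `P(λ)` and `P(λ')`. -/
def AreOpposite {G : AlgGroup k} (lam lam' : OnePS G) : Prop :=
  IsRLeviOf (Pset lam ∩ Pset lam') (Pset lam) ∧
  IsRLeviOf (Pset lam ∩ Pset lam') (Pset lam')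

/-- A subgroup (given as a subset) `H ⊆ G` is completely reducible in `G` if
every R-parabolic subgroup of `G` containing `H` has an R-Levi subgroup
containing `H`. -/
def CompletelyReducible (G : AlgGroup k) (H : Set (GL (Fin G.n) k)) : Prop :=
  ∀ lam : OnePS G, H ⊆ Pset lam →
    ∃ L : Set (GL (Fin G.n) k), IsRLeviOf L (Pset lam) ∧ H ⊆ L

/-- A subgroup (given as a subset) `H ⊆ G` is irreducible in `G` if it is not
contained in any proper R-parabolic subgroup of `G`. -/
def IrreducibleIn (G : AlgGroup k) (H : Set (GL (Fin G.n) k)) : Prop :=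
  ∀ lam : OnePS G, H ⊆ Pset lam → Pset lam = (G.toSubgroup : Set (GL (Fin G.n) k))

/-- The center `Z(G)` of `G`, as a subset. -/
def centerSet (G : AlgGroup k) : Set (GL (Fin G.n) k) :=
  {g | g ∈ G.toSubgroup ∧ ∀ h ∈ G.toSubgroup, g * h = h * g}

/-- The centralizer `Z_G(H)` of a subset `H` in `G`. -/
def centralizerSet (G : AlgGroup k) (H : Set (GL (Fin G.n) k)) :
    Set (GL (Fin G.n) k) :=
  {g | g ∈ G.toSubgroup ∧ ∀ h ∈ H, g * h = h * g}

/-- A subset of `GL n k` which is Zariski closed in `GL n k` (with the subspace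
topology coming from the space of matrices). -/
def ClosedInGL {n : ℕ} (S : Set (GL (Fin n) k)) : Prop :=
  ∃ I : Set (MvPolynomial (Fin n × Fin n) k),
    S = {A : GL (Fin n) k | mat2pt (A : Matrix (Fin n) (Fin n) k) ∈ zeroLocus I}

/-- Zariski connectedness (preconnectedness) of a subset of `GL n k`. -/
def IsConnSet {n : ℕ} (T : Set (GL (Fin n) k)) : Prop :=
  ∀ V W : Set (GL (Fin n) k), ClosedInGL V → ClosedInGL W →
    T ⊆ V ∪ W → T ∩ V ∩ W = ∅ → T ⊆ V ∨ T ⊆ W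

/-- The connected component of the identity of `G`. -/
def idComponent (G : AlgGroup k) : Set (GL (Fin G.n) k) :=
  ⋃₀ {C | C ⊆ (G.toSubgroup : Set (GL (Fin G.n) k)) ∧
      (1 : GL (Fin G.n) k) ∈ C ∧ IsConnSet C}

/-- A unipotent element of `GL n k`. -/
def IsUnipotentEl {n : ℕ} (A : GL (Fin n) k) : Prop :=
  ((A : Matrix (Fin n) (Fin n) k) - 1) ^ n = 0

/-- `G` is reductive: the unipotent radical of the identity component `G⁰` is
trivial, i.e. every connected normal subgroup of `G⁰` consisting of unipotent
elements is trivial. -/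
def IsReductive (G : AlgGroup k) : Prop :=
  ∀ H : Set (GL (Fin G.n) k),
    H ⊆ idComponent G → (1 : GL (Fin G.n) k) ∈ H →
    (∀ a ∈ H, ∀ b ∈ H, a * b ∈ H) → (∀ a ∈ H, a⁻¹ ∈ H) →
    (∀ g ∈ idComponent G, ∀ h ∈ H, g * h * g⁻¹ ∈ H) →
    IsConnSet H → (∀ h ∈ H, IsUnipotentEl h) →
    H = {1}

/-- A semisimple (diagonalizable) element of `GL n k`. -/
def IsSemisimpleEl {n : ℕ} (A : GL (Fin n) k) : Prop :=
  ∃ P : GL (Fin n) k,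
    ((P * A * P⁻¹ : GL (Fin n) k) : Matrix (Fin n) (Fin n) k).IsDiag

/-- A torus in `G`: a Zariski closed connected commutative subgroup all of
whose elements are semisimple. -/
def IsTorusIn (G : AlgGroup k) (T : Set (GL (Fin G.n) k)) : Prop :=
  T ⊆ (G.toSubgroup : Set (GL (Fin G.n) k)) ∧ (1 : GL (Fin G.n) k) ∈ T ∧
  (∀ a ∈ T, ∀ b ∈ T, a * b ∈ T) ∧ (∀ a ∈ T, a⁻¹ ∈ T) ∧
  ClosedInGL T ∧ IsConnSet T ∧
  (∀ a ∈ T, ∀ b ∈ T, a * b = b * a) ∧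
  (∀ a ∈ T, IsSemisimpleEl a)

/-- A maximal torus of `G`. -/
def IsMaximalTorusIn (G : AlgGroup k) (T : Set (GL (Fin G.n) k)) : Prop :=
  IsTorusIn G T ∧ ∀ T' : Set (GL (Fin G.n) k), IsTorusIn G T' → T ⊆ T' → T' = T

/-- A morphism of affine algebraic groups: a group homomorphism on the points
of `G` whose matrix entries are regular functions on `G`. -/
structure AlgGroupHom (G G' : AlgGroup k) where
  toFun : GL (Fin G.n) k → GL (Fin G'.n) k
  mem : ∀ g ∈ G.toSubgroup, toFun g ∈ G'.toSubgroup
  map_one : toFun 1 = 1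
  map_mul : ∀ g ∈ G.toSubgroup, ∀ h ∈ G.toSubgroup, toFun (g * h) = toFun g * toFun h
  regular : ∃ p : Fin G'.n × Fin G'.n → MvPolynomial ((Fin G.n × Fin G.n) ⊕ Unit) k,
    ∀ g ∈ G.toSubgroup, ∀ ij : Fin G'.n × Fin G'.n,
      (toFun g : Matrix (Fin G'.n) (Fin G'.n) k) ij.1 ij.2 =
        MvPolynomial.eval
          (Sum.elim (mat2pt (g : Matrix (Fin G.n) (Fin G.n) k))
            (fun _ => ((g⁻¹ : GL (Fin G.n) k) : Matrix (Fin G.n) (Fin G.n) k).det))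
          (p ij)

/-- Surjectivity of a morphism of algebraic groups (onto the points of `G'`). -/
def AlgGroupHom.Surj {G G' : AlgGroup k} (f : AlgGroupHom G G') : Prop :=
  ∀ g' ∈ G'.toSubgroup, ∃ g ∈ G.toSubgroup, f.toFun g = g'

/-- An affine `G`-variety: a Zariski closed subset of affine space `k^m`
together with an algebraic (polynomially defined) action of `G`. -/
structure GVariety (G : AlgGroup k) (m : ℕ) where
  carrier : Set (Fin m → k)
  closed : IsZClosed carrier
  act : GL (Fin G.n) k → (Fin m → k) → (Fin m → k)
  act_mem : ∀ g ∈ G.toSubgroup, ∀ x ∈ carrier, act g x ∈ carrier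
  act_one : ∀ x ∈ carrier, act 1 x = x
  act_mul : ∀ g ∈ G.toSubgroup, ∀ h ∈ G.toSubgroup, ∀ x ∈ carrier,
    act (g * h) x = act g (act h x)
  regular : ∃ p : Fin m → MvPolynomial ((Fin G.n × Fin G.n) ⊕ (Unit ⊕ Fin m)) k,
    ∀ g ∈ G.toSubgroup, ∀ x ∈ carrier, ∀ i : Fin m,
      act g x i =
        MvPolynomial.eval
          (Sum.elim (mat2pt (g : Matrix (Fin G.n) (Fin G.n) k))
            (Sum.elim
              (fun _ => ((g⁻¹ : GL (Fin G.n) k) : Matrix (Fin G.n) (Fin G.n) k).det)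
              x))
          (p i)

/-- `XLimit X lam x y` : the `lam`-ray through `x`, `t ↦ lam(t)·x`, extends to
a morphism `k → X` with value `y` at `0`; i.e. `lam⁺x` exists and equals `y`. -/
def XLimit {G : AlgGroup k} {m : ℕ} (X : GVariety G m) (lam : OnePS G)
    (x y : Fin m → k) : Prop :=
  y ∈ X.carrier ∧
  ∃ q : Fin m → Polynomial k,
    (∀ (t : kˣ) (i : Fin m), X.act (lam.toFun t) x i = (q i).eval (t : k)) ∧
    ∀ i : Fin m, y i = (q i).eval 0

/-- `lam ∈ Λ_x` : the limit `lam⁺x` exists. -/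
def InLambda {G : AlgGroup k} {m : ℕ} (X : GVariety G m) (x : Fin m → k)
    (lam : OnePS G) : Prop :=
  ∃ y, XLimit X lam x y

/-- `H_x = ∩_{λ ∈ Λ_x} P(λ)`. -/
def Hx {G : AlgGroup k} {m : ℕ} (X : GVariety G m) (x : Fin m → k) :
    Set (GL (Fin G.n) k) :=
  {g | g ∈ G.toSubgroup ∧ ∀ lam : OnePS G, InLambda X x lam → g ∈ Pset lam}

/-- `Λ_x` is symmetric: every `λ ∈ Λ_x` admits an opposite `λ' ∈ Λ_x`. -/
def SymmetricLambda {G : AlgGroup k} {m : ℕ} (X : GVariety G m)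
    (x : Fin m → k) : Prop :=
  ∀ lam : OnePS G, InLambda X x lam →
    ∃ lam' : OnePS G, InLambda X x lam' ∧ AreOpposite lam lam'

/-- The map `η : X → S(G)`, `x ↦ H_x`, is proper: `H_x ⊆ P(λ)` implies `λ ∈ Λ_x`. -/
def EtaProper {G : AlgGroup k} {m : ℕ} (X : GVariety G m) : Prop :=
  ∀ x ∈ X.carrier, ∀ lam : OnePS G, Hx X x ⊆ Pset lam → InLambda X x lam

/-- The `G`-orbit of `x`. -/
def orbitSet {G : AlgGroup k} {m : ℕ} (X : GVariety G m) (x : Fin m → k) :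
    Set (Fin m → k) :=
  {y | ∃ g ∈ G.toSubgroup, y = X.act g x}

/-- `x` is polystable: its `G`-orbit is Zariski closed. -/
def Polystable {G : AlgGroup k} {m : ℕ} (X : GVariety G m) (x : Fin m → k) : Prop :=
  IsZClosed (orbitSet X x)

/-- The stabilizer `G_x` of `x`, as a subset of `G`. -/
def stabSet {G : AlgGroup k} {m : ℕ} (X : GVariety G m) (x : Fin m → k) :
    Set (GL (Fin G.n) k) :=
  {g | g ∈ G.toSubgroup ∧ X.act g x = x}

/-- The center of the action, `G_X = ∩_{x ∈ X} G_x`. -/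
def actionCenter {G : AlgGroup k} {m : ℕ} (X : GVariety G m) :
    Set (GL (Fin G.n) k) :=
  {g | g ∈ G.toSubgroup ∧ ∀ x ∈ X.carrier, X.act g x = x}

/-- `x` is stable: polystable and `G_x/G_X` is finite (finitely many cosets
`g·G_X` with `g ∈ G_x`). -/
def Stable {G : AlgGroup k} {m : ℕ} (X : GVariety G m) (x : Fin m → k) : Prop :=
  Polystable X x ∧
  Set.Finite ((fun g => (fun h => g * h) '' actionCenter X) '' stabSet X x)

/-- `x` is properly stable: polystable with finite stabilizer. -/
def ProperlyStable {G : AlgGroup k} {m : ℕ} (X : GVariety G m) (x : Fin m → k) : Prop :=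
  Polystable X x ∧ (stabSet X x).Finite

/-- `x` is equicentral: polystable and `G_x = G_X`. -/
def Equicentral {G : AlgGroup k} {m : ℕ} (X : GVariety G m) (x : Fin m → k) : Prop :=
  Polystable X x ∧ stabSet X x = actionCenter X

/-- `x` is 1PS stable: polystable, and for every one-parameter subgroup `λ`
of `G` with `λ(k^×) ⊄ G_X` the limit `λ⁺x` does not exist. -/
def OnePSStable {G : AlgGroup k} {m : ℕ} (X : GVariety G m) (x : Fin m → k) : Prop :=
  Polystable X x ∧
  ∀ lam : OnePS G, ¬ (∀ t : kˣ, lam.toFun t ∈ actionCenter X) → ¬ InLambda X x lam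

/-- The weight space of weight `n ∈ ℤ` for the 1PS `lam` acting on `k^m`. -/
def weightSpace {G : AlgGroup k} {m : ℕ} (X : GVariety G m) (lam : OnePS G)
    (n : ℤ) : Set (Fin m → k) :=
  {w | ∀ t : kˣ, X.act (lam.toFun t) w = (((t ^ n : kˣ) : k)) • w}

/-- `μ(v, lam) = μ0`: decomposing `v` into nonzero weight vectors for `lam`,
the minimal occurring weight equals `μ0`. -/
def MuIs {G : AlgGroup k} {m : ℕ} (X : GVariety G m) (lam : OnePS G)
    (v : Fin m → k) (μ0 : ℤ) : Prop :=
  ∃ (s : Finset ℤ) (c : ℤ → (Fin m → k)),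
    (∀ n ∈ s, c n ∈ weightSpace X lam n ∧ c n ≠ 0) ∧
    v = ∑ n ∈ s, c n ∧ μ0 ∈ s ∧ ∀ n ∈ s, μ0 ≤ n

/-- `GL n k` itself, as an affine algebraic group. -/
def fullGL (k : Type) [Field k] (n : ℕ) : AlgGroup k where
  n := n
  toSubgroup := ⊤
  closed := ⟨∅, by intro A; simp [zeroLocus]⟩

/-- A subset `X ⊆ G^N` which is Zariski closed in `G^N`. -/
def GNClosed (G : AlgGroup k) (N : ℕ)
    (S : Set (Fin N → GL (Fin G.n) k)) : Prop :=
  ∃ I : Set (MvPolynomial (Fin N × (Fin G.n × Fin G.n)) k),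
    S = {x | (∀ i, x i ∈ G.toSubgroup) ∧
          ∀ f ∈ I, MvPolynomial.eval
            (fun p => ((x p.1 : Matrix (Fin G.n) (Fin G.n) k) p.2.1 p.2.2)) f = 0}

/-- Limits of the `lam`-ray through `x ∈ X ⊆ G^N`, for the simultaneous
conjugation action. -/
def GNLimit {G : AlgGroup k} {N : ℕ} (X : Set (Fin N → GL (Fin G.n) k))
    (lam : OnePS G) (x y : Fin N → GL (Fin G.n) k) : Prop :=
  y ∈ X ∧
  ∃ q : Fin N → Fin G.n × Fin G.n → Polynomial k,
    (∀ (t : kˣ) (i : Fin N) (ij : Fin G.n × Fin G.n),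
      ((lam.toFun t * x i * (lam.toFun t)⁻¹ : GL (Fin G.n) k) :
          Matrix (Fin G.n) (Fin G.n) k) ij.1 ij.2 = (q i ij).eval (t : k)) ∧
    ∀ (i : Fin N) (ij : Fin G.n × Fin G.n),
      (y i : Matrix (Fin G.n) (Fin G.n) k) ij.1 ij.2 = (q i ij).eval 0

/-- `lam ∈ Λ_x` for `x ∈ X ⊆ G^N`. -/
def GNInLambda {G : AlgGroup k} {N : ℕ} (X : Set (Fin N → GL (Fin G.n) k))
    (x : Fin N → GL (Fin G.n) k) (lam : OnePS G) : Prop :=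
  ∃ y, GNLimit X lam x y

/-- `H_x` for `x ∈ X ⊆ G^N`. -/
def GNHx {G : AlgGroup k} {N : ℕ} (X : Set (Fin N → GL (Fin G.n) k))
    (x : Fin N → GL (Fin G.n) k) : Set (GL (Fin G.n) k) :=
  {g | g ∈ G.toSubgroup ∧ ∀ lam : OnePS G, GNInLambda X x lam → g ∈ Pset lam}

/-- `φ_x`: the subgroup of `G` generated by the components of `x ∈ G^N`. -/
def phiSet {G : AlgGroup k} {N : ℕ} (x : Fin N → GL (Fin G.n) k) :
    Set (GL (Fin G.n) k) :=
  (Subgroup.closure (Set.range x) : Subgroup (GL (Fin G.n) k))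

/-- The orbit of `x ∈ G^N` under simultaneous conjugation. -/
def GNOrbit {G : AlgGroup k} {N : ℕ} (x : Fin N → GL (Fin G.n) k) :
    Set (Fin N → GL (Fin G.n) k) :=
  {y | ∃ g ∈ G.toSubgroup, y = fun i => g * x i * g⁻¹}

/-- Polystability of `x ∈ X ⊆ G^N`: the conjugation orbit is Zariski closed. -/
def GNPolystable (G : AlgGroup k) {N : ℕ} (x : Fin N → GL (Fin G.n) k) : Prop :=
  GNClosed G N (GNOrbit x)

/-- The stabilizer of `x ∈ G^N` under simultaneous conjugation. -/
def GNStab (G : AlgGroup k) {N : ℕ} (x : Fin N → GL (Fin G.n) k) :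
    Set (GL (Fin G.n) k) :=
  {g | g ∈ G.toSubgroup ∧ ∀ i, g * x i * g⁻¹ = x i}

/-- `G_X` for `X ⊆ G^N` with the simultaneous conjugation action. -/
def GNActionCenter (G : AlgGroup k) {N : ℕ}
    (X : Set (Fin N → GL (Fin G.n) k)) : Set (GL (Fin G.n) k) :=
  {g | g ∈ G.toSubgroup ∧ ∀ x ∈ X, ∀ i, g * x i * g⁻¹ = x i}

/-- `x ∈ X ⊆ G^N` is stable: polystable and `G_x/G_X` finite. -/
def GNStable (G : AlgGroup k) {N : ℕ} (X : Set (Fin N → GL (Fin G.n) k))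
    (x : Fin N → GL (Fin G.n) k) : Prop :=
  GNPolystable G x ∧
  Set.Finite ((fun g => (fun h => g * h) '' GNActionCenter G X) '' GNStab G x)

/-- `x ∈ X ⊆ G^N` is equicentral: polystable and `G_x = G_X`. -/
def GNEquicentral (G : AlgGroup k) {N : ℕ} (X : Set (Fin N → GL (Fin G.n) k))
    (x : Fin N → GL (Fin G.n) k) : Prop :=
  GNPolystable G x ∧ GNStab G x = GNActionCenter G X

/-- A subgroup `H ⊆ G` is isotropic: completely reducible with `Z_G(H) = Z(G)`. -/
def IsIsotropic (G : AlgGroup k) (H : Set (GL (Fin G.n) k)) : Prop :=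
  CompletelyReducible G H ∧ centralizerSet G H = centerSet G

end PaperGIT

set_option linter.unusedSectionVars false
set_option linter.style.longLine false

namespace PaperGIT

section LinRed

variable {k : Type} [Field k] {H : Type} [Group H]

/-- `O` behaves like the ring of regular functions of an affine algebraic group with points `H`. -/
structure AffGrp (O : Subalgebra k (H → k)) : Prop where
  fg : Algebra.FiniteType k O
  pts : ∀ χ : O →ₐ[k] k, ∃ g : H, ∀ f : O, χ f = f.1 g
  comul : ∀ f : O, ∃ (N : ℕ) (φ ψ : Fin N → O), ∀ g h, f.1 (g * h) = ∑ i, (φ i).1 g * (ψ i).1 h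
  inv : ∀ f ∈ O, (fun g => f g⁻¹) ∈ O

variable {O : Subalgebra k (H → k)}

theorem AffGrp.lt_mem (hO : AffGrp O) (g : H) (f : O) : (fun h => f.1 (g * h)) ∈ O := by
  obtain ⟨N, φ, ψ, h⟩ := hO.comul f
  have : (fun h => f.1 (g * h)) = ∑ i, (φ i).1 g • (ψ i).1 := by
    funext x; simp [h]
  rw [this]
  exact O.toSubmodule.sum_mem fun i _ => O.toSubmodule.smul_mem _ (ψ i).2

theorem AffGrp.rt_mem (hO : AffGrp O) (g : H) (f : O) : (fun h => f.1 (h * g)) ∈ O := by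
  obtain ⟨N, φ, ψ, h⟩ := hO.comul f
  have : (fun h => f.1 (h * g)) = ∑ i, (ψ i).1 g • (φ i).1 := by
    funext x; simp [h, mul_comm]
  rw [this]
  exact O.toSubmodule.sum_mem fun i _ => O.toSubmodule.smul_mem _ (φ i).2

/-- Left translation. -/
def lt (hO : AffGrp O) (g : H) : O →ₐ[k] O where
  toFun f := ⟨fun h => f.1 (g * h), hO.lt_mem g f⟩
  map_one' := rfl
  map_mul' _ _ := rfl
  map_zero' := rfl
  map_add' _ _ := rfl
  commutes' _ := rfl

/-- Right translation. -/
def rt (hO : AffGrp O) (g : H) : O →ₐ[k] O where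
  toFun f := ⟨fun h => f.1 (h * g), hO.rt_mem g f⟩
  map_one' := rfl
  map_mul' _ _ := rfl
  map_zero' := rfl
  map_add' _ _ := rfl
  commutes' _ := rfl

@[simp] theorem lt_apply (hO : AffGrp O) (g h : H) (f : O) : (lt hO g f).1 h = f.1 (g * h) := rfl
@[simp] theorem rt_apply (hO : AffGrp O) (g h : H) (f : O) : (rt hO g f).1 h = f.1 (h * g) := rfl

/-- right regular representation -/
def regRep (hO : AffGrp O) : Representation k H O where
  toFun g := (rt hO g).toLinearMap
  map_one' := by
    ext f h; simp
  map_mul' g g' := by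
    ext f h; simp [mul_assoc]

@[simp] theorem regRep_apply (hO : AffGrp O) (g h : H) (f : O) :
    (regRep hO g f).1 h = f.1 (h * g) := rfl

/-- Evaluation. -/
def evO (O : Subalgebra k (H → k)) (g : H) : O →ₐ[k] k where
  toFun f := f.1 g
  map_one' := rfl
  map_mul' _ _ := rfl
  map_zero' := rfl
  map_add' _ _ := rfl
  commutes' _ := rfl

@[simp] theorem evO_apply (g : H) (f : O) : evO O g f = f.1 g := rfl

/-- Point derivations at the identity. -/
def LieG (O : Subalgebra k (H → k)) : Submodule k (O →ₗ[k] k) where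
  carrier := {x | ∀ f g : O, x (f * g) = f.1 1 * x g + g.1 1 * x f}
  add_mem' := by
    intro a b ha hb f g
    simp only [Set.mem_ofPred_eq, LinearMap.add_apply] at *
    rw [ha, hb]; ring
  zero_mem' := by intro f g; simp
  smul_mem' := by
    intro c a ha f g
    simp only [Set.mem_ofPred_eq, LinearMap.smul_apply, smul_eq_mul] at *
    rw [ha]; ring

variable {M : Type} [AddCommGroup M] [Module k M]

/-- Rational representation. -/
def IsRat (O : Subalgebra k (H → k)) (ρ : Representation k H M) : Prop :=
  ∀ m, ∃ (N : ℕ) (φ : Fin N → O) (v : Fin N → M), ∀ g, ρ g m = ∑ i, (φ i).1 g • v i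

theorem IsRat.coeff_mem {ρ : Representation k H M} (h : IsRat O ρ) (ξ : M →ₗ[k] k) (m : M) :
    (fun g => ξ (ρ g m)) ∈ O := by
  obtain ⟨N, φ, v, hv⟩ := h m
  have : (fun g => ξ (ρ g m)) = ∑ i, ξ (v i) • (φ i).1 := by
    funext x; simp [hv, mul_comm]
  rw [this]
  exact O.toSubmodule.sum_mem fun i _ => O.toSubmodule.smul_mem _ (φ i).2

/-- Matrix coefficient. -/
def coeff {ρ : Representation k H M} (h : IsRat O ρ) (ξ : M →ₗ[k] k) : M →ₗ[k] O where
  toFun m := ⟨fun g => ξ (ρ g m), h.coeff_mem ξ m⟩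
  map_add' a b := by ext g; simp
  map_smul' a b := by ext g; simp

@[simp] theorem coeff_apply {ρ : Representation k H M} (h : IsRat O ρ) (ξ : M →ₗ[k] k) (m : M)
    (g : H) : (coeff h ξ m).1 g = ξ (ρ g m) := rfl

theorem dual_ext {a b : M} (h : ∀ ξ : M →ₗ[k] k, ξ a = ξ b) : a = b := by
  rw [← sub_eq_zero]
  apply (Module.forall_dual_apply_eq_zero_iff k (a - b)).1
  intro f
  rw [map_sub, h f, sub_self]

theorem IsRat.exists_d {ρ : Representation k H M} (h : IsRat O ρ) (x : O →ₗ[k] k) (m : M) :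
    ∃ m' : M, ∀ ξ : M →ₗ[k] k, ξ m' = x (coeff h ξ m) := by
  obtain ⟨N, φ, v, hv⟩ := h m
  refine ⟨∑ i, x (φ i) • v i, fun ξ => ?_⟩
  have : coeff h ξ m = ∑ i, ξ (v i) • (φ i) := by
    ext g; simp [hv, mul_comm]
  rw [this]; simp [mul_comm]

/-- The operator on `M` induced by a functional on `O`. -/
noncomputable def dr {ρ : Representation k H M} (h : IsRat O ρ) (x : O →ₗ[k] k) : M →ₗ[k] M where
  toFun m := (h.exists_d x m).choose
  map_add' a b := by
    apply dual_ext (k := k); intro ξ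
    rw [map_add, (h.exists_d x _).choose_spec, (h.exists_d x _).choose_spec,
      (h.exists_d x _).choose_spec]; simp
  map_smul' a b := by
    apply dual_ext (k := k); intro ξ
    rw [RingHom.id_apply, map_smul, (h.exists_d x _).choose_spec, (h.exists_d x _).choose_spec]
    simp

theorem dr_spec {ρ : Representation k H M} (h : IsRat O ρ) (x : O →ₗ[k] k) (ξ : M →ₗ[k] k)
    (m : M) : ξ (dr h x m) = x (coeff h ξ m) := (h.exists_d x m).choose_spec ξ

theorem dr_eq {ρ : Representation k H M} (h : IsRat O ρ) (x : O →ₗ[k] k) (m m' : M)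
    (hm : ∀ ξ : M →ₗ[k] k, ξ m' = x (coeff h ξ m)) : dr h x m = m' := by
  apply dual_ext (k := k); intro ξ; rw [dr_spec, hm]

/-- `dr` as a linear map in the functional. -/
noncomputable def drL {ρ : Representation k H M} (h : IsRat O ρ) :
    (O →ₗ[k] k) →ₗ[k] (M →ₗ[k] M) where
  toFun := dr h
  map_add' x y := by
    ext m; apply dual_ext (k := k); intro ξ; simp [dr_spec]
  map_smul' c x := by
    ext m; apply dual_ext (k := k); intro ξ; simp [dr_spec]

@[simp] theorem drL_apply {ρ : Representation k H M} (h : IsRat O ρ) (x : O →ₗ[k] k) :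
  drL h x = dr h x := rfl

theorem regRep_isRat (hO : AffGrp O) : IsRat O (regRep hO) := by
  intro f
  obtain ⟨N, φ, ψ, h⟩ := hO.comul f
  refine ⟨N, ψ, φ, fun g => ?_⟩
  ext x; simp [h, mul_comm]

/-- The left invariant operator associated with `x`. -/
noncomputable def LL (hO : AffGrp O) (x : O →ₗ[k] k) : O →ₗ[k] O := dr (regRep_isRat hO) x

@[simp] theorem LL_apply (hO : AffGrp O) (x : O →ₗ[k] k) (f : O) (g : H) :
    (LL hO x f).1 g = x (lt hO g f) := by
  have := dr_spec (regRep_isRat hO) x (evO O g).toLinearMap f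
  exact this

theorem LL_one (hO : AffGrp O) (x : O →ₗ[k] k) (f : O) : (LL hO x f).1 1 = x f := by
  rw [LL_apply]; congr 1; ext; simp

theorem LL_coeff (hO : AffGrp O) {ρ : Representation k H M} (h : IsRat O ρ) (x : O →ₗ[k] k)
    (ξ : M →ₗ[k] k) (m : M) : LL hO x (coeff h ξ m) = coeff h ξ (dr h x m) := by
  ext g
  rw [LL_apply, coeff_apply, ← LinearMap.comp_apply, dr_spec]
  congr 1; ext g'; simp

theorem LL_mul (hO : AffGrp O) {x : O →ₗ[k] k} (hx : x ∈ LieG O) (f g : O) :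
    LL hO x (f * g) = f * LL hO x g + g * LL hO x f := by
  ext h
  have := hx (lt hO h f) (lt hO h g)
  simp only [lt_apply, mul_one] at this
  simp [this]

theorem LL_lt (hO : AffGrp O) (x : O →ₗ[k] k) (f : O) (g : H) :
    LL hO x (lt hO g f) = lt hO g (LL hO x f) := by
  ext h
  simp only [LL_apply, lt_apply]; congr 1; ext; simp [mul_assoc]

/-- The bracket. -/
noncomputable def brk (hO : AffGrp O) (x y : O →ₗ[k] k) : O →ₗ[k] k := x ∘ₗ LL hO y - y ∘ₗ LL hO x

theorem dr_comp (hO : AffGrp O) {ρ : Representation k H M} (h : IsRat O ρ) (x y : O →ₗ[k] k)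
    (m : M) : dr h (x ∘ₗ LL hO y) m = dr h x (dr h y m) := by
  apply dual_ext (k := k); intro ξ
  rw [dr_spec, dr_spec, LinearMap.comp_apply, LL_coeff]

theorem dr_brk (hO : AffGrp O) {ρ : Representation k H M} (h : IsRat O ρ) (x y : O →ₗ[k] k) :
    dr h (brk hO x y) = dr h x * dr h y - dr h y * dr h x := by
  ext m
  have := map_sub (drL h) (x ∘ₗ LL hO y) (y ∘ₗ LL hO x)
  simp only [drL_apply] at this
  rw [brk, this, LinearMap.sub_apply, dr_comp, dr_comp]; rfl

theorem brk_mem (hO : AffGrp O) {x y : O →ₗ[k] k} (hx : x ∈ LieG O) (hy : y ∈ LieG O) :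
    brk hO x y ∈ LieG O := by
  intro f g
  simp only [brk, LinearMap.sub_apply, LinearMap.comp_apply, LL_mul hO hx, LL_mul hO hy, map_add,
    hx _ _, hy _ _, LL_one]

  ring

/-- conjugation -/
def cj (hO : AffGrp O) (g : H) : O →ₐ[k] O := (lt hO g).comp (rt hO g⁻¹)

/-- The adjoint action. -/
def Ad (hO : AffGrp O) (g : H) (x : O →ₗ[k] k) : O →ₗ[k] k := x ∘ₗ (cj hO g).toLinearMap

theorem Ad_mem (hO : AffGrp O) (g : H) {x : O →ₗ[k] k} (hx : x ∈ LieG O) : Ad hO g x ∈ LieG O := by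
  intro a b
  simp only [Ad, LinearMap.comp_apply, AlgHom.toLinearMap_apply, map_mul]
  rw [hx]; simp [cj]

theorem dr_Ad (hO : AffGrp O) {ρ : Representation k H M} (h : IsRat O ρ) (x : O →ₗ[k] k) (g : H) :
    dr h (Ad hO g x) = ρ g * dr h x * ρ g⁻¹ := by
  ext m
  apply dr_eq; intro ξ
  rw [Module.End.mul_apply, Module.End.mul_apply, ← LinearMap.comp_apply, dr_spec]
  simp only [Ad, LinearMap.comp_apply]
  congr 1; ext a
  simp [cj]

theorem LieG_one {x : O →ₗ[k] k} (hx : x ∈ LieG O) : x 1 = 0 := by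
  have := hx 1 1
  simpa using this

/-! Submodule restriction -/

/-- restriction of a representation to a stable subspace -/
def resRep (ρ : Representation k H M) (U : Submodule k M) (hU : ∀ g, ∀ m ∈ U, ρ g m ∈ U) :
    Representation k H U where
  toFun g := (ρ g).restrict (hU g)
  map_one' := by ext; simp
  map_mul' a b := by ext; simp

@[simp] theorem resRep_apply (ρ : Representation k H M) (U : Submodule k M)
    (hU : ∀ g, ∀ m ∈ U, ρ g m ∈ U) (g : H) (m : U) : (resRep ρ U hU g m : M) = ρ g m := rfl

theorem resRep_isRat {ρ : Representation k H M} (h : IsRat O ρ) (U : Submodule k M)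
    (hU : ∀ g, ∀ m ∈ U, ρ g m ∈ U) : IsRat O (resRep ρ U hU) := by
  intro m
  obtain ⟨π, hπ⟩ := U.subtype.exists_leftInverse_of_injective (by simp)
  obtain ⟨N, φ, v, hv⟩ := h m
  refine ⟨N, φ, fun i => π (v i), fun g => ?_⟩
  have h1 : resRep ρ U hU g m = π (ρ g m) := by
    have := LinearMap.congr_fun hπ (resRep ρ U hU g m)
    simpa using this.symm
  rw [h1, hv]; simp

theorem dr_res {ρ : Representation k H M} (h : IsRat O ρ) (U : Submodule k M)
    (hU : ∀ g, ∀ m ∈ U, ρ g m ∈ U) (x : O →ₗ[k] k) (m : U) :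
    ((dr (resRep_isRat h U hU) x m : U) : M) = dr h x m := by
  symm
  apply dr_eq
  intro ξ
  exact dr_spec (resRep_isRat h U hU) x (ξ ∘ₗ U.subtype) m

theorem dr_mem {ρ : Representation k H M} (h : IsRat O ρ) (U : Submodule k M)
    (hU : ∀ g, ∀ m ∈ U, ρ g m ∈ U) (x : O →ₗ[k] k) {m : M} (hm : m ∈ U) : dr h x m ∈ U := by
  rw [← dr_res h U hU x ⟨m, hm⟩]; exact SetLike.coe_mem _

/-- If all `ρ g m - m ∈ U` then `x m ∈ U` for every point derivation. -/
theorem dr_mem_of_sub {ρ : Representation k H M} (h : IsRat O ρ) (U : Submodule k M)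
    {x : O →ₗ[k] k} (hx : x ∈ LieG O) {m : M} (hm : ∀ g, ρ g m - m ∈ U) : dr h x m ∈ U := by
  by_contra hc
  obtain ⟨ξ, h1, h2⟩ := Submodule.exists_dual_map_eq_bot_of_notMem hc inferInstance
  apply h1
  rw [dr_spec]
  have : coeff h ξ m = (ξ m) • (1 : O) := by
    ext g
    have h3 : ξ (ρ g m - m) = 0 := by
      have : ξ (ρ g m - m) ∈ U.map ξ := Submodule.mem_map_of_mem (hm g)
      rw [h2] at this; simpa using this
    rw [map_sub, sub_eq_zero] at h3
    simp [h3]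
  rw [this, map_smul, LieG_one hx, smul_zero]

/-- The span of an orbit. -/
def orbSpan (ρ : Representation k H M) (m : M) : Submodule k M :=
  Submodule.span k (Set.range fun g => ρ g m)

theorem orbSpan_stable (ρ : Representation k H M) (m : M) : ∀ g, ∀ a ∈ orbSpan ρ m, ρ g a ∈ orbSpan ρ m := by
  intro g a ha
  induction ha using Submodule.span_induction with
  | mem x hx =>
    obtain ⟨h, rfl⟩ := hx
    apply Submodule.subset_span
    exact ⟨g * h, by simp⟩
  | zero => simp
  | add x y _ _ hx hy => rw [map_add]; exact add_mem hx hy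
  | smul c x _ hx => rw [map_smul]; exact Submodule.smul_mem _ _ hx

theorem mem_orbSpan (ρ : Representation k H M) (m : M) : m ∈ orbSpan ρ m :=
  Submodule.subset_span ⟨1, by simp⟩

theorem orbSpan_fd {ρ : Representation k H M} (h : IsRat O ρ) (m : M) :
    FiniteDimensional k (orbSpan ρ m) := by
  obtain ⟨N, φ, v, hv⟩ := h m
  have h1 : orbSpan ρ m ≤ Submodule.span k (Set.range v) := by
    rw [orbSpan, Submodule.span_le]
    rintro _ ⟨g, rfl⟩
    simp only [hv]
    exact Submodule.sum_mem _ fun i _ => Submodule.smul_mem _ _ (Submodule.subset_span ⟨i, rfl⟩)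
  have : FiniteDimensional k (Submodule.span k (Set.range v)) :=
    FiniteDimensional.span_of_finite k (Set.finite_range v)
  exact Submodule.finiteDimensional_of_le h1

end LinRed

end PaperGIT

namespace PaperGIT

section Replica

open Module

theorem genEig_mul {k A : Type} [Field k] [CommRing A] [Algebra k A] (L : A →ₗ[k] A)
    (hL : ∀ f g, L (f * g) = f * L g + g * L f) (μ ν : k) :
    ∀ (N a b : ℕ) (f g : A), a + b = N → ((L - μ • (1 : End k A)) ^ a) f = 0 →
      ((L - ν • (1 : End k A)) ^ b) g = 0 → ((L - (μ + ν) • (1 : End k A)) ^ N) (f * g) = 0 := by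
  intro N
  induction N with
  | zero =>
    intro a b f g hab hf hg
    obtain ⟨rfl, rfl⟩ : a = 0 ∧ b = 0 := by omega
    simp at hf; simp [hf]
  | succ N ih =>
    intro a b f g hab hf hg
    have key : (L - (μ + ν) • (1 : End k A)) (f * g) =
        f * ((L - ν • (1 : End k A)) g) + ((L - μ • (1 : End k A)) f) * g := by
      simp only [LinearMap.sub_apply, LinearMap.smul_apply, End.one_apply, hL]
      rw [mul_sub, sub_mul, mul_smul_comm, smul_mul_assoc, add_smul]; ring
    rw [pow_succ, End.mul_apply, key, map_add]
    have h1 : ((L - (μ + ν) • (1 : End k A)) ^ N) (f * ((L - ν • (1 : End k A)) g)) = 0 := by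
      rcases b with _ | b
      · simp at hg; simp [hg]
      · exact ih a b _ _ (by omega) hf (by rw [← End.mul_apply, ← pow_succ]; exact hg)
    have h2 : ((L - (μ + ν) • (1 : End k A)) ^ N) (((L - μ • (1 : End k A)) f) * g) = 0 := by
      rcases a with _ | a
      · simp at hf; simp [hf]
      · exact ih a b _ _ (by omega) (by rw [← End.mul_apply, ← pow_succ]; exact hf) hg
    rw [h1, h2, add_zero]

theorem semiconj_pow {k A B : Type} [Field k] [AddCommGroup A] [Module k A] [AddCommGroup B]
    [Module k B] (S : End k A) (T : End k B) (j : A →ₗ[k] B) (h : ∀ a, j (S a) = T (j a)) (μ : k)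
    (n : ℕ) (a : A) : j (((S - μ • (1 : End k A)) ^ n) a) = ((T - μ • (1 : End k B)) ^ n) (j a) := by
  induction n generalizing a with
  | zero => simp
  | succ n ih =>
    rw [pow_succ, pow_succ, End.mul_apply, End.mul_apply, ih]
    simp [h]

theorem semiconj_genEig {k A B : Type} [Field k] [AddCommGroup A] [Module k A] [AddCommGroup B]
    [Module k B] (S : End k A) (T : End k B) (j : A →ₗ[k] B) (h : ∀ a, j (S a) = T (j a)) (μ : k)
    {a : A} (ha : a ∈ S.maxGenEigenspace μ) : j a ∈ T.maxGenEigenspace μ := by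
  rw [End.mem_maxGenEigenspace] at *
  obtain ⟨n, hn⟩ := ha
  exact ⟨n, by rw [← semiconj_pow S T j h, hn, map_zero]⟩

variable {k : Type} [Field k] [IsAlgClosed k] {H : Type} [Group H] {O : Subalgebra k (H → k)}
variable {M : Type} [AddCommGroup M] [Module k M]

theorem iSup_genEig (hO : AffGrp O) {ρ : Representation k H M} (h : IsRat O ρ) (x : O →ₗ[k] k) :
    ⨆ μ, End.maxGenEigenspace (dr h x) μ = ⊤ := by
  rw [eq_top_iff]
  intro m _
  have hs := orbSpan_stable ρ m
  have := orbSpan_fd h m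
  set S : End k (orbSpan ρ m) := dr (resRep_isRat h _ hs) x with hS
  have h1 : (⟨m, mem_orbSpan ρ m⟩ : orbSpan ρ m) ∈ ⨆ μ, S.maxGenEigenspace μ := by
    rw [End.iSup_maxGenEigenspace_eq_top]; trivial
  have h2 : (orbSpan ρ m).subtype ⟨m, mem_orbSpan ρ m⟩ ∈
      (⨆ μ, S.maxGenEigenspace μ).map (orbSpan ρ m).subtype := Submodule.mem_map_of_mem h1
  rw [Submodule.map_iSup] at h2
  have h3 : (⨆ μ, (S.maxGenEigenspace μ).map (orbSpan ρ m).subtype) ≤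
      ⨆ μ, End.maxGenEigenspace (dr h x) μ := by
    refine iSup_mono fun μ => ?_
    rintro _ ⟨a, ha, rfl⟩
    exact semiconj_genEig S _ _ (fun a => dr_res h _ hs x a) μ ha
  exact h3 h2

/-- Operator acting by scalars on the generalized eigenspaces. -/
theorem exists_scalarOp (T : End k M) (hT : ⨆ μ, T.maxGenEigenspace μ = ⊤) (φ : k → k) :
    ∃ D : End k M, ∀ μ, ∀ m ∈ T.maxGenEigenspace μ, D m = φ μ • m := by
  classical
  have hI : DirectSum.IsInternal (fun μ => T.maxGenEigenspace μ) :=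
    DirectSum.isInternal_submodule_of_iSupIndep_of_iSup_eq_top T.independent_maxGenEigenspace hT
  let e := LinearEquiv.ofBijective (DirectSum.coeLinearMap fun μ => T.maxGenEigenspace μ) hI
  refine ⟨(DirectSum.toModule k k M fun μ => φ μ • (T.maxGenEigenspace μ).subtype) ∘ₗ
    e.symm.toLinearMap, fun μ m hm => ?_⟩
  have : e.symm m = DirectSum.lof k k (fun μ => T.maxGenEigenspace μ) μ ⟨m, hm⟩ := by
    rw [LinearEquiv.symm_apply_eq]
    exact (DirectSum.coeLinearMap_lof (fun μ => T.maxGenEigenspace μ) μ ⟨m, hm⟩).symm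
  simp [this]

theorem exists_replica (hO : AffGrp O) {x : O →ₗ[k] k} (hx : x ∈ LieG O) (φ : k → k)
    (hφ : ∀ a b, φ (a + b) = φ a + φ b) : ∃ y ∈ LieG O,
      ∀ (M : Type) [AddCommGroup M] [Module k M] (ρ : Representation k H M) (h : IsRat O ρ) (μ : k),
      ∀ m ∈ End.maxGenEigenspace (dr h x) μ, dr h y m = φ μ • m := by
  have hT := iSup_genEig hO (regRep_isRat hO) x
  obtain ⟨D, hD⟩ := exists_scalarOp _ hT φ
  refine ⟨(evO O 1).toLinearMap ∘ₗ D, ?_, ?_⟩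
  · have key : ∀ f g : O, D (f * g) = f * D g + g * D f := by
      intro f g
      have hf : f ∈ ⨆ μ, End.maxGenEigenspace (dr (regRep_isRat hO) x) μ := by rw [hT]; trivial
      have hg : g ∈ ⨆ μ, End.maxGenEigenspace (dr (regRep_isRat hO) x) μ := by rw [hT]; trivial
      refine Submodule.iSup_induction _ (motive := fun f => D (f * g) = f * D g + g * D f) hf
        (fun μ f hf => ?_) (by simp) (fun a b ha hb => by rw [add_mul, map_add, ha, hb, map_add]; ring)
      refine Submodule.iSup_induction _ (motive := fun g => D (f * g) = f * D g + g * D f) hg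
        (fun ν g hg => ?_) (by simp) (fun a b ha hb => by rw [mul_add, map_add, ha, hb, map_add]; ring)
      have hfg : f * g ∈ End.maxGenEigenspace (dr (regRep_isRat hO) x) (μ + ν) := by
        rw [End.mem_maxGenEigenspace] at *
        obtain ⟨a, ha⟩ := hf
        obtain ⟨b, hb⟩ := hg
        exact ⟨a + b, genEig_mul _ (LL_mul hO hx) μ ν _ a b f g rfl ha hb⟩
      rw [hD _ _ hf, hD _ _ hg, hD _ _ hfg, hφ, add_smul, mul_smul_comm, mul_smul_comm,
        mul_comm g f, add_comm]
    intro f g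
    simp only [LinearMap.comp_apply, key]
    simp
  · intro M _ _ ρ h μ m hm
    apply dr_eq
    intro ξ
    have h1 := semiconj_genEig (dr h x : End k M) (dr (regRep_isRat hO) x) (coeff h ξ)
      (fun a => (LL_coeff hO h x ξ a).symm) μ hm
    simp [hD _ _ h1]

theorem nilpotent_of_trace [CharZero k] [FiniteDimensional k M] (T : End k M)
    (h : ∀ φ : k →ₗ[ℚ] ℚ, ∃ D : End k M, (∀ μ, ∀ m ∈ T.maxGenEigenspace μ, D m = (φ μ : k) • m) ∧
      LinearMap.trace k M (T * D) = 0) : IsNilpotent T := by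
  classical
  have hI : DirectSum.IsInternal (fun μ => T.maxGenEigenspace μ) :=
    DirectSum.isInternal_submodule_of_iSupIndep_of_iSup_eq_top T.independent_maxGenEigenspace
      T.iSup_maxGenEigenspace_eq_top
  have hN : {μ | T.maxGenEigenspace μ ≠ ⊥}.Finite :=
    WellFoundedGT.finite_ne_bot_of_iSupIndep T.independent_maxGenEigenspace
  have hmaps : ∀ μ, Set.MapsTo T (T.maxGenEigenspace μ) (T.maxGenEigenspace μ) := fun μ =>
    End.mapsTo_maxGenEigenspace_of_comm (Commute.refl T) μ
  have htr : ∀ μ, LinearMap.trace k (T.maxGenEigenspace μ) (T.restrict (hmaps μ)) =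
      finrank k (T.maxGenEigenspace μ) * μ := by
    intro μ
    have h1 := End.isNilpotent_restrict_maxGenEigenspace_sub_algebraMap T μ
    have h2 := (LinearMap.isNilpotent_trace_of_isNilpotent h1).eq_zero
    have h3 : T.restrict (hmaps μ) = LinearMap.restrict (T - algebraMap k (End k M) μ)
      (End.mapsTo_maxGenEigenspace_of_comm (Algebra.mul_sub_algebraMap_commutes T μ) μ) + μ • 1 := by
      ext m
      change T m = (T - algebraMap k (End k M) μ) m + μ • (m : M)
      simp
    rw [h3, map_add, h2, map_smul, LinearMap.trace_one]; simp [mul_comm]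
  have hzero : ∀ μ, T.maxGenEigenspace μ ≠ ⊥ → μ = 0 := by
    intro μ hμ
    rw [← Module.forall_dual_apply_eq_zero_iff ℚ μ]
    intro φ
    obtain ⟨D, hD, htD⟩ := h φ
    have hmaps' : ∀ μ, Set.MapsTo (T * D : End k M) (T.maxGenEigenspace μ) (T.maxGenEigenspace μ) := by
      intro μ m hm
      simp only [SetLike.mem_coe] at *
      rw [End.mul_apply, hD μ m hm]
      exact hmaps μ (Submodule.smul_mem _ _ hm)
    rw [LinearMap.trace_eq_sum_trace_restrict' hI hN hmaps'] at htD
    have h4 : ∀ μ, LinearMap.trace k (T.maxGenEigenspace μ) (LinearMap.restrict (T * D) (hmaps' μ)) =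
      ((φ μ * finrank k (T.maxGenEigenspace μ) : ℚ) : k) * μ := by
      intro μ
      have : LinearMap.restrict (T * D) (hmaps' μ) = (φ μ : k) • T.restrict (hmaps μ) := by
        ext m
        change T (D m) = (φ μ : k) • T m
        rw [hD μ m m.2, map_smul]
      rw [this, map_smul, htr]; push_cast; simp [mul_assoc]
    simp only [h4] at htD
    have h5 := congrArg φ htD
    rw [map_zero, map_sum] at h5
    have h6 : ∀ ν : k, φ (((φ ν * finrank k (T.maxGenEigenspace ν) : ℚ) : k) * ν) =
        φ ν * φ ν * finrank k (T.maxGenEigenspace ν) := by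
      intro ν
      rw [← Rat.smul_def, map_smul, smul_eq_mul]; ring
    simp only [h6] at h5
    rw [Finset.sum_eq_zero_iff_of_nonneg (fun ν _ =>
      mul_nonneg (mul_self_nonneg _) (Nat.cast_nonneg _))] at h5
    have h7 := h5 μ (by simpa using hμ)
    have h8 : (finrank k (T.maxGenEigenspace μ) : ℚ) ≠ 0 := by
      simpa [Submodule.finrank_eq_zero] using hμ
    simpa [h8] using h7
  have htop : T.maxGenEigenspace 0 = ⊤ := by
    rw [← T.iSup_maxGenEigenspace_eq_top]
    apply le_antisymm (le_iSup _ 0)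
    apply iSup_le
    intro μ
    by_cases hμ : T.maxGenEigenspace μ = ⊥
    · rw [hμ]; exact bot_le
    · rw [hzero μ hμ]
  have h1 := End.isNilpotent_restrict_maxGenEigenspace_sub_algebraMap T 0
  obtain ⟨n, hn⟩ := h1
  refine ⟨n, ?_⟩
  ext m
  have hm : m ∈ T.maxGenEigenspace 0 := by rw [htop]; trivial
  have h2 := congrArg Subtype.val (LinearMap.congr_fun hn ⟨m, hm⟩)
  have h3 := semiconj_pow (LinearMap.restrict (T - algebraMap k (End k M) 0)
      (End.mapsTo_maxGenEigenspace_of_comm (Algebra.mul_sub_algebraMap_commutes T 0) 0)) T (T.maxGenEigenspace 0).subtype (fun a => by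
    change (T - algebraMap k (End k M) 0) (a : M) = T a
    simp) 0 n ⟨m, hm⟩
  simp only [zero_smul, sub_zero] at h3
  exact h3.symm.trans h2

end Replica

end PaperGIT

namespace PaperGIT

section Casimir

open Module

variable {k : Type} [Field k] [IsAlgClosed k] [CharZero k] {H : Type} [Group H]
  {O : Subalgebra k (H → k)}
variable {M : Type} [AddCommGroup M] [Module k M]

/-- Ideals of the Lie algebra stable under the adjoint action. -/
structure IsIdl (hO : AffGrp O) (N : Submodule k (O →ₗ[k] k)) : Prop where
  le : N ≤ LieG O
  brk : ∀ x ∈ N, ∀ y ∈ LieG O, brk hO x y ∈ N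
  ad : ∀ x ∈ N, ∀ g, Ad hO g x ∈ N

/-- Abstract form of reductivity. -/
structure RedHyp (hO : AffGrp O) {V : Type} [AddCommGroup V] [Module k V]
    {ρV : Representation k H V} (hV : IsRat O ρV) : Prop where
  fd : FiniteDimensional k V
  inj : ∀ x ∈ LieG O, dr hV x = 0 → x = 0
  nil : ∀ N, IsIdl hO N → (∀ x ∈ N, IsNilpotent (dr hV x)) → N = ⊥

theorem IsIdl.inf {hO : AffGrp O} {N N' : Submodule k (O →ₗ[k] k)} (h : IsIdl hO N)
    (h' : IsIdl hO N') : IsIdl hO (N ⊓ N') where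
  le := inf_le_left.trans h.le
  brk x hx y hy := ⟨h.brk x hx.1 y hy, h'.brk x hx.2 y hy⟩
  ad x hx g := ⟨h.ad x hx.1 g, h'.ad x hx.2 g⟩

theorem isIdl_LieG (hO : AffGrp O) : IsIdl hO (LieG O) where
  le := le_rfl
  brk _ hx _ hy := brk_mem hO hx hy
  ad _ hx g := Ad_mem hO g hx

/-- kernel ideal -/
noncomputable def kerI {ρ : Representation k H M} (h : IsRat O ρ) : Submodule k (O →ₗ[k] k) :=
  LieG O ⊓ LinearMap.ker (drL h)

theorem mem_kerI {ρ : Representation k H M} {h : IsRat O ρ} {x : O →ₗ[k] k} :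
    x ∈ kerI h ↔ x ∈ LieG O ∧ dr h x = 0 := Iff.rfl

theorem isIdl_kerI (hO : AffGrp O) {ρ : Representation k H M} (h : IsRat O ρ) :
    IsIdl hO (kerI h) where
  le := inf_le_left
  brk x hx y hy := by
    rw [mem_kerI] at *
    exact ⟨brk_mem hO hx.1 hy, by rw [dr_brk, hx.2]; simp⟩
  ad x hx g := by
    rw [mem_kerI] at *
    exact ⟨Ad_mem hO g hx.1, by rw [dr_Ad, hx.2]; simp⟩

/-- orthogonal of an ideal for the trace form -/
noncomputable def orthI {ρ : Representation k H M} (h : IsRat O ρ) (N : Submodule k (O →ₗ[k] k)) :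
    Submodule k (O →ₗ[k] k) where
  carrier := {x | x ∈ LieG O ∧ ∀ y ∈ N, LinearMap.trace k M (dr h x * dr h y) = 0}
  add_mem' := by
    rintro a b ⟨ha, ha'⟩ ⟨hb, hb'⟩
    refine ⟨add_mem ha hb, fun y hy => ?_⟩
    rw [← drL_apply, map_add, add_mul, map_add, drL_apply, drL_apply, ha' y hy, hb' y hy, add_zero]
  zero_mem' := ⟨zero_mem _, fun y hy => by rw [← drL_apply, map_zero, zero_mul, map_zero]⟩
  smul_mem' := by
    rintro c a ⟨ha, ha'⟩
    refine ⟨Submodule.smul_mem _ _ ha, fun y hy => ?_⟩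
    rw [← drL_apply, map_smul, smul_mul_assoc, map_smul, drL_apply, ha' y hy, smul_zero]

theorem mem_orthI {ρ : Representation k H M} {h : IsRat O ρ} {N : Submodule k (O →ₗ[k] k)}
    {x : O →ₗ[k] k} :
    x ∈ orthI h N ↔ x ∈ LieG O ∧ ∀ y ∈ N, LinearMap.trace k M (dr h x * dr h y) = 0 := Iff.rfl

theorem isIdl_orthI (hO : AffGrp O) {ρ : Representation k H M} (h : IsRat O ρ)
    {N : Submodule k (O →ₗ[k] k)} (hN : IsIdl hO N) : IsIdl hO (orthI h N) where
  le := fun x hx => hx.1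
  brk x hx y hy := by
    refine ⟨brk_mem hO hx.1 hy, fun z hz => ?_⟩
    have h1 := hx.2 _ (hN.brk z hz y hy)
    rw [dr_brk] at *
    rw [sub_mul, map_sub, sub_eq_zero]
    rw [mul_sub, map_sub, sub_eq_zero] at h1
    rw [mul_assoc, ← h1, mul_assoc, LinearMap.trace_mul_comm k (dr h y), mul_assoc]
  ad x hx g := by
    refine ⟨Ad_mem hO g hx.1, fun z hz => ?_⟩
    have h1 := hx.2 _ (hN.ad z hz g⁻¹)
    rw [dr_Ad] at *
    rw [inv_inv] at h1
    rw [mul_assoc, mul_assoc, LinearMap.trace_mul_comm, ← h1]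
    simp only [mul_assoc]

theorem nilp_of_orth (hO : AffGrp O) {ρ : Representation k H M} (h : IsRat O ρ)
    [FiniteDimensional k M] {x : O →ₗ[k] k} (hx : x ∈ LieG O)
    (P : (O →ₗ[k] k) → Prop)
    (hP : ∀ φ : k →ₗ[ℚ] ℚ, ∀ y ∈ LieG O, (∀ (M : Type) [AddCommGroup M] [Module k M]
      (ρ : Representation k H M) (h : IsRat O ρ) (μ : k),
      ∀ m ∈ End.maxGenEigenspace (dr h x) μ, dr h y m = (φ μ : k) • m) → P y)
    (htr : ∀ y, P y → LinearMap.trace k M (dr h x * dr h y) = 0) : IsNilpotent (dr h x) := by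
  apply nilpotent_of_trace
  intro φ
  obtain ⟨y, hy, hy'⟩ := exists_replica hO hx (fun a => (φ a : k)) (by intro a b; simp)
  exact ⟨dr h y, fun μ m hm => hy' M ρ h μ m hm, htr y (hP φ y hy hy')⟩

theorem replica_zero {ρ : Representation k H M} (h : IsRat O ρ) {x y : O →ₗ[k] k}
    (hx : IsNilpotent (dr h x)) (φ : k →ₗ[ℚ] ℚ)
    (hy : ∀ μ : k, ∀ m ∈ End.maxGenEigenspace (dr h x) μ, dr h y m = (φ μ : k) • m) :
    dr h y = 0 := by
  obtain ⟨n, hn⟩ := hx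
  ext m
  rw [hy 0 m ?_]
  · simp
  · rw [End.mem_maxGenEigenspace]
    refine ⟨n, ?_⟩
    rw [zero_smul, sub_zero, hn]; rfl

theorem RedHyp.lieFd {hO : AffGrp O} {V : Type} [AddCommGroup V] [Module k V]
    {ρV : Representation k H V} {hV : IsRat O ρV} (hR : RedHyp hO hV) :
    FiniteDimensional k (LieG O) := by
  have := hR.fd
  apply FiniteDimensional.of_injective ((drL hV) ∘ₗ (LieG O).subtype)
  rw [injective_iff_map_eq_zero]
  intro a ha
  exact Subtype.ext (hR.inj a a.2 ha)

theorem dual_surj [FiniteDimensional k M] (f : M →ₗ[k] Module.Dual k M) (hf : Function.Injective f) :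
    Function.Surjective f :=
  (LinearMap.injective_iff_surjective_of_finrank_eq_finrank Subspace.dual_finrank_eq.symm).1 hf

theorem trace_faithful {hO : AffGrp O} {V : Type} [AddCommGroup V] [Module k V]
    {ρV : Representation k H V} {hV : IsRat O ρV} (hR : RedHyp hO hV)
    {ρ : Representation k H M} (h : IsRat O ρ) [FiniteDimensional k M] {x : O →ₗ[k] k}
    (hx : x ∈ LieG O) (htr : ∀ y ∈ LieG O, LinearMap.trace k M (dr h x * dr h y) = 0) :
    dr h x = 0 := by
  have := hR.fd
  have := hR.lieFd
  have N1 : kerI h ⊓ orthI hV (kerI h) = ⊥ := by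
    apply hR.nil _ ((isIdl_kerI hO h).inf (isIdl_orthI hO hV (isIdl_kerI hO h)))
    rintro z ⟨hz1, hz2⟩
    apply nilp_of_orth hO hV hz1.1 (fun y => y ∈ kerI h) _ hz2.2
    intro φ y hy hy'
    refine ⟨hy, replica_zero h ?_ φ (fun μ => hy' M ρ h μ)⟩
    rw [show dr h z = 0 from hz1.2]; exact IsNilpotent.zero
  have N2 : orthI h (LieG O) ⊓ orthI hV (kerI h) = ⊥ := by
    apply hR.nil _ ((isIdl_orthI hO h (isIdl_LieG hO)).inf (isIdl_orthI hO hV (isIdl_kerI hO h)))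
    rintro z ⟨hz1, hz2⟩
    have hzE : IsNilpotent (dr h z) :=
      nilp_of_orth hO h hz1.1 (fun y => y ∈ LieG O) (fun _ y hy _ => hy) hz1.2
    apply nilp_of_orth hO hV hz1.1 (fun y => y ∈ kerI h) _ hz2.2
    intro φ y hy hy'
    exact ⟨hy, replica_zero h hzE φ (fun μ => hy' M ρ h μ)⟩
  have : FiniteDimensional k (kerI h) := Submodule.finiteDimensional_of_le (inf_le_left : kerI h ≤ LieG O)
  -- the form
  let B : (O →ₗ[k] k) →ₗ[k] (kerI h) →ₗ[k] k :=
    (((LinearMap.mul k (End k V)).compr₂ (LinearMap.trace k V)).compl₁₂ (drL hV)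
      ((drL hV) ∘ₗ (kerI h).subtype))
  have hB : ∀ a (b : kerI h), B a b = LinearMap.trace k V (dr hV a * dr hV b) := fun a b => rfl
  have hsurj : Function.Surjective (B ∘ₗ (kerI h).subtype) := by
    have hinj : Function.Injective (B ∘ₗ (kerI h).subtype) := by
      rw [injective_iff_map_eq_zero]
      intro a ha
      have : (a : O →ₗ[k] k) ∈ kerI h ⊓ orthI hV (kerI h) :=
        ⟨a.2, a.2.1, fun y hy => by
          have := LinearMap.congr_fun ha ⟨y, hy⟩
          simpa [hB] using this⟩
      rw [N1] at this
      exact Subtype.ext this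
    exact dual_surj (M := kerI h) (B ∘ₗ (kerI h).subtype) hinj
  obtain ⟨κ, hκ⟩ := hsurj (B x)
  have hmem : x - κ ∈ orthI h (LieG O) ⊓ orthI hV (kerI h) := by
    refine ⟨⟨sub_mem hx κ.2.1, fun y hy => ?_⟩, sub_mem hx κ.2.1, fun y hy => ?_⟩
    · rw [← drL_apply, map_sub, sub_mul, map_sub, drL_apply, drL_apply, htr y hy,
        show dr h κ = 0 from κ.2.2]; simp
    · have := LinearMap.congr_fun hκ ⟨y, hy⟩
      rw [LinearMap.comp_apply, hB, hB] at this
      rw [← drL_apply, map_sub, sub_mul, map_sub, drL_apply, drL_apply, sub_eq_zero]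
      exact this.symm
  rw [N2, Submodule.mem_bot, sub_eq_zero] at hmem
  rw [hmem]; exact κ.2.2

/-- `𝔤 M` -/
def gSpan {ρ : Representation k H M} (h : IsRat O ρ) : Submodule k M :=
  Submodule.span k {m | ∃ x ∈ LieG O, ∃ m', m = dr h x m'}

theorem exists_casimir {hO : AffGrp O} {V : Type} [AddCommGroup V] [Module k V]
    {ρV : Representation k H V} {hV : IsRat O ρV} (hR : RedHyp hO hV)
    {ρ : Representation k H M} (h : IsRat O ρ) [FiniteDimensional k M] :
    ∃ C : End k M, (∀ g, ρ g * C * ρ g⁻¹ = C) ∧ (LinearMap.trace k M C = 0 → ∀ x ∈ LieG O, dr h x = 0) ∧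
      ∀ m, C m ∈ gSpan h := by
  classical
  let 𝔤 : Submodule k (End k M) := (LieG O).map (drL h)
  have : FiniteDimensional k 𝔤 := FiniteDimensional.finiteDimensional_submodule 𝔤
  have : Module.Free k 𝔤 := Module.Free.of_divisionRing k 𝔤
  let B : LinearMap.BilinForm k 𝔤 :=
    (((LinearMap.mul k (End k M)).compr₂ (LinearMap.trace k M)).compl₁₂ 𝔤.subtype 𝔤.subtype)
  have hB : ∀ a b : 𝔤, B a b = LinearMap.trace k M ((a : End k M) * (b : End k M)) := fun a b => rfl
  have hsymm : ∀ a b, B a b = B b a := fun a b => by rw [hB, hB, LinearMap.trace_mul_comm]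
  have hnd : B.Nondegenerate := by
    have : ∀ a, (∀ b, B a b = 0) → a = 0 := by
      rintro ⟨_, x, hx, rfl⟩ ha
      apply Subtype.ext
      exact trace_faithful hR h hx fun y hy => ha ⟨_, y, hy, rfl⟩
    exact ⟨this, fun a ha => this a fun b => by rw [hsymm]; exact ha b⟩
  let e := Module.finBasis k 𝔤
  let e' := B.dualBasis hnd e
  have exp1 : ∀ x : 𝔤, x = ∑ i, B x (e i) • e' i := by
    intro x
    conv_lhs => rw [← e'.sum_repr x]
    simp only [e', LinearMap.BilinForm.dualBasis_repr_apply]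
  have pair : ∀ i j, B (e' i) (e j) = if j = i then 1 else 0 := fun i j =>
    LinearMap.BilinForm.apply_dualBasis_left _ _ _ _
  have exp2 : ∀ x : 𝔤, x = ∑ i, B x (e' i) • e i := by
    intro x
    conv_lhs => rw [← e.sum_repr x]
    congr 1; funext i; congr 1
    rw [hsymm]
    conv_rhs => rw [← e.sum_repr x]
    rw [map_sum]
    simp only [map_smul, pair]
    simp
  have cjmem : ∀ (g : H) (a : 𝔤), ρ g * (a : End k M) * ρ g⁻¹ ∈ 𝔤 := by
    rintro g ⟨_, x, hx, rfl⟩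
    exact ⟨Ad hO g x, Ad_mem hO g hx, dr_Ad hO h x g⟩
  let c : H → 𝔤 → 𝔤 := fun g a => ⟨_, cjmem g a⟩
  have hc : ∀ g a, (c g a : End k M) = ρ g * (a : End k M) * ρ g⁻¹ := fun g a => rfl
  have hρ : ∀ g, ρ g * ρ g⁻¹ = 1 := fun g => by rw [← map_mul]; simp
  have hρ' : ∀ g, ρ g⁻¹ * ρ g = 1 := fun g => by rw [← map_mul]; simp
  have cB : ∀ g a b, B (c g a) b = B a (c g⁻¹ b) := by
    intro g a b
    rw [hB, hB, hc, hc, inv_inv, mul_assoc, mul_assoc, LinearMap.trace_mul_comm]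
    simp only [mul_assoc]
  refine ⟨∑ i, (e i : End k M) * (e' i : End k M), fun g => ?_, fun ht x hx => ?_, fun m => ?_⟩
  · have h1 : ∀ j, (c g (e j) : End k M) = ∑ i, B (c g (e j)) (e' i) • (e i : End k M) := by
      intro j
      conv_lhs => rw [exp2 (c g (e j))]
      simp
    have h2 : ∀ i, (e' i : End k M) = ∑ j, B (c g (e j)) (e' i) • (c g (e' j) : End k M) := by
      intro i
      have h3 : (e' i : End k M) = ρ g * (c g⁻¹ (e' i) : End k M) * ρ g⁻¹ := by
        rw [hc, inv_inv, ← mul_assoc, ← mul_assoc, hρ, one_mul, mul_assoc, hρ, mul_one]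
      have h4 : (c g⁻¹ (e' i) : End k M) = ∑ j, B (c g⁻¹ (e' i)) (e j) • (e' j : End k M) := by
        conv_lhs => rw [exp1 (c g⁻¹ (e' i))]
        simp
      rw [h3, h4, Finset.mul_sum, Finset.sum_mul]
      congr 1; funext j
      rw [hc g (e' j), mul_smul_comm, smul_mul_assoc, hsymm, ← cB]
    calc ρ g * (∑ i, (e i : End k M) * (e' i : End k M)) * ρ g⁻¹
        = ∑ j, (c g (e j) : End k M) * (c g (e' j) : End k M) := by
          rw [Finset.mul_sum, Finset.sum_mul]
          congr 1; funext j
          rw [hc, hc]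
          simp only [mul_assoc]
          rw [← mul_assoc (ρ g⁻¹) (ρ g), hρ', one_mul]
      _ = ∑ j, ∑ i, B (c g (e j)) (e' i) • ((e i : End k M) * (c g (e' j) : End k M)) := by
          congr 1; funext j
          rw [h1 j, Finset.sum_mul]
          simp only [smul_mul_assoc]
      _ = ∑ i, (e i : End k M) * (e' i : End k M) := by
          rw [Finset.sum_comm]
          congr 1; funext i
          conv_rhs => rw [h2 i]
          rw [Finset.mul_sum]
          simp only [mul_smul_comm]
  · have h1 : LinearMap.trace k M (∑ i, (e i : End k M) * (e' i : End k M)) = finrank k 𝔤 := by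
      rw [map_sum]
      have : ∀ i, LinearMap.trace k M ((e i : End k M) * (e' i : End k M)) = 1 := by
        intro i
        rw [← hB, hsymm, pair]; simp
      simp [this]
    rw [h1, Nat.cast_eq_zero, Submodule.finrank_eq_zero] at ht
    have : dr h x ∈ 𝔤 := ⟨x, hx, rfl⟩
    rw [ht] at this
    exact this
  · rw [LinearMap.sum_apply]
    refine Submodule.sum_mem _ fun i _ => Submodule.subset_span ?_
    obtain ⟨x, hx, hx'⟩ := (e i).2
    exact ⟨x, hx, (e' i : End k M) m, by rw [Module.End.mul_apply, ← hx']; rfl⟩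

theorem lie_decomp {hO : AffGrp O} {V : Type} [AddCommGroup V] [Module k V]
    {ρV : Representation k H V} {hV : IsRat O ρV} (hR : RedHyp hO hV) (d : ℕ) :
    ∀ (M : Type) [AddCommGroup M] [Module k M] (ρ : Representation k H M) (h : IsRat O ρ)
      [FiniteDimensional k M], finrank k M ≤ d → ∀ m : M, ∃ m0 ∈ gSpan h, ∀ x ∈ LieG O,
        dr h x (m - m0) = 0 := by
  induction d with
  | zero =>
    intro M _ _ ρ h _ hd m
    have := finrank_zero_iff.1 (Nat.le_zero.1 hd)
    exact ⟨0, zero_mem _, fun x _ => Subsingleton.elim _ _⟩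
  | succ d ih =>
    intro M _ _ ρ h _ hd m
    obtain ⟨C, hC, hC0, hCm⟩ := exists_casimir hR h
    have hcomm : ∀ g n a, ρ g ((C ^ n) a) = (C ^ n) (ρ g a) := by
      intro g n
      have h1 : Commute (ρ g) C := by
        change ρ g * C = C * ρ g
        conv_rhs => rw [← hC g]
        rw [mul_assoc, ← map_mul]; simp
      intro a
      exact LinearMap.congr_fun (h1.pow_right n) a
    by_cases hnil : IsNilpotent C
    · refine ⟨0, zero_mem _, fun x hx => ?_⟩
      rw [hC0 (LinearMap.isNilpotent_trace_of_isNilpotent hnil).eq_zero x hx]; rfl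
    obtain ⟨n, hn⟩ : ∃ n, ⨆ n, (C ^ n).ker = (C ^ (n + 1)).ker := by
      obtain ⟨n, hn⟩ := monotone_stabilizes_iff_noetherian.2 (inferInstance : IsNoetherian k M)
        ⟨fun n => (C ^ n).ker, fun a b hab x hx => by
          rw [LinearMap.mem_ker] at *; exact Module.End.pow_map_zero_of_le hab hx⟩
      refine ⟨n, le_antisymm (iSup_le fun j => ?_) (le_iSup (fun n => (C ^ n).ker) (n + 1))⟩
      intro x hx
      have h1 := hn (n + 1) (by omega)
      have h2 := hn (n + 1 + j) (by omega)
      change (C ^ n).ker = (C ^ (n + 1)).ker at h1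
      change (C ^ n).ker = (C ^ (n + 1 + j)).ker at h2
      rw [← h1, h2]
      exact Module.End.pow_map_zero_of_le (by omega) hx
    have hcompl := LinearMap.isCompl_iSup_ker_pow_iInf_range_pow C
    rw [hn] at hcompl
    have hm : m ∈ (C ^ (n + 1)).ker ⊔ ⨅ n, (C ^ n).range := by rw [hcompl.sup_eq_top]; trivial
    obtain ⟨a, ha, b, hb, rfl⟩ := Submodule.mem_sup.1 hm
    have hb' : b ∈ gSpan h := by
      obtain ⟨c, hc⟩ := (Submodule.mem_iInf _).1 hb 1
      rw [← hc, pow_one]; exact hCm c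
    have hst : ∀ g, ∀ m ∈ (C ^ (n + 1)).ker, ρ g m ∈ (C ^ (n + 1)).ker := by
      intro g m hm
      rw [LinearMap.mem_ker] at *
      rw [← hcomm, hm, map_zero]
    have hlt : finrank k (C ^ (n + 1)).ker < finrank k M := by
      apply Submodule.finrank_lt
      intro htop
      apply hnil
      exact ⟨n + 1, LinearMap.ker_eq_top.1 htop⟩
    obtain ⟨m0, hm0, hx⟩ := ih _ (resRep ρ _ hst) (resRep_isRat h _ hst) (by omega) ⟨a, ha⟩
    refine ⟨m0 + b, add_mem ?_ hb', fun x hx' => ?_⟩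
    · have : gSpan (resRep_isRat h _ hst) ≤ (gSpan h).comap (C ^ (n + 1)).ker.subtype := by
        rw [gSpan, Submodule.span_le]
        rintro _ ⟨x, hx, m', rfl⟩
        apply Submodule.subset_span
        exact ⟨x, hx, m', dr_res h _ hst x m'⟩
      exact this hm0
    · have := congrArg Subtype.val (hx x hx')
      rw [dr_res] at this
      simpa using this

end Casimir

end PaperGIT

namespace PaperGIT

section Cartier

open Module

theorem cotangent_family {k : Type} [Field k] {A : Type} [CommRing A] [Algebra k A] [IsNoetherianRing A]
    (ε : A →ₐ[k] k) :
    ∃ (r : ℕ) (x : Fin r → A) (l : Fin r → (A →ₗ[k] k)), (∀ j, ε (x j) = 0) ∧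
      (∀ j f g, l j (f * g) = ε f * l j g + ε g * l j f) ∧
      ∀ y, ε y = 0 → y - ∑ j, l j y • x j ∈ (RingHom.ker ε) ^ 2 := by
  classical
  set m : Ideal A := RingHom.ker ε with hm
  have memm : ∀ y, y ∈ m ↔ ε y = 0 := fun y => RingHom.mem_ker
  let W : Submodule k A := (m ^ 2).restrictScalars k ⊔ Submodule.span k {1}
  have W1 : (1 : A) ∈ W := Submodule.mem_sup_right (Submodule.mem_span_singleton_self _)
  have W2 : ∀ y ∈ m ^ 2, y ∈ W := fun y hy => Submodule.mem_sup_left hy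
  have sub : ∀ y : A, y - algebraMap k A (ε y) ∈ m := by
    intro y; rw [memm]; simp
  have hfd : FiniteDimensional k (A ⧸ W) := by
    obtain ⟨S, hS⟩ := (isNoetherianRing_iff_ideal_fg A).1 inferInstance m
    refine ⟨⟨S.image W.mkQ, ?_⟩⟩
    rw [eq_top_iff]
    have key : ∀ y ∈ m, W.mkQ y ∈ Submodule.span k ((S.image W.mkQ : Finset (A ⧸ W)) : Set (A ⧸ W)) := by
      intro y hy
      rw [← hS] at hy
      refine Submodule.span_induction (p := fun y _ => W.mkQ y ∈ Submodule.span k ((S.image W.mkQ : Finset (A ⧸ W)) : Set (A ⧸ W))) ?_ ?_ ?_ ?_ hy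
      · intro z hz; apply Submodule.subset_span; simp only [Finset.coe_image]; exact ⟨z, hz, rfl⟩
      · simp
      · intro a b _ _ ha hb; rw [map_add]; exact Submodule.add_mem _ ha hb
      · intro a z hz h
        have hz' : z ∈ m := hS ▸ hz
        have : W.mkQ (a • z) = ε a • W.mkQ z := by
          rw [← map_smul, ← sub_eq_zero, ← map_sub, Submodule.mkQ_apply, Submodule.Quotient.mk_eq_zero]
          apply W2
          have := Ideal.mul_mem_mul (sub a) hz'
          rw [← pow_two] at this
          convert this using 1
          rw [smul_eq_mul, Algebra.smul_def]; ring
        rw [this]; exact Submodule.smul_mem _ _ h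
    intro q _
    obtain ⟨y, rfl⟩ := W.mkQ_surjective q
    have h := key _ (sub y)
    have : W.mkQ (algebraMap k A (ε y)) = 0 := by
      rw [Submodule.mkQ_apply, Submodule.Quotient.mk_eq_zero, Algebra.algebraMap_eq_smul_one]
      exact W.smul_mem _ W1
    rwa [map_sub, this, sub_zero] at h
  let b := Module.finBasis k (A ⧸ W)
  choose x0 hx0 using fun j => W.mkQ_surjective (b j)
  refine ⟨_, fun j => x0 j - algebraMap k A (ε (x0 j)), fun j => (b.coord j) ∘ₗ W.mkQ, ?_, ?_, ?_⟩
  · intro j; simp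
  · intro j f g
    have e : W.mkQ (f * g) = ε f • W.mkQ g + ε g • W.mkQ f := by
      rw [← map_smul, ← map_smul, ← map_add, ← sub_eq_zero, ← map_sub, Submodule.mkQ_apply, Submodule.Quotient.mk_eq_zero]
      have h1 := W2 _ (by have := Ideal.mul_mem_mul (sub f) (sub g); rwa [← pow_two] at this)
      have h2 := W.smul_mem (ε f * ε g) W1
      convert W.sub_mem h1 h2 using 1
      simp only [Algebra.smul_def, map_mul]; ring
    simp only [LinearMap.comp_apply, e, map_add, map_smul, smul_eq_mul]
  · intro y hy
    have h : y - ∑ j, ((b.coord j) ∘ₗ W.mkQ) y • (x0 j - algebraMap k A (ε (x0 j))) ∈ W := by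
      rw [← Submodule.Quotient.mk_eq_zero, ← Submodule.mkQ_apply, map_sub, map_sum]
      have e : ∀ j, W.mkQ (x0 j - algebraMap k A (ε (x0 j))) = b j := by
        intro j
        rw [map_sub, hx0, sub_eq_self, Submodule.mkQ_apply, Submodule.Quotient.mk_eq_zero, Algebra.algebraMap_eq_smul_one]
        exact W.smul_mem _ W1
      simp only [map_smul, e, LinearMap.comp_apply, Basis.coord_apply, b.sum_repr, sub_self]
    have hε : ε (y - ∑ j, ((b.coord j) ∘ₗ W.mkQ) y • (x0 j - algebraMap k A (ε (x0 j)))) = 0 := by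
      simp [hy]
    obtain ⟨w, hw, c, hc, e⟩ := Submodule.mem_sup.1 h
    obtain ⟨a, rfl⟩ := Submodule.mem_span_singleton.1 hc
    rw [← e] at hε ⊢
    have : ε w = 0 := (memm _).1 (Ideal.pow_le_self two_ne_zero hw)
    have : a = 0 := by simpa [this] using hε
    simpa [this] using hw

theorem euler_pow {k : Type} [Field k] [CharZero k] {A : Type} [CommRing A] [Algebra k A]
    (m : Ideal A) (E : A →ₗ[k] A) (hE : ∀ f g, E (f * g) = f * E g + g * E f)
    (h1 : ∀ y ∈ m, E y - y ∈ m ^ 2) (f : A) (hf : f ∈ m) (h0 : E f = 0) : ∀ s : ℕ, f ∈ m ^ s := by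
  have key : ∀ s : ℕ, ∀ y ∈ m ^ (s+1), E y - ((s+1 : ℕ) : k) • y ∈ m ^ (s + 2) := by
    intro s
    induction s with
    | zero => intro y hy; simpa using h1 y (by simpa using hy)
    | succ s ih =>
      intro y hy
      rw [pow_succ] at hy
      refine Submodule.mul_induction_on hy ?_ ?_
      · intro a ha b hb
        have e1 := Ideal.mul_mem_mul (ih a ha) hb
        have e2 := Ideal.mul_mem_mul ha (h1 b hb)
        rw [← pow_succ] at e1
        rw [← pow_add] at e2
        convert Ideal.add_mem _ e1 e2 using 1
        rw [hE, Algebra.smul_def, Algebra.smul_def]; push_cast [map_natCast, map_add]; ring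
      · intro a b ha hb
        convert Ideal.add_mem _ ha hb using 1
        rw [map_add, smul_add]; ring
  intro s
  induction s with
  | zero => simp
  | succ s ih =>
    cases s with
    | zero => simpa using hf
    | succ s =>
      have := key s f ih
      rw [h0, zero_sub, neg_mem_iff] at this
      have h2 := Submodule.smul_mem ((m ^ (s+2)).restrictScalars k) (((s+1 : ℕ) : k)⁻¹) this
      rwa [smul_smul, inv_mul_cancel₀ (by exact_mod_cast Nat.succ_ne_zero s), one_smul] at h2

variable {k : Type} [Field k] [IsAlgClosed k] {H : Type} [Group H]
  {O : Subalgebra k (H → k)}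

theorem exists_algHom_of_field {F : Type} [Field F] [Algebra k F] [Algebra.FiniteType k F] :
    Nonempty (F →ₐ[k] k) := by
  have : Module.Finite k F := finite_of_finite_type_of_isJacobsonRing k F
  exact ⟨IsAlgClosed.lift⟩

theorem exists_algHom_of_ne_top {A : Type} [CommRing A] [Algebra k A] [Algebra.FiniteType k A]
    (I : Ideal A) (hne : I ≠ ⊤) : ∃ χ : A →ₐ[k] k, ∀ f ∈ I, χ f = 0 := by
  obtain ⟨M, hM, hle⟩ := Ideal.exists_le_maximal I hne
  let _ : Field (A ⧸ M) := Ideal.Quotient.field M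
  obtain ⟨φ⟩ := exists_algHom_of_field (k := k) (F := A ⧸ M)
  refine ⟨φ.comp (Ideal.Quotient.mkₐ k M), fun f hf => ?_⟩
  rw [AlgHom.comp_apply]
  have : Ideal.Quotient.mkₐ k M f = 0 := Ideal.Quotient.eq_zero_iff_mem.2 (hle hf)
  rw [this, map_zero]

theorem AffGrp.ideal_top (hO : AffGrp O) (I : Ideal O) (hI : ∀ g, ∃ f ∈ I, f.1 g ≠ 0) : I = ⊤ := by
  by_contra hne
  have := hO.fg
  obtain ⟨φ, hφ⟩ := exists_algHom_of_ne_top (k := k) I hne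
  obtain ⟨g, hg⟩ := hO.pts φ
  obtain ⟨f, hf, hfg⟩ := hI g
  apply hfg
  rw [← hg, hφ f hf]

/-- Cartier: a function killed by all derivations is locally constant at `1`. -/
theorem AffGrp.loc_const [CharZero k] (hO : AffGrp O) (f : O) (hf : ∀ x ∈ LieG O, LL hO x f = 0) :
    ∃ e : O, e.1 1 = 1 ∧ e * (f - algebraMap k O (f.1 1)) = 0 := by
  have := hO.fg
  have : IsNoetherianRing O := Algebra.FiniteType.isNoetherianRing k O
  obtain ⟨r, x, l, hx, hl, hy⟩ := cotangent_family (evO O (1 : H))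
  have hlm : ∀ j, l j ∈ LieG O := fun j f g => hl j f g
  have hev : ∀ f : O, evO O (1:H) f = f.1 1 := fun f => rfl
  let E : O →ₗ[k] O := ∑ j, (LinearMap.mulLeft k (x j)) ∘ₗ (LL hO (l j))
  have hEa : ∀ y, E y = ∑ j, x j * LL hO (l j) y := by intro y; simp [E]
  set m := RingHom.ker (evO O (1:H)) with hm
  have E1 : ∀ f g, E (f * g) = f * E g + g * E f := by
    intro f g
    rw [hEa, hEa, hEa, Finset.mul_sum, Finset.mul_sum, ← Finset.sum_add_distrib]
    refine Finset.sum_congr rfl fun j _ => ?_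
    rw [LL_mul hO (hlm j)]; ring
  have E2 : ∀ y ∈ m, E y - y ∈ m ^ 2 := by
    intro y hym
    have h1 := hy y hym
    have h2 : E y - ∑ j, l j y • x j ∈ m ^ 2 := by
      rw [hEa, ← Finset.sum_sub_distrib]
      refine Ideal.sum_mem _ fun j _ => ?_
      have a1 : x j ∈ m := hx j
      have a2 : LL hO (l j) y - algebraMap k O (l j y) ∈ m := by
        change evO O 1 _ = 0
        rw [map_sub, hev, LL_one, AlgHom.commutes]; simp
      have := Ideal.mul_mem_mul a1 a2
      rw [← pow_two] at this
      convert this using 1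
      rw [Algebra.smul_def]; ring
    convert Ideal.sub_mem _ h2 h1 using 1
    ring
  have E3 : E (f - algebraMap k O (f.1 1)) = 0 := by
    rw [map_sub, hEa, hEa, Finset.sum_eq_zero, Finset.sum_eq_zero, sub_zero]
    · intro j _
      have : LL hO (l j) (1 : O) = 0 := by
        have h := LL_mul hO (hlm j) 1 1
        simpa using h
      rw [Algebra.algebraMap_eq_smul_one, map_smul, this, smul_zero, mul_zero]
    · intro j _; rw [hf _ (hlm j), mul_zero]
  have hfm : f - algebraMap k O (f.1 1) ∈ m := by
    change evO O 1 _ = 0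
    rw [map_sub, hev, AlgHom.commutes]; simp
  have hp := euler_pow m E E1 E2 _ hfm E3
  have : (f - algebraMap k O (f.1 1)) ∈ (⨅ i : ℕ, m ^ i • ⊤ : Submodule O O) := by
    rw [Submodule.mem_iInf]; intro i; simpa using hp i
  obtain ⟨r, hr⟩ := (Ideal.mem_iInf_smul_pow_eq_bot_iff m _).1 this
  refine ⟨1 - r.1, ?_, ?_⟩
  · have : (r.1 : O).1 1 = 0 := r.2
    change (1 : k) - (r.1 : O).1 1 = 1
    rw [this, sub_zero]
  · rw [sub_mul, one_mul]
    rw [smul_eq_mul] at hr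
    rw [hr, sub_self]

theorem AffGrp.finite_range [CharZero k] (hO : AffGrp O) (f : O) (hf : ∀ x ∈ LieG O, LL hO x f = 0) :
    (Set.range f.1).Finite := by
  let J : Ideal O :=
    { carrier := {e | ∃ p : Polynomial k, p ≠ 0 ∧ e * Polynomial.aeval f p = 0}
      zero_mem' := ⟨1, one_ne_zero, by simp⟩
      add_mem' := by
        rintro a b ⟨p, hp, hp'⟩ ⟨q, hq, hq'⟩
        refine ⟨p * q, mul_ne_zero hp hq, ?_⟩
        rw [map_mul]
        calc (a + b) * (Polynomial.aeval f p * Polynomial.aeval f q) = (a * Polynomial.aeval f p) * Polynomial.aeval f q + (b * Polynomial.aeval f q) * Polynomial.aeval f p := by ring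
          _ = 0 := by rw [hp', hq']; ring
      smul_mem' := by
        rintro c a ⟨p, hp, hp'⟩
        exact ⟨p, hp, by rw [smul_eq_mul, mul_assoc, hp', mul_zero]⟩ }
  have hJ : J = ⊤ := by
    apply hO.ideal_top
    intro g
    have h1 : ∀ x ∈ LieG O, LL hO x (lt hO g f) = 0 := by
      intro x hx; rw [LL_lt, hf x hx, map_zero]
    obtain ⟨e, he, he'⟩ := hO.loc_const _ h1
    refine ⟨lt hO g⁻¹ e, ⟨Polynomial.X - Polynomial.C (f.1 g), Polynomial.X_sub_C_ne_zero _, ?_⟩, ?_⟩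
    · have := congrArg (lt hO g⁻¹) he'
      rw [map_mul, map_sub, AlgHom.commutes, map_zero] at this
      have e2 : lt hO g⁻¹ (lt hO g f) = f := by
        apply Subtype.ext; funext h; simp
      rw [e2] at this
      simpa using this
    · simp [he]
  obtain ⟨p, hp, h⟩ : (1 : O) ∈ J := hJ ▸ Submodule.mem_top
  classical
  rw [one_mul] at h
  refine (p.roots.toFinset.finite_toSet).subset ?_
  rintro _ ⟨g, rfl⟩
  simp only [Finset.mem_coe, Multiset.mem_toFinset]
  rw [Polynomial.mem_roots hp, Polynomial.IsRoot]
  have := congrArg (evO O g) h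
  rw [← Polynomial.aeval_algHom_apply, map_zero] at this
  simpa using this

/-- Linear reductivity. -/
theorem linRed [CharZero k] (hO : AffGrp O) {V : Type} [AddCommGroup V] [Module k V]
    {ρV : Representation k H V} {hV : IsRat O ρV} (hR : RedHyp hO hV)
    {M : Type} [AddCommGroup M] [Module k M] {ρ : Representation k H M} (h : IsRat O ρ)
    (U : Submodule k M) (b : M) (hb : ∀ g, ρ g b - b ∈ U) :
    ∃ u ∈ U, ∀ g, ρ g (b - u) = b - u := by
  classical
  let M' := orbSpan ρ b
  have hM' := orbSpan_stable ρ b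
  have : FiniteDimensional k M' := orbSpan_fd h b
  have hsub : ∀ m ∈ M', ∀ g, ρ g m - m ∈ U := by
    intro m hm g
    refine Submodule.span_induction (p := fun m _ => ρ g m - m ∈ U) ?_ ?_ ?_ ?_ hm
    · rintro _ ⟨g', rfl⟩
      have e : ρ g (ρ g' b) - ρ g' b = (ρ (g * g') b - b) - (ρ g' b - b) := by
        rw [map_mul]; simp
      change ρ g (ρ g' b) - ρ g' b ∈ U
      rw [e]; exact U.sub_mem (hb _) (hb _)
    · simp
    · intro x y _ _ hx hy
      rw [map_add, add_sub_add_comm]; exact U.add_mem hx hy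
    · intro c x _ hx
      rw [map_smul, ← smul_sub]; exact U.smul_mem _ hx
  let h' := resRep_isRat h M' hM'
  obtain ⟨m0, hm0, hinv⟩ := lie_decomp hR (finrank k M') M' _ h' le_rfl ⟨b, mem_orbSpan ρ b⟩
  have hm0U : (m0 : M) ∈ U := by
    have : gSpan h' ≤ U.comap M'.subtype := by
      refine Submodule.span_le.2 ?_
      rintro _ ⟨x, hx, m', rfl⟩
      change ((dr h' x m' : M') : M) ∈ U
      rw [dr_res]
      exact dr_mem_of_sub h U hx (hsub m'.1 m'.2)
    exact this hm0
  set m1 : M' := ⟨b, mem_orbSpan ρ b⟩ - m0 with hm1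
  -- finite orbit
  have hfin : (Set.range fun g => resRep ρ M' hM' g m1).Finite := by
    let B := finBasis k M'
    have hc : ∀ j, (Set.range (coeff h' (B.coord j) m1).1).Finite := by
      intro j
      apply hO.finite_range
      intro x hx
      rw [LL_coeff, hinv x hx, map_zero]
    have : (Set.pi Set.univ fun j => Set.range (coeff h' (B.coord j) m1).1).Finite := Set.Finite.pi fun j => hc j
    refine (this.image B.equivFun.symm).subset ?_
    rintro _ ⟨g, rfl⟩
    refine ⟨B.equivFun (resRep ρ M' hM' g m1), ?_, ?_⟩
    · intro j _
      exact ⟨g, by rw [coeff_apply]; rfl⟩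
    · simp
  let S := hfin.toFinset
  have hS : ∀ m, m ∈ S ↔ ∃ g, resRep ρ M' hM' g m1 = m := by intro m; simp [S]
  have hSne : (S.card : k) ≠ 0 := by
    have : m1 ∈ S := (hS _).2 ⟨1, by simp⟩
    exact_mod_cast (Finset.card_pos.2 ⟨_, this⟩).ne'
  set avg : M := (S.card : k)⁻¹ • ∑ m ∈ S, (m : M) with havg
  have avginv : ∀ g, ρ g avg = avg := by
    intro g
    rw [havg, map_smul, map_sum]
    congr 1
    refine Finset.sum_bij (fun m _ => resRep ρ M' hM' g m) ?_ ?_ ?_ ?_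
    · intro m hm
      obtain ⟨g', rfl⟩ := (hS _).1 hm
      refine (hS _).2 ⟨g * g', by rw [map_mul]; rfl⟩
    · intro a _ c _ hac
      have := congrArg (resRep ρ M' hM' g⁻¹) hac
      simpa [← Module.End.mul_apply, ← map_mul] using this
    · intro m hm
      obtain ⟨g', rfl⟩ := (hS _).1 hm
      refine ⟨resRep ρ M' hM' (g⁻¹ * g') m1, (hS _).2 ⟨_, rfl⟩, ?_⟩
      rw [← Module.End.mul_apply, ← map_mul]; simp
    · intro m _; rw [resRep_apply]
  have hbavg : b - avg ∈ U := by
    have : b - avg = (S.card : k)⁻¹ • ∑ m ∈ S, (b - (m : M)) := by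
      rw [Finset.sum_sub_distrib, smul_sub, Finset.sum_const, ← Nat.cast_smul_eq_nsmul k, smul_smul, inv_mul_cancel₀ hSne, one_smul]
    rw [this]
    refine U.smul_mem _ (U.sum_mem fun m hm => ?_)
    obtain ⟨g, rfl⟩ := (hS _).1 hm
    rw [resRep_apply]
    have e1 := hsub m1.1 m1.2 g
    have e2 : b - (m1 : M) = m0 := by rw [hm1]; simp
    have : b - ρ g m1 = (m0 : M) - (ρ g m1 - m1) := by rw [← e2]; abel
    rw [this]
    exact U.sub_mem hm0U e1
  refine ⟨b - avg, hbavg, fun g => ?_⟩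
  rw [sub_sub_cancel]; exact avginv g

end Cartier

end PaperGIT

namespace PaperGIT

section Reg

variable {k : Type} [Field k]

/-- Algebra of polynomial functions on a family of points of affine space. -/
noncomputable def reg {P σ : Type} (e : P → σ → k) : Subalgebra k (P → k) :=
  (MvPolynomial.aeval (R := k) (fun s (p : P) => e p s)).range

theorem aeval_pts {P σ : Type} (e : P → σ → k) (f : MvPolynomial σ k) (p : P) :
    MvPolynomial.aeval (R := k) (fun s (p : P) => e p s) f p = MvPolynomial.eval (e p) f := by
  have := MvPolynomial.comp_aeval_apply (R := k) (fun s (p : P) => e p s) (Pi.evalAlgHom k (fun _ : P => k) p) f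
  simp only [Pi.evalAlgHom_apply] at this
  rw [this, MvPolynomial.aeval_eq_eval]

theorem mem_reg {P σ : Type} {e : P → σ → k} {F : P → k} :
    F ∈ reg e ↔ ∃ f : MvPolynomial σ k, ∀ p, F p = MvPolynomial.eval (e p) f := by
  constructor
  · rintro ⟨f, rfl⟩; exact ⟨f, fun p => aeval_pts e f p⟩
  · rintro ⟨f, hf⟩; exact ⟨f, by funext p; rw [hf]; exact aeval_pts e f p⟩

theorem coord_mem_reg {P σ : Type} (e : P → σ → k) (s : σ) : (fun p => e p s) ∈ reg e :=
  mem_reg.2 ⟨MvPolynomial.X s, fun p => by simp⟩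

theorem eval_mem_reg {P σ : Type} (e : P → σ → k) (f : MvPolynomial σ k) :
    (fun p => MvPolynomial.eval (e p) f) ∈ reg e := mem_reg.2 ⟨f, fun _ => rfl⟩

theorem reg_le {P σ : Type} {e : P → σ → k} {S : Subalgebra k (P → k)} (h : ∀ s, (fun p => e p s) ∈ S) :
    reg e ≤ S := by
  rintro F ⟨f, rfl⟩
  change MvPolynomial.aeval _ f ∈ S
  induction f using MvPolynomial.induction_on with
  | C a => rw [MvPolynomial.aeval_C]; exact S.algebraMap_mem a
  | add p q hp hq => rw [map_add]; exact S.add_mem hp hq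
  | mul_X p s hp => rw [map_mul, MvPolynomial.aeval_X]; exact S.mul_mem hp (h s)

theorem reg_fg {P σ : Type} [Finite σ] (e : P → σ → k) : Algebra.FiniteType k (reg e) :=
  Algebra.FiniteType.of_surjective (MvPolynomial.aeval (R := k) (fun s (p : P) => e p s)).rangeRestrict
    (AlgHom.rangeRestrict_surjective _)

/-- Functions on a product which are finite sums of products of functions. -/
noncomputable def tens {P Q : Type} (A : Subalgebra k (P → k)) (B : Subalgebra k (Q → k)) : Subalgebra k (P × Q → k) :=
  Algebra.adjoin k {F | ∃ φ ∈ A, ∃ ψ ∈ B, ∀ z, F z = φ z.1 * ψ z.2}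

theorem mem_tens {P Q : Type} {A : Subalgebra k (P → k)} {B : Subalgebra k (Q → k)} {F : P × Q → k} :
    F ∈ tens A B ↔ ∃ (N : ℕ) (φ : Fin N → A) (ψ : Fin N → B), ∀ p q, F (p, q) = ∑ i, (φ i).1 p * (ψ i).1 q := by
  constructor
  · intro h
    let S : Submonoid (P × Q → k) :=
      { carrier := {F | ∃ φ ∈ A, ∃ ψ ∈ B, ∀ z, F z = φ z.1 * ψ z.2}
        one_mem' := ⟨1, A.one_mem, 1, B.one_mem, fun z => by simp⟩
        mul_mem' := by
          rintro F F' ⟨φ, hφ, ψ, hψ, h⟩ ⟨φ', hφ', ψ', hψ', h'⟩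
          refine ⟨φ * φ', A.mul_mem hφ hφ', ψ * ψ', B.mul_mem hψ hψ', fun z => ?_⟩
          simp only [Pi.mul_apply, h, h']; ring }
    have h2 : F ∈ Submodule.span k (S : Set (P × Q → k)) := by
      have h1 : F ∈ Subalgebra.toSubmodule (tens A B) := h
      rw [tens, Algebra.adjoin_eq_span] at h1
      rw [← Submonoid.closure_eq S]; exact h1
    obtain ⟨N, c, G, rfl⟩ := Submodule.mem_span_set'.1 h2
    choose φ hφ ψ hψ e using fun i => (G i).2
    refine ⟨N, fun i => ⟨c i • φ i, A.smul_mem (hφ i) _⟩, fun i => ⟨ψ i, hψ i⟩, fun p q => ?_⟩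
    simp only [Finset.sum_apply, Pi.smul_apply, e, smul_eq_mul, mul_assoc]
  · rintro ⟨N, φ, ψ, h⟩
    have : F = ∑ i, fun z => (φ i).1 z.1 * (ψ i).1 z.2 := by
      funext z; rw [← Prod.mk.eta (p := z), h]; simp
    rw [this]
    refine Subalgebra.sum_mem _ fun i _ => Algebra.subset_adjoin ⟨_, (φ i).2, _, (ψ i).2, fun z => rfl⟩

theorem tens_left {P Q : Type} {A : Subalgebra k (P → k)} (B : Subalgebra k (Q → k)) {F : P → k} (h : F ∈ A) :
    (fun z : P × Q => F z.1) ∈ tens A B := Algebra.subset_adjoin ⟨F, h, 1, B.one_mem, fun z => by simp⟩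

theorem tens_right {P Q : Type} (A : Subalgebra k (P → k)) {B : Subalgebra k (Q → k)} {F : Q → k} (h : F ∈ B) :
    (fun z : P × Q => F z.2) ∈ tens A B := Algebra.subset_adjoin ⟨1, A.one_mem, F, h, fun z => by simp⟩

/-- pullback of functions -/
def pull {P Q : Type} (u : P → Q) : (Q → k) →ₐ[k] (P → k) where
  toFun F p := F (u p)
  map_one' := rfl
  map_mul' _ _ := rfl
  map_zero' := rfl
  map_add' _ _ := rfl
  commutes' _ := rfl

theorem reg_pull {P Q σ : Type} {e : Q → σ → k} (u : P → Q) {S : Subalgebra k (P → k)}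
    (h : ∀ s, (fun p => e (u p) s) ∈ S) {F : Q → k} (hF : F ∈ reg e) : (fun p => F (u p)) ∈ S :=
  (reg_le (S := S.comap (pull u)) h) hF

theorem det_mem {P : Type} {n : ℕ} {S : Subalgebra k (P → k)} {M : P → Matrix (Fin n) (Fin n) k}
    (h : ∀ i j, (fun p => M p i j) ∈ S) : (fun p => (M p).det) ∈ S := by
  have : (fun p => (M p).det) = (Matrix.det (Matrix.of fun i j => (⟨_, h i j⟩ : S))).1 := by
    funext p
    have := RingHom.map_det ((Pi.evalRingHom (fun _ : P => k) p).comp S.val.toRingHom) (Matrix.of fun i j => (⟨_, h i j⟩ : S))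
    exact this.symm
  rw [this]; exact SetLike.coe_mem _

theorem adj_mem {P : Type} {n : ℕ} {S : Subalgebra k (P → k)} {M : P → Matrix (Fin n) (Fin n) k}
    (h : ∀ i j, (fun p => M p i j) ∈ S) (i j : Fin n) : (fun p => (M p).adjugate i j) ∈ S := by
  have : (fun p => (M p).adjugate i j) = (Matrix.adjugate (Matrix.of fun i j => (⟨_, h i j⟩ : S)) i j).1 := by
    funext p
    have := RingHom.map_adjugate ((Pi.evalRingHom (fun _ : P => k) p).comp S.val.toRingHom) (Matrix.of fun i j => (⟨_, h i j⟩ : S))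
    exact (congrFun (congrFun this i) j).symm
  rw [this]; exact SetLike.coe_mem _

end Reg

section GrpO

variable {k : Type} [Field k]

/-- coordinates on `GL n` -/
def gpt {n : ℕ} (g : GL (Fin n) k) : (Fin n × Fin n) ⊕ Unit → k :=
  Sum.elim (mat2pt (g : Matrix (Fin n) (Fin n) k)) (fun _ => ((g⁻¹ : GL (Fin n) k) : Matrix (Fin n) (Fin n) k).det)

theorem det_mul_inv {n : ℕ} (g : GL (Fin n) k) :
    (g : Matrix (Fin n) (Fin n) k).det * ((g⁻¹ : GL (Fin n) k) : Matrix (Fin n) (Fin n) k).det = 1 := by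
  rw [← Matrix.det_mul, ← Units.val_mul, mul_inv_cancel, Units.val_one, Matrix.det_one]

theorem inv_entry {n : ℕ} (g : GL (Fin n) k) (i j : Fin n) :
    ((g⁻¹ : GL (Fin n) k) : Matrix (Fin n) (Fin n) k) i j =
      ((g⁻¹ : GL (Fin n) k) : Matrix (Fin n) (Fin n) k).det * (g : Matrix (Fin n) (Fin n) k).adjugate i j := by
  have h : ((g⁻¹ : GL (Fin n) k) : Matrix (Fin n) (Fin n) k) =
      ((g⁻¹ : GL (Fin n) k) : Matrix (Fin n) (Fin n) k).det • (g : Matrix (Fin n) (Fin n) k).adjugate := by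
    have h1 : (g : Matrix (Fin n) (Fin n) k) * (((g⁻¹ : GL (Fin n) k) : Matrix (Fin n) (Fin n) k).det • (g : Matrix (Fin n) (Fin n) k).adjugate) = 1 := by
      rw [Matrix.mul_smul, Matrix.mul_adjugate, smul_smul, mul_comm, det_mul_inv, one_smul]
    calc ((g⁻¹ : GL (Fin n) k) : Matrix (Fin n) (Fin n) k) = ((g⁻¹ : GL (Fin n) k) : Matrix (Fin n) (Fin n) k) * 1 := by rw [mul_one]
      _ = _ := by rw [← h1, ← mul_assoc, ← Units.val_mul, inv_mul_cancel, Units.val_one, one_mul]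
  exact congrFun (congrFun h i) j

/-- A point of affine space satisfying `det * δ = 1` comes from `GL n`. -/
theorem exists_gpt {n : ℕ} (p : (Fin n × Fin n) ⊕ Unit → k)
    (hp : (Matrix.of fun i j => p (Sum.inl (i, j))).det * p (Sum.inr ()) = 1) : ∃ g : GL (Fin n) k, gpt g = p := by
  have hu : IsUnit (Matrix.of fun i j => p (Sum.inl (i, j))) :=
    (Matrix.isUnit_iff_isUnit_det _).2 (IsUnit.of_mul_eq_one _ hp)
  obtain ⟨g, hg⟩ := hu
  refine ⟨g, ?_⟩
  funext s
  rcases s with ⟨i, j⟩ | ⟨⟩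
  · change (g : Matrix (Fin n) (Fin n) k) i j = _
    rw [hg]; rfl
  · have h1 := det_mul_inv g
    rw [hg] at h1
    change ((g⁻¹ : GL (Fin n) k) : Matrix (Fin n) (Fin n) k).det = _
    exact mul_left_cancel₀ (left_ne_zero_of_mul_eq_one hp) (h1.trans hp.symm)

/-- points of the group -/
abbrev Pt (G : AlgGroup k) : Type := G.toSubgroup

/-- Regular functions on `G`. -/
noncomputable def gO (G : AlgGroup k) : Subalgebra k (Pt G → k) := reg (fun g : Pt G => gpt g.1)

theorem entry_mem (G : AlgGroup k) (i j : Fin G.n) :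
    (fun g : Pt G => (g.1 : Matrix (Fin G.n) (Fin G.n) k) i j) ∈ gO G :=
  coord_mem_reg (fun g : Pt G => gpt g.1) (Sum.inl (i, j))

theorem dinv_mem (G : AlgGroup k) :
    (fun g : Pt G => ((g.1⁻¹ : GL (Fin G.n) k) : Matrix (Fin G.n) (Fin G.n) k).det) ∈ gO G :=
  coord_mem_reg (fun g : Pt G => gpt g.1) (Sum.inr ())

theorem inv_entry_mem (G : AlgGroup k) (i j : Fin G.n) :
    (fun g : Pt G => ((g.1⁻¹ : GL (Fin G.n) k) : Matrix (Fin G.n) (Fin G.n) k) i j) ∈ gO G := by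
  simp only [inv_entry]
  exact (gO G).mul_mem (dinv_mem G) (adj_mem (M := fun g : Pt G => (g.1 : Matrix (Fin G.n) (Fin G.n) k)) (entry_mem G) i j)

theorem gpt_mul_mem {P : Type} {n : ℕ} {S : Subalgebra k (P → k)} {u v : P → GL (Fin n) k}
    (hu : ∀ s, (fun p => gpt (u p) s) ∈ S) (hv : ∀ s, (fun p => gpt (v p) s) ∈ S) (s) :
    (fun p => gpt (u p * v p) s) ∈ S := by
  rcases s with ⟨i, j⟩ | ⟨⟩
  · have : (fun p => gpt (u p * v p) (Sum.inl (i, j))) = ∑ l, (fun p => gpt (u p) (Sum.inl (i, l))) * (fun p => gpt (v p) (Sum.inl (l, j))) := by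
      funext p
      simp only [gpt, Sum.elim_inl, mat2pt, Units.val_mul, Matrix.mul_apply, Finset.sum_apply, Pi.mul_apply]
    rw [this]
    exact S.sum_mem fun l _ => S.mul_mem (hu _) (hv _)
  · have : (fun p => gpt (u p * v p) (Sum.inr ())) = (fun p => gpt (v p) (Sum.inr ())) * (fun p => gpt (u p) (Sum.inr ())) := by
      funext p
      simp only [gpt, Sum.elim_inr, mul_inv_rev, Units.val_mul, Matrix.det_mul, Pi.mul_apply]
    rw [this]
    exact S.mul_mem (hv _) (hu _)

theorem gpt_inv_mem {P : Type} {n : ℕ} {S : Subalgebra k (P → k)} {u : P → GL (Fin n) k}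
    (hu : ∀ s, (fun p => gpt (u p) s) ∈ S) (s) :
    (fun p => gpt (u p)⁻¹ s) ∈ S := by
  have hu' : ∀ i j, (fun p => (u p : Matrix (Fin n) (Fin n) k) i j) ∈ S := fun i j => hu (Sum.inl (i, j))
  rcases s with ⟨i, j⟩ | ⟨⟩
  · change (fun p => ((u p)⁻¹ : GL (Fin n) k).1 i j) ∈ S
    simp only [inv_entry]
    exact S.mul_mem (hu (Sum.inr ())) (adj_mem (M := fun p => (u p : Matrix (Fin n) (Fin n) k)) hu' i j)
  · change (fun p => (((u p)⁻¹)⁻¹ : GL (Fin n) k).1.det) ∈ S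
    simp only [inv_inv]
    exact det_mem hu'

theorem gO_affGrp (G : AlgGroup k) : AffGrp (gO G) where
  fg := reg_fg _
  pts χ := by
    have hco : ∀ s, (fun g : Pt G => gpt g.1 s) ∈ gO G := fun s => coord_mem_reg (fun g : Pt G => gpt g.1) s
    let φ : MvPolynomial ((Fin G.n × Fin G.n) ⊕ Unit) k →ₐ[k] gO G :=
      (MvPolynomial.aeval (R := k) (fun s (g : Pt G) => gpt g.1 s)).rangeRestrict
    have hφ : ∀ f g, (φ f).1 g = MvPolynomial.eval (gpt g.1) f := fun f g => aeval_pts (fun g : Pt G => gpt g.1) f g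
    let p : (Fin G.n × Fin G.n) ⊕ Unit → k := fun s => χ (φ (MvPolynomial.X s))
    have hχ : ∀ f, χ (φ f) = MvPolynomial.eval p f := by
      intro f
      have : (χ.comp φ) = MvPolynomial.aeval p := by
        ext s; simp [p]
      have := AlgHom.congr_fun this f
      rwa [MvPolynomial.aeval_eq_eval] at this
    -- polynomial for det
    have key : ∀ f, (∀ g : Pt G, MvPolynomial.eval (gpt g.1) f = 0) → MvPolynomial.eval p f = 0 := by
      intro f hf
      have : φ f = 0 := by apply Subtype.ext; funext g; rw [hφ, hf]; rfl
      rw [← hχ, this, map_zero]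
    have hdet : (Matrix.of fun i j => p (Sum.inl (i, j))).det * p (Sum.inr ()) = 1 := by
      have hev : ∀ q : (Fin G.n × Fin G.n) ⊕ Unit → k, MvPolynomial.eval q ((Matrix.of fun i j => (MvPolynomial.X (Sum.inl (i, j)) : MvPolynomial ((Fin G.n × Fin G.n) ⊕ Unit) k)).det * MvPolynomial.X (Sum.inr ()) - 1) = (Matrix.of fun i j => q (Sum.inl (i, j))).det * q (Sum.inr ()) - 1 := by
        intro q
        rw [map_sub, map_mul, RingHom.map_det, map_one, MvPolynomial.eval_X]
        congr 3
        ext i j; simp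
      have := key _ (fun g => by
        rw [hev, sub_eq_zero]
        exact det_mul_inv g.1)
      rw [hev] at this
      exact sub_eq_zero.1 this
    obtain ⟨g, hg⟩ := exists_gpt p hdet
    have hgG : g ∈ G.toSubgroup := by
      obtain ⟨I, hI⟩ := G.closed
      rw [hI]
      intro f hf
      have := key (MvPolynomial.rename Sum.inl f) (fun g' => by
        rw [MvPolynomial.eval_rename]
        exact (hI g'.1).1 g'.2 f hf)
      rw [MvPolynomial.eval_rename, ← hg] at this
      exact this
    refine ⟨⟨g, hgG⟩, fun f => ?_⟩
    obtain ⟨f', hf'⟩ := AlgHom.rangeRestrict_surjective (MvPolynomial.aeval (R := k) (fun s (g : Pt G) => gpt g.1 s)) f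
    have e : f = φ f' := hf'.symm
    rw [e, hχ, hφ, hg]
  comul f := by
    have h := reg_pull (e := fun g : Pt G => gpt g.1) (fun z : Pt G × Pt G => z.1 * z.2) (S := tens (gO G) (gO G))
      (gpt_mul_mem (u := fun z : Pt G × Pt G => z.1.1) (v := fun z : Pt G × Pt G => z.2.1)
        (fun s => tens_left (gO G) (coord_mem_reg (fun g : Pt G => gpt g.1) s))
        (fun s => tens_right (gO G) (coord_mem_reg (fun g : Pt G => gpt g.1) s))) f.2
    exact mem_tens.1 h
  inv f hf := reg_pull (e := fun g : Pt G => gpt g.1) (fun z : Pt G => z⁻¹) (S := gO G)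
      (gpt_inv_mem (u := fun z : Pt G => z.1) (coord_mem_reg (fun g : Pt G => gpt g.1))) hf

end GrpO

end PaperGIT

namespace PaperGIT

section Engel
open LieModule

attribute [local instance] LieRing.ofAssociativeRing

theorem engel_flag {k V : Type} [Field k] [AddCommGroup V] [Module k V] [FiniteDimensional k V]
    (N : Submodule k (Module.End k V)) (hb : ∀ a ∈ N, ∀ b ∈ N, a * b - b * a ∈ N) (hn : ∀ a ∈ N, IsNilpotent a) :
    ∃ (r : ℕ) (F : ℕ → Submodule k V), F 0 = ⊤ ∧ F r = ⊥ ∧ (∀ i, F (i+1) ≤ F i) ∧ ∀ a ∈ N, ∀ i, ∀ v ∈ F i, a v ∈ F (i+1) := by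
  let L : LieSubalgebra k (Module.End k V) := { N with lie_mem' := fun {a b} ha hb' => hb a ha b hb' }
  have : LieModule.IsNilpotent L V := by
    rw [LieModule.isNilpotent_iff_forall' (R := k)]
    intro x
    have h : toEnd k L V x = x.1 := rfl
    rw [h]; exact hn _ x.2
  obtain ⟨r, hr⟩ := (LieModule.isNilpotent_iff k L V).1 this
  refine ⟨r, fun i => (lowerCentralSeries k L V i).toSubmodule, by simp, by simp [hr], fun i => ?_, ?_⟩
  · exact (antitone_lowerCentralSeries k L V (Nat.le_succ i))
  · intro a ha i v hv
    change v ∈ lowerCentralSeries k L V i at hv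
    change a v ∈ lowerCentralSeries k L V (i+1)
    rw [lowerCentralSeries_succ]
    exact LieSubmodule.lie_mem_lie (x := (⟨a, ha⟩ : L)) (LieSubmodule.mem_top _) hv

end Engel

section ExpM

open Polynomial

variable {k : Type} [Field k] [CharZero k] {n : ℕ}

theorem matrix_pow_zero {a : Matrix (Fin n) (Fin n) k} (h : IsNilpotent a) : a ^ n = 0 := by
  have h1 : IsNilpotent (Matrix.toLinAlgEquiv' a) := h.map _
  have h2 := h1.charpoly_eq_X_pow_finrank
  have h3 := LinearMap.aeval_self_charpoly (Matrix.toLinAlgEquiv' a)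
  rw [h2] at h3
  simp only [map_pow, aeval_X, Module.finrank_fin_fun] at h3
  rw [← map_pow] at h3
  exact (map_eq_zero_iff _ (AlgEquiv.injective _)).1 h3

/-- exponential of a nilpotent matrix as a polynomial -/
noncomputable def expP (a : Matrix (Fin n) (Fin n) k) (i j : Fin n) : k[X] :=
  ∑ l ∈ Finset.range (n+1), C ((l.factorial : k)⁻¹ * (a ^ l) i j) * X ^ l

noncomputable def expM (a : Matrix (Fin n) (Fin n) k) (t : k) : Matrix (Fin n) (Fin n) k :=
  ∑ l ∈ Finset.range (n+1), ((l.factorial : k)⁻¹ * t ^ l) • a ^ l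

theorem eval_expP (a : Matrix (Fin n) (Fin n) k) (i j : Fin n) (t : k) : (expP a i j).eval t = expM a t i j := by
  simp only [expP, expM, eval_finsetSum, Matrix.sum_apply, Matrix.smul_apply]
  refine Finset.sum_congr rfl fun l _ => ?_
  simp; ring

theorem expM_eq {a : Matrix (Fin n) (Fin n) k} (h : a ^ n = 0) (t : k) : expM a t = IsNilpotent.exp (t • a) := by
  have h1 : (t • a) ^ (n+1) = 0 := by rw [_root_.smul_pow, pow_succ a, h, zero_mul, smul_zero]
  rw [IsNilpotent.exp_eq_sum h1, expM]
  refine Finset.sum_congr rfl fun l _ => ?_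
  rw [_root_.smul_pow, ← smul_assoc]
  congr 1
  rw [Rat.smul_def]; push_cast; rfl

theorem expM_mul_neg {a : Matrix (Fin n) (Fin n) k} (h : a ^ n = 0) (t : k) : expM a t * expM a (-t) = 1 := by
  rw [expM_eq h, expM_eq h, neg_smul]
  exact IsNilpotent.exp_mul_exp_neg_self ⟨n, by rw [_root_.smul_pow, h, smul_zero]⟩

theorem expM_smul (a : Matrix (Fin n) (Fin n) k) (t s : k) : expM (s • a) t = expM a (s * t) := by
  simp only [expM]
  refine Finset.sum_congr rfl fun l _ => ?_
  rw [_root_.smul_pow, smul_smul]; congr 1; ring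

theorem expM_zero (a : Matrix (Fin n) (Fin n) k) : expM a 0 = 1 := by
  rw [expM, Finset.sum_range_succ']
  simp

theorem derivative_expP {a : Matrix (Fin n) (Fin n) k} (h : a ^ n = 0) (i j : Fin n) :
    derivative (expP a i j) = ∑ l, expP a i l * C (a l j) := by
  have e : ∑ l, expP a i l * C (a l j) = ∑ r ∈ Finset.range (n+1), C ((r.factorial : k)⁻¹ * (a ^ (r+1)) i j) * X ^ r := by
    simp only [expP, Finset.sum_mul]
    rw [Finset.sum_comm]
    refine Finset.sum_congr rfl fun r _ => ?_
    rw [pow_succ, Matrix.mul_apply, Finset.mul_sum, map_sum, Finset.sum_mul]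
    refine Finset.sum_congr rfl fun l _ => ?_
    simp only [map_mul]; ring
  rw [e, Finset.sum_range_succ, expP, Finset.sum_range_succ', derivative_add, derivative_sum]
  have h0 : (a ^ (n+1)) i j = 0 := by rw [pow_succ, h, zero_mul]; rfl
  rw [h0]
  simp only [mul_zero, map_zero, zero_mul, add_zero, pow_zero, mul_one, derivative_C]
  refine Finset.sum_congr rfl fun r _ => ?_
  rw [derivative_C_mul_X_pow]
  simp only [Nat.add_sub_cancel]
  congr 2
  rw [Nat.factorial_succ]
  have : ((r + 1 : ℕ) : k) ≠ 0 := Nat.cast_ne_zero.2 (Nat.succ_ne_zero r)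
  have h2 : ((r.factorial : ℕ) : k) ≠ 0 := Nat.cast_ne_zero.2 (Nat.factorial_ne_zero r)
  rw [Nat.cast_mul, mul_inv]
  field_simp

theorem eq_zero_of_expM {a : Matrix (Fin n) (Fin n) k} (h : a ^ n = 0) (h1 : ∀ t, expM a t = 1) : a = 0 := by
  ext i j
  have e : expP a i j = C ((1 : Matrix (Fin n) (Fin n) k) i j) := by
    apply Polynomial.funext; intro t; rw [eval_expP, h1, eval_C]
  have d := derivative_expP h i j
  rw [e, derivative_C] at d
  have d0 := congrArg (eval 0) d
  simp only [eval_zero, eval_finsetSum, eval_mul, eval_C, eval_expP, expM_zero] at d0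
  rw [← Matrix.mul_apply, one_mul] at d0
  exact d0.symm

/-- exponential as a unit -/
noncomputable def expU (a : Matrix (Fin n) (Fin n) k) (h : a ^ n = 0) (t : k) : GL (Fin n) k :=
  ⟨expM a t, expM a (-t), expM_mul_neg h t, by simpa using expM_mul_neg h (-t)⟩

theorem poly_zero_of_derivs (q : k[X]) (h : ∀ j, (derivative^[j] q).eval 0 = 0) : q = 0 := by
  ext j
  have := h j
  rw [← coeff_zero_eq_eval_zero, coeff_iterate_derivative] at this
  simp only [zero_add, Nat.descFactorial_self, nsmul_eq_mul, mul_eq_zero] at this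
  rcases this with h | h
  · exact absurd (Nat.cast_eq_zero.1 h) (Nat.factorial_ne_zero j)
  · simpa using h

end ExpM

section LieMat

open Polynomial

variable {k : Type} [Field k] [CharZero k] (G : AlgGroup k)

noncomputable def co (i j : Fin G.n) : gO G := ⟨_, entry_mem G i j⟩

noncomputable def matX (x : gO G →ₗ[k] k) : Matrix (Fin G.n) (Fin G.n) k := Matrix.of fun i j => x (co G i j)

/-- standard representation -/
noncomputable def stdRep : Representation k (Pt G) (Fin G.n → k) where
  toFun g := Matrix.toLin' (g.1 : Matrix (Fin G.n) (Fin G.n) k)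
  map_one' := by simp; rfl
  map_mul' g h := by simp [Matrix.toLin'_mul]; rfl

theorem stdRep_apply (g : Pt G) (v : Fin G.n → k) : stdRep G g v = (g.1 : Matrix (Fin G.n) (Fin G.n) k).mulVec v := by
  simp [stdRep]

theorem stdRep_isRat : IsRat (gO G) (stdRep G) := by
  intro m
  refine ⟨G.n, fun i => ∑ j, m j • co G i j, fun i => Pi.single i 1, fun g => ?_⟩
  rw [stdRep_apply]
  funext i
  simp only [Matrix.mulVec, dotProduct, AddSubmonoidClass.coe_finsetSum, SetLike.val_smul, Finset.sum_apply, Pi.smul_apply, smul_eq_mul, co]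
  symm
  rw [Finset.sum_eq_single i]
  · simp [mul_comm]
  · intro b _ hb; simp [Pi.single_apply, hb.symm]
  · simp

theorem dr_std (x : gO G →ₗ[k] k) : dr (stdRep_isRat G) x = Matrix.toLin' (matX G x) := by
  apply LinearMap.ext; intro m
  apply dual_ext (k := k)
  intro ξ
  rw [dr_spec]
  have : coeff (stdRep_isRat G) ξ m = ∑ i, ∑ j, (ξ (Pi.single i 1) * m j) • co G i j := by
    apply Subtype.ext; funext g
    rw [coeff_apply, stdRep_apply]
    rw [pi_eq_sum_univ' ((g.1 : Matrix (Fin G.n) (Fin G.n) k).mulVec m)]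
    simp only [map_sum, map_smul, AddSubmonoidClass.coe_finsetSum, SetLike.val_smul, Finset.sum_apply, Pi.smul_apply, smul_eq_mul, co, Matrix.mulVec, dotProduct, Finset.sum_mul]
    refine Finset.sum_congr rfl fun i _ => Finset.sum_congr rfl fun j _ => ?_
    have : (fun j => if i = j then (1:k) else 0) = Pi.single i 1 := by
      funext j; simp [Pi.single_apply, eq_comm]
    try simp only [this]
    ring
  rw [this]
  rw [pi_eq_sum_univ' (Matrix.toLin' (matX G x) m)]
  simp only [map_sum, map_smul, smul_eq_mul, Matrix.toLin'_apply, Matrix.mulVec, dotProduct, Finset.sum_mul]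
  refine Finset.sum_congr rfl fun i _ => Finset.sum_congr rfl fun j _ => ?_
  have : (fun j => if i = j then (1:k) else 0) = Pi.single i 1 := by
    funext j; simp [Pi.single_apply, eq_comm]
  simp only [this, matX, Matrix.of_apply]
  ring

/-- the polynomial function on `G` -/
noncomputable def pf (f : MvPolynomial (Fin G.n × Fin G.n) k) : gO G :=
  ⟨fun g => MvPolynomial.eval (mat2pt (g.1 : Matrix (Fin G.n) (Fin G.n) k)) f,
    reg_le (e := fun g : Pt G => mat2pt (g.1 : Matrix (Fin G.n) (Fin G.n) k)) (fun s => entry_mem G s.1 s.2) (eval_mem_reg _ f)⟩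

noncomputable def dD (a : Matrix (Fin G.n) (Fin G.n) k) : Derivation k (MvPolynomial (Fin G.n × Fin G.n) k) (MvPolynomial (Fin G.n × Fin G.n) k) :=
  MvPolynomial.mkDerivation k fun p => ∑ l, MvPolynomial.X (p.1, l) * MvPolynomial.C (a l p.2)

theorem LL_const {x : gO G →ₗ[k] k} (hx : x ∈ LieG (gO G)) (c : k) : LL (gO_affGrp G) x (algebraMap k (gO G) c) = 0 := by
  have : LL (gO_affGrp G) x (1 : gO G) = 0 := by
    have h := LL_mul (gO_affGrp G) hx 1 1
    simpa using h
  rw [Algebra.algebraMap_eq_smul_one, map_smul, this, smul_zero]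

theorem LL_pf {x : gO G →ₗ[k] k} (hx : x ∈ LieG (gO G)) (f : MvPolynomial (Fin G.n × Fin G.n) k) :
    LL (gO_affGrp G) x (pf G f) = pf G (dD G (matX G x) f) := by
  have hadd : ∀ p q, pf G (p + q) = pf G p + pf G q := by
    intro p q; apply Subtype.ext; funext g; simp [pf]
  have hmul : ∀ p q, pf G (p * q) = pf G p * pf G q := by
    intro p q; apply Subtype.ext; funext g; simp [pf]
  induction f using MvPolynomial.induction_on with
  | C c =>
    have e : pf G (MvPolynomial.C c) = algebraMap k (gO G) c := by apply Subtype.ext; funext g; simp [pf]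
    rw [e, LL_const G hx, dD]
    apply Subtype.ext; funext g; simp [pf]
  | add p q hp hq => rw [hadd, map_add, map_add, hadd, hp, hq]
  | mul_X p s hp =>
    have hX : LL (gO_affGrp G) x (pf G (MvPolynomial.X s)) = pf G (dD G (matX G x) (MvPolynomial.X s)) := by
      apply Subtype.ext; funext g
      rw [LL_apply]
      have : lt (gO_affGrp G) g (pf G (MvPolynomial.X s)) = ∑ l, (g.1 : Matrix (Fin G.n) (Fin G.n) k) s.1 l • co G l s.2 := by
        apply Subtype.ext; funext h
        simp [pf, co, mat2pt, Matrix.mul_apply]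
      rw [this]
      simp [dD, pf, mat2pt, matX]
    rw [hmul, LL_mul _ hx, hp, hX, Derivation.leibniz, hadd, smul_eq_mul, smul_eq_mul, hmul, hmul]

theorem derivative_curve {a : Matrix (Fin G.n) (Fin G.n) k} (h : a ^ G.n = 0) (f : MvPolynomial (Fin G.n × Fin G.n) k) :
    derivative (MvPolynomial.aeval (fun p : Fin G.n × Fin G.n => expP a p.1 p.2) f) =
      MvPolynomial.aeval (fun p : Fin G.n × Fin G.n => expP a p.1 p.2) (dD G a f) := by
  induction f using MvPolynomial.induction_on with
  | C c => simp [dD]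
  | add p q hp hq => simp only [map_add, hp, hq]
  | mul_X p s hp =>
    have hX : derivative (MvPolynomial.aeval (R := k) (fun p : Fin G.n × Fin G.n => expP a p.1 p.2) (MvPolynomial.X s)) =
      MvPolynomial.aeval (fun p : Fin G.n × Fin G.n => expP a p.1 p.2) (dD G a (MvPolynomial.X s)) := by
      simp [dD, derivative_expP h]
    rw [map_mul, derivative_mul, hX, hp, Derivation.leibniz, map_add, smul_eq_mul, smul_eq_mul, map_mul, map_mul]
    ring

theorem eval_curve (a : Matrix (Fin G.n) (Fin G.n) k) (t : k) (f : MvPolynomial (Fin G.n × Fin G.n) k) :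
    (MvPolynomial.aeval (fun p : Fin G.n × Fin G.n => expP a p.1 p.2) f).eval t = MvPolynomial.eval (mat2pt (expM a t)) f := by
  have := MvPolynomial.comp_aeval_apply (R := k) (fun p : Fin G.n × Fin G.n => expP a p.1 p.2) (Polynomial.aeval (R := k) t) f
  rw [Polynomial.coe_aeval_eq_eval] at this
  rw [this, MvPolynomial.aeval_eq_eval]
  simp only [eval_expP]; rfl

theorem expU_mem {x : gO G →ₗ[k] k} (hx : x ∈ LieG (gO G)) (h : matX G x ^ G.n = 0) (t : k) :
    expU (matX G x) h t ∈ G.toSubgroup := by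
  obtain ⟨I, hI⟩ := G.closed
  rw [hI]
  intro f hf
  set a := matX G x with ha
  have h0 : pf G f = 0 := by
    apply Subtype.ext; funext g; exact (hI g.1).1 g.2 f hf
  have hD : ∀ j, pf G ((dD G a)^[j] f) = 0 := by
    intro j
    induction j with
    | zero => exact h0
    | succ j ih => rw [Function.iterate_succ_apply', ← LL_pf G hx, ih, map_zero]
  have hder : ∀ j, derivative^[j] (MvPolynomial.aeval (fun p : Fin G.n × Fin G.n => expP a p.1 p.2) f) =
      MvPolynomial.aeval (fun p : Fin G.n × Fin G.n => expP a p.1 p.2) ((dD G a)^[j] f) := by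
    intro j
    induction j with
    | zero => rfl
    | succ j ih => rw [Function.iterate_succ_apply', Function.iterate_succ_apply', ih, derivative_curve G h]
  have hz := poly_zero_of_derivs (MvPolynomial.aeval (fun p : Fin G.n × Fin G.n => expP a p.1 p.2) f) (by
    intro j
    rw [hder, eval_curve, expM_zero]
    have := congrFun (congrArg Subtype.val (hD j)) 1
    exact this)
  have := eval_curve G a t f
  rw [hz, eval_zero] at this
  exact this.symm

end LieMat

end PaperGIT

namespace PaperGIT

section RedG

open Polynomial

variable {k : Type} [Field k] [CharZero k] (G : AlgGroup k)

theorem matX_inj {x : gO G →ₗ[k] k} (hx : x ∈ LieG (gO G)) (h : matX G x = 0) : x = 0 := by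
  have hx' : ∀ f g : gO G, x (f * g) = f.1 1 * x g + g.1 1 * x f := hx
  have x1 : x 1 = 0 := by simpa using hx' 1 1
  let S : Subalgebra k (Pt G → k) :=
    { carrier := {F | ∃ h : F ∈ gO G, x ⟨F, h⟩ = 0}
      mul_mem' := by
        rintro F F' ⟨h1, h2⟩ ⟨h1', h2'⟩
        refine ⟨(gO G).mul_mem h1 h1', ?_⟩
        have := hx' ⟨F, h1⟩ ⟨F', h1'⟩
        rw [h2, h2'] at this
        simpa using this
      add_mem' := by
        rintro F F' ⟨h1, h2⟩ ⟨h1', h2'⟩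
        refine ⟨(gO G).add_mem h1 h1', ?_⟩
        have := map_add x ⟨F, h1⟩ ⟨F', h1'⟩
        rw [h2, h2'] at this
        simpa using this
      algebraMap_mem' := by
        intro c
        refine ⟨(gO G).algebraMap_mem c, ?_⟩
        have : (⟨algebraMap k (Pt G → k) c, (gO G).algebraMap_mem c⟩ : gO G) = c • 1 := by
          apply Subtype.ext; funext g; simp
        rw [this, map_smul, x1, smul_zero] }
  have hco : ∀ i j, (fun g : Pt G => (g.1 : Matrix (Fin G.n) (Fin G.n) k) i j) ∈ S := by
    intro i j
    exact ⟨entry_mem G i j, congrFun (congrFun h i) j⟩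
  obtain ⟨hd, hd'⟩ := det_mem (M := fun g : Pt G => (g.1 : Matrix (Fin G.n) (Fin G.n) k)) hco
  have hdi : (fun g : Pt G => ((g.1⁻¹ : GL (Fin G.n) k) : Matrix (Fin G.n) (Fin G.n) k).det) ∈ S := by
    refine ⟨dinv_mem G, ?_⟩
    have := hx' ⟨_, hd⟩ ⟨_, dinv_mem G⟩
    have e : (⟨_, hd⟩ : gO G) * ⟨_, dinv_mem G⟩ = 1 := by
      apply Subtype.ext; funext g; exact det_mul_inv g.1
    rw [e, x1, hd'] at this
    simpa using this.symm
  have hle : gO G ≤ S := by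
    apply reg_le
    rintro (⟨i, j⟩ | ⟨⟩)
    · exact hco i j
    · exact hdi
  apply LinearMap.ext
  intro f
  obtain ⟨_, h2⟩ := hle f.2
  exact h2

theorem nil_bot (hG : IsReductive G) (N : Submodule k (gO G →ₗ[k] k)) (hN : N ≤ LieG (gO G))
    (hbrk : ∀ x ∈ N, ∀ y ∈ LieG (gO G), brk (gO_affGrp G) x y ∈ N)
    (had : ∀ x ∈ N, ∀ g, Ad (gO_affGrp G) g x ∈ N)
    (hnil : ∀ x ∈ N, IsNilpotent (dr (stdRep_isRat G) x)) : N = ⊥ := by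
  have hp : ∀ x ∈ N, matX G x ^ G.n = 0 := by
    intro x hx
    apply matrix_pow_zero
    have := hnil x hx
    rw [dr_std] at this
    have h2 : IsNilpotent (Matrix.toLinAlgEquiv' (matX G x)) := this
    exact (IsNilpotent.map_iff (AlgEquiv.injective Matrix.toLinAlgEquiv')).1 h2
  let S : Set (GL (Fin G.n) k) := {u | ∃ x, ∃ hx : x ∈ N, ∃ t, u = expU (matX G x) (hp x hx) t}
  let H := Subgroup.closure S
  have hsub : ∀ x (hx : x ∈ N) t, expU (matX G x) (hp x hx) t ∈ H := fun x hx t =>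
    Subgroup.subset_closure ⟨x, hx, t, rfl⟩
  have hHG : H ≤ G.toSubgroup := by
    rw [Subgroup.closure_le]
    rintro _ ⟨x, hx, t, rfl⟩
    exact expU_mem G (hN hx) _ t
  have hU0 : ∀ x (hx : x ∈ N), expU (matX G x) (hp x hx) 0 = 1 := by
    intro x hx; apply Units.ext; exact expM_zero _
  -- curves stay in a closed piece
  have hcurve : ∀ V W : Set (GL (Fin G.n) k), ClosedInGL V → ClosedInGL W → (H : Set (GL (Fin G.n) k)) ⊆ V ∪ W →
      (H : Set (GL (Fin G.n) k)) ∩ V ∩ W = ∅ → ∀ h ∈ H, ∀ x (hx : x ∈ N) (s t : k), h * expU (matX G x) (hp x hx) s ∈ V → h * expU (matX G x) (hp x hx) t ∈ V := by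
    rintro V W ⟨I, rfl⟩ ⟨J, rfl⟩ hVW hd h hh x hx s t hs
    have hmem : ∀ t, h * expU (matX G x) (hp x hx) t ∈ H := fun t => H.mul_mem hh (hsub x hx t)
    by_contra ht
    have hsW : h * expU (matX G x) (hp x hx) s ∉ {A : GL (Fin G.n) k | mat2pt (A : Matrix (Fin G.n) (Fin G.n) k) ∈ zeroLocus J} := by
      intro hW
      have : h * expU (matX G x) (hp x hx) s ∈ (∅ : Set (GL (Fin G.n) k)) := hd ▸ ⟨⟨hmem s, hs⟩, hW⟩
      exact this
    have h1 : ∃ f ∈ I, MvPolynomial.eval (mat2pt ((h * expU (matX G x) (hp x hx) t : GL (Fin G.n) k) : Matrix (Fin G.n) (Fin G.n) k)) f ≠ 0 := by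
      by_contra hc; push Not at hc; exact ht hc
    have h2 : ∃ f ∈ J, MvPolynomial.eval (mat2pt ((h * expU (matX G x) (hp x hx) s : GL (Fin G.n) k) : Matrix (Fin G.n) (Fin G.n) k)) f ≠ 0 := by
      by_contra hc; push Not at hc; exact hsW hc
    obtain ⟨f, hf, hf'⟩ := h1
    obtain ⟨g, hg, hg'⟩ := h2
    let c : Fin G.n × Fin G.n → k[X] := fun p => ∑ l, C ((h : Matrix (Fin G.n) (Fin G.n) k) p.1 l) * expP (matX G x) l p.2
    have hc : ∀ (q : MvPolynomial (Fin G.n × Fin G.n) k) r, Polynomial.eval r (MvPolynomial.aeval (R := k) c q) =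
        MvPolynomial.eval (mat2pt ((h * expU (matX G x) (hp x hx) r : GL (Fin G.n) k) : Matrix (Fin G.n) (Fin G.n) k)) q := by
      intro q r
      have := MvPolynomial.comp_aeval_apply (R := k) c (Polynomial.aeval (R := k) r : k[X] →ₐ[k] k) q
      rw [Polynomial.coe_aeval_eq_eval] at this
      rw [this, MvPolynomial.aeval_eq_eval]
      have e : (fun p => eval r (c p)) = mat2pt ((h * expU (matX G x) (hp x hx) r : GL (Fin G.n) k) : Matrix (Fin G.n) (Fin G.n) k) := by
        funext p
        simp only [c, eval_finsetSum, eval_mul, eval_C, eval_expP, mat2pt, Units.val_mul, Matrix.mul_apply]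
        rfl
      rw [e]
    have hz : MvPolynomial.aeval (R := k) c f * MvPolynomial.aeval (R := k) c g = 0 := by
      apply Polynomial.funext
      intro r
      rw [eval_mul, eval_zero, hc, hc]
      rcases hVW (hmem r) with h | h
      · rw [h f hf, zero_mul]
      · rw [h g hg, mul_zero]
    rcases mul_eq_zero.1 hz with hz | hz
    · apply hf'; rw [← hc, hz, eval_zero]
    · apply hg'; rw [← hc, hz, eval_zero]
  have hall : ∀ V W : Set (GL (Fin G.n) k), ClosedInGL V → ClosedInGL W → (H : Set (GL (Fin G.n) k)) ⊆ V ∪ W →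
      (H : Set (GL (Fin G.n) k)) ∩ V ∩ W = ∅ → (1 : GL (Fin G.n) k) ∈ V → (H : Set (GL (Fin G.n) k)) ⊆ V := by
    intro V W hV hW hVW hd h1 h hh
    have hc := hcurve V W hV hW hVW hd
    refine Subgroup.closure_induction_right (p := fun h _ => h ∈ V) h1 ?_ ?_ hh
    · rintro y hy _ ⟨x, hx, t, rfl⟩ hyV
      refine hc y hy x hx 0 t ?_
      rw [hU0 x hx, mul_one]; exact hyV
    · rintro y hy _ ⟨x, hx, t, rfl⟩ hyV
      have := hc (y * (expU (matX G x) (hp x hx) t)⁻¹) (H.mul_mem hy (H.inv_mem (hsub x hx t))) x hx t 0 (by simpa using hyV)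
      rwa [hU0 x hx, mul_one] at this
  have hconn : IsConnSet (H : Set (GL (Fin G.n) k)) := by
    intro V W hV hW hVW hd
    rcases hVW H.one_mem with h1 | h1
    · exact Or.inl (hall V W hV hW hVW hd h1)
    · refine Or.inr (hall W V hW hV (by rwa [Set.union_comm]) ?_ h1)
      rw [Set.inter_assoc, Set.inter_comm W V, ← Set.inter_assoc]; exact hd
  -- unipotence
  obtain ⟨r, F, F0, Fr, Fle, hF⟩ := engel_flag (N.map (drL (stdRep_isRat G))) (by
      rintro _ ⟨x, hx, rfl⟩ _ ⟨y, hy, rfl⟩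
      refine ⟨brk (gO_affGrp G) x y, hbrk x hx y (hN hy), ?_⟩
      rw [drL_apply, drL_apply, drL_apply, dr_brk]) (by
      rintro _ ⟨x, hx, rfl⟩
      rw [drL_apply]; exact hnil x hx)
  have hFa : ∀ x ∈ N, ∀ i, ∀ v ∈ F i, (matX G x).mulVec v ∈ F (i+1) := by
    intro x hx i v hv
    have := hF _ ⟨x, hx, rfl⟩ i v hv
    rwa [drL_apply, dr_std, Matrix.toLin'_apply] at this
  have hpow : ∀ x ∈ N, ∀ l i, ∀ v ∈ F i, ((matX G x) ^ (l+1)).mulVec v ∈ F (i+1) := by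
    intro x hx l
    induction l with
    | zero => intro i v hv; simpa using hFa x hx i v hv
    | succ l ih =>
      intro i v hv
      rw [pow_succ, ← Matrix.mulVec_mulVec]
      exact ih i _ (Fle i (hFa x hx i v hv))
  have hexp : ∀ x ∈ N, ∀ t i, ∀ v ∈ F i, (expM (matX G x) t).mulVec v - v ∈ F (i+1) := by
    intro x hx t i v hv
    rw [expM, Finset.sum_range_succ', Matrix.add_mulVec]
    simp only [Nat.factorial_zero, Nat.cast_one, inv_one, pow_zero, mul_one, one_smul, Matrix.one_mulVec, add_sub_cancel_right]
    rw [Matrix.sum_mulVec]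
    refine Submodule.sum_mem _ fun l _ => ?_
    rw [Matrix.smul_mulVec]
    exact Submodule.smul_mem _ _ (hpow x hx l i v hv)
  have hword : ∀ h ∈ H, ∀ i, ∀ v ∈ F i, (h : Matrix (Fin G.n) (Fin G.n) k).mulVec v - v ∈ F (i+1) := by
    intro h hh
    have hstep : ∀ y : GL (Fin G.n) k, (∀ i, ∀ v ∈ F i, (y : Matrix (Fin G.n) (Fin G.n) k).mulVec v - v ∈ F (i+1)) → ∀ x (hx : x ∈ N) t,
        ∀ i, ∀ v ∈ F i, ((y * expU (matX G x) (hp x hx) t : GL (Fin G.n) k) : Matrix (Fin G.n) (Fin G.n) k).mulVec v - v ∈ F (i+1) := by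
      intro y hy x hx t i v hv
      have e1 := hexp x hx t i v hv
      have e2 : (expM (matX G x) t).mulVec v ∈ F i := by
        have := Submodule.add_mem _ (Fle i e1) hv
        simpa using this
      have e3 := hy i _ e2
      rw [Units.val_mul, ← Matrix.mulVec_mulVec]
      have := Submodule.add_mem _ e3 e1
      rw [sub_add_sub_cancel] at this; exact this
    refine Subgroup.closure_induction_right (p := fun (h : GL (Fin G.n) k) _ => ∀ i, ∀ v ∈ F i, (h : Matrix (Fin G.n) (Fin G.n) k).mulVec v - v ∈ F (i+1)) ?_ ?_ ?_ hh
    · intro i v _; simp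
    · rintro y _ _ ⟨x, hx, t, rfl⟩ hy
      exact hstep y hy x hx t
    · rintro y _ _ ⟨x, hx, t, rfl⟩ hy
      have e : (expU (matX G x) (hp x hx) t)⁻¹ = expU (matX G x) (hp x hx) (-t) := by
        apply Units.ext; rfl
      rw [e]
      exact hstep y hy x hx (-t)
  have hunip : ∀ h ∈ (H : Set (GL (Fin G.n) k)), IsUnipotentEl h := by
    intro h hh
    apply matrix_pow_zero
    refine ⟨r, ?_⟩
    have : ∀ i v, (((h : Matrix (Fin G.n) (Fin G.n) k) - 1) ^ i).mulVec v ∈ F i := by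
      intro i
      induction i with
      | zero => intro v; rw [F0]; trivial
      | succ i ih =>
        intro v
        rw [pow_succ', ← Matrix.mulVec_mulVec, Matrix.sub_mulVec, Matrix.one_mulVec]
        exact hword h hh i _ (ih v)
    apply Matrix.ext_of_mulVec_single
    intro i
    have h2 := this r (Pi.single i 1)
    rw [Fr, Submodule.mem_bot] at h2
    rw [h2, Matrix.zero_mulVec]
  have hconj : ∀ g ∈ G.toSubgroup, ∀ h ∈ (H : Set (GL (Fin G.n) k)), g * h * g⁻¹ ∈ (H : Set (GL (Fin G.n) k)) := by
    intro g hg h hh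
    have hle : H ≤ H.comap (MulAut.conj g).toMonoidHom := by
      change Subgroup.closure S ≤ _
      rw [Subgroup.closure_le]
      rintro _ ⟨x, hx, t, rfl⟩
      change g * expU (matX G x) (hp x hx) t * g⁻¹ ∈ H
      have hx2 := had x hx ⟨g, hg⟩
      have e0 : matX G (Ad (gO_affGrp G) ⟨g, hg⟩ x) = (g : Matrix (Fin G.n) (Fin G.n) k) * matX G x * ((g⁻¹ : GL (Fin G.n) k) : Matrix (Fin G.n) (Fin G.n) k) := by
        apply Matrix.toLin'.injective
        rw [← dr_std, dr_Ad, dr_std, Matrix.toLin'_mul, Matrix.toLin'_mul]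
        rfl
      have e : g * expU (matX G x) (hp x hx) t * g⁻¹ = expU (matX G (Ad (gO_affGrp G) ⟨g, hg⟩ x)) (hp _ hx2) t := by
        apply Units.ext
        change (g : Matrix (Fin G.n) (Fin G.n) k) * expM (matX G x) t * ((g⁻¹ : GL (Fin G.n) k) : Matrix (Fin G.n) (Fin G.n) k) = expM (matX G (Ad (gO_affGrp G) ⟨g, hg⟩ x)) t
        rw [e0, expM, expM, Finset.mul_sum, Finset.sum_mul]
        refine Finset.sum_congr rfl fun l _ => ?_
        rw [Matrix.mul_smul, Matrix.smul_mul]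
        congr 1
        rw [Units.conj_pow]
      rw [e]
      exact hsub _ hx2 t
    exact hle hh
  have hid : (H : Set (GL (Fin G.n) k)) ⊆ idComponent G := by
    intro h hh
    exact ⟨H, ⟨hHG, H.one_mem, hconn⟩, hh⟩
  have hH1 := hG (H : Set (GL (Fin G.n) k)) hid H.one_mem (fun a ha b hb => H.mul_mem ha hb) (fun a ha => H.inv_mem ha)
    (by
      intro g hg h hh
      obtain ⟨C, ⟨hC, _, _⟩, hgC⟩ := hg
      exact hconj g (hC hgC) h hh) hconn hunip
  rw [eq_bot_iff]
  intro x hx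
  rw [Submodule.mem_bot]
  apply matX_inj G (hN hx)
  apply eq_zero_of_expM (hp x hx)
  intro t
  have : expU (matX G x) (hp x hx) t ∈ (H : Set (GL (Fin G.n) k)) := hsub x hx t
  rw [hH1] at this
  exact congrArg Units.val this

theorem redHyp [IsAlgClosed k] (hG : IsReductive G) : RedHyp (gO_affGrp G) (stdRep_isRat G) where
  fd := inferInstance
  inj x hx h := by
    apply matX_inj G hx
    rw [dr_std] at h
    exact Matrix.toLin'.injective (by rw [h, map_zero])
  nil N hN h := nil_bot G hG N hN.le hN.brk hN.ad h

/-- Linear reductivity of a reductive group. -/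
theorem linRedG [IsAlgClosed k] (hG : IsReductive G)
    {M : Type} [AddCommGroup M] [Module k M] {ρ : Representation k (Pt G) M} (h : IsRat (gO G) ρ)
    (U : Submodule k M) (b : M) (hb : ∀ g, ρ g b - b ∈ U) :
    ∃ u ∈ U, ∀ g, ρ g (b - u) = b - u :=
  linRed (gO_affGrp G) (redHyp G hG) h U b hb

end RedG

end PaperGIT

namespace PaperGIT

section Gen

/-- Nullstellensatz transport to field-valued points. -/
theorem ns_transport {k : Type} [Field k] [IsAlgClosed k] {σ : Type} [Finite σ] (J : Set (MvPolynomial σ k))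
    (Φ : MvPolynomial σ k) (h : ∀ p : σ → k, (∀ f ∈ J, MvPolynomial.eval p f = 0) → MvPolynomial.eval p Φ = 0)
    {K : Type} [Field K] [Algebra k K] (q : σ → K) (hq : ∀ f ∈ J, MvPolynomial.aeval (R := k) q f = 0) :
    MvPolynomial.aeval (R := k) q Φ = 0 := by
  have h1 : Φ ∈ MvPolynomial.vanishingIdeal k (MvPolynomial.zeroLocus k (Ideal.span J)) := by
    rw [MvPolynomial.mem_vanishingIdeal_iff]
    intro p hp
    rw [MvPolynomial.aeval_eq_eval]
    apply h p
    intro f hf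
    have := (MvPolynomial.mem_zeroLocus_iff.1 hp) f (Ideal.subset_span hf)
    rwa [MvPolynomial.aeval_eq_eval] at this
  rw [MvPolynomial.vanishingIdeal_zeroLocus_eq_radical] at h1
  obtain ⟨N, hN⟩ := h1
  have h2 : Ideal.span J ≤ RingHom.ker (MvPolynomial.aeval (R := k) q) := by
    rw [Ideal.span_le]; exact hq
  have h3 := h2 hN
  rw [RingHom.mem_ker, map_pow] at h3
  by_contra h4
  exact pow_ne_zero N h4 h3

/-- A common zero over some extension field gives one over `k`. -/
theorem ns_exists {k : Type} [Field k] [IsAlgClosed k] {σ : Type} [Finite σ] (J : Set (MvPolynomial σ k))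
    {K : Type} [Field K] [Algebra k K] (q : σ → K) (hq : ∀ f ∈ J, MvPolynomial.aeval (R := k) q f = 0) :
    ∃ p : σ → k, ∀ f ∈ J, MvPolynomial.eval p f = 0 := by
  by_contra hc
  push Not at hc
  have := ns_transport J 1 (fun p hp => by
    obtain ⟨f, hf, hf'⟩ := hc p
    exact absurd (hp f hf) hf') q hq
  simp at this

/-- Fourier–Motzkin. -/
theorem sign_rat {Γ : Type*} [AddCommGroup Γ] [LinearOrder Γ] [IsOrderedAddMonoid Γ] (r : ℕ) (ν : (Fin r → ℤ) →+ Γ)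
    (D : Finset (Fin r → ℤ)) (hD : ∀ d ∈ D, 0 < ν d) : ∃ l : Fin r → ℚ, ∀ d ∈ D, 0 < ∑ i, l i * d i := by
  classical
  induction r with
  | zero =>
    refine ⟨fun _ => 0, fun d hd => ?_⟩
    have := hD d hd
    rw [Subsingleton.elim d 0, map_zero] at this
    exact absurd this (lt_irrefl _)
  | succ r ih =>
    let ι : (Fin r → ℤ) →+ (Fin (r+1) → ℤ) :=
      { toFun := fun v => Fin.cons 0 v
        map_zero' := by funext i; refine Fin.cases ?_ (fun _ => ?_) i <;> simp
        map_add' := by intro u v; funext i; refine Fin.cases ?_ (fun _ => ?_) i <;> simp }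
    let cmb : (Fin (r+1) → ℤ) → (Fin (r+1) → ℤ) → (Fin r → ℤ) := fun p q i => p 0 * q i.succ - q 0 * p i.succ
    have hcmb : ∀ p q, ι (cmb p q) = p 0 • q + (- q 0) • p := by
      intro p q; funext i
      refine Fin.cases ?_ (fun i => ?_) i
      · simp [ι]; ring
      · simp [ι, cmb]; ring
    let D0 := (D.filter (fun d => d 0 = 0)).image (fun d (i : Fin r) => d i.succ)
    let D1 := (D.filter (fun d => 0 < d 0) ×ˢ D.filter (fun d => d 0 < 0)).image (fun z => cmb z.1 z.2)
    obtain ⟨l, hl⟩ := ih (ν.comp ι) (D0 ∪ D1) (by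
      intro d hd
      rcases Finset.mem_union.1 hd with hd | hd
      · obtain ⟨d, hd', rfl⟩ := Finset.mem_image.1 hd
        obtain ⟨hd, hd0⟩ := Finset.mem_filter.1 hd'
        have : ι (fun i => d i.succ) = d := by
          funext i; refine Fin.cases ?_ (fun i => ?_) i
          · simp [ι, hd0]
          · simp [ι]
        rw [AddMonoidHom.comp_apply, this]; exact hD d hd
      · obtain ⟨⟨p, q⟩, hd', rfl⟩ := Finset.mem_image.1 hd
        obtain ⟨hp, hq⟩ := Finset.mem_product.1 hd'
        obtain ⟨hp, hp0⟩ := Finset.mem_filter.1 hp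
        obtain ⟨hq, hq0⟩ := Finset.mem_filter.1 hq
        rw [AddMonoidHom.comp_apply, hcmb, map_add, map_zsmul, map_zsmul]
        exact add_pos (zsmul_pos (hD q hq) hp0) (zsmul_pos (hD p hp) (by simpa using hq0)))
    let ev : (Fin (r+1) → ℤ) → ℚ := fun d => ∑ i : Fin r, l i * d i.succ
    obtain ⟨c, hc1, hc2⟩ := Order.exists_between_finsets
      ((D.filter (fun d => 0 < d 0)).image (fun d => - ev d / d 0))
      ((D.filter (fun d => d 0 < 0)).image (fun d => - ev d / d 0)) (by
        intro a ha b hb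
        obtain ⟨p, hp, rfl⟩ := Finset.mem_image.1 ha
        obtain ⟨q, hq, rfl⟩ := Finset.mem_image.1 hb
        have h1 := hl (cmb p q) (Finset.mem_union_right _ (Finset.mem_image.2 ⟨(p, q), Finset.mem_product.2 ⟨hp, hq⟩, rfl⟩))
        have hp0 := (Finset.mem_filter.1 hp).2
        have hq0 := (Finset.mem_filter.1 hq).2
        have h2 : ∑ i, l i * (cmb p q i : ℚ) = p 0 * ev q - q 0 * ev p := by
          simp only [ev, cmb, Finset.mul_sum, ← Finset.sum_sub_distrib]
          refine Finset.sum_congr rfl fun i _ => ?_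
          push_cast; ring
        rw [h2] at h1
        have hp0' : (0:ℚ) < p 0 := by exact_mod_cast hp0
        have hq0' : (q 0 : ℚ) < 0 := by exact_mod_cast hq0
        rw [div_lt_iff₀ hp0', div_mul_eq_mul_div, lt_div_iff_of_neg hq0']
        linarith)
    refine ⟨Fin.cons c l, fun d hd => ?_⟩
    rw [Fin.sum_univ_succ]
    simp only [Fin.cons_zero, Fin.cons_succ]
    change 0 < c * d 0 + ev d
    rcases lt_trichotomy (d 0) 0 with h | h | h
    · have := hc2 _ (Finset.mem_image_of_mem _ (Finset.mem_filter.2 ⟨hd, h⟩))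
      have h' : (d 0 : ℚ) < 0 := by exact_mod_cast h
      rw [lt_div_iff_of_neg h'] at this
      linarith
    · have := hl (fun i => d i.succ) (Finset.mem_union_left _ (Finset.mem_image.2 ⟨d, Finset.mem_filter.2 ⟨hd, h⟩, rfl⟩))
      rw [h]; simpa [ev] using this
    · have := hc1 _ (Finset.mem_image_of_mem _ (Finset.mem_filter.2 ⟨hd, h⟩))
      have h' : (0 : ℚ) < d 0 := by exact_mod_cast h
      rw [div_lt_iff₀ h'] at this
      linarith

theorem sign_int {Γ : Type*} [AddCommGroup Γ] [LinearOrder Γ] [IsOrderedAddMonoid Γ] (r : ℕ) (ν : (Fin r → ℤ) →+ Γ)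
    (D : Finset (Fin r → ℤ)) (hD : ∀ d ∈ D, 0 < ν d) : ∃ l : Fin r → ℤ, ∀ d ∈ D, 0 < ∑ i, l i * d i := by
  obtain ⟨l, hl⟩ := sign_rat r ν D hD
  obtain ⟨N, hN⟩ := IsLocalization.exist_integer_multiples_of_finite (nonZeroDivisors ℤ) l
  have hN0 : (N : ℤ) ≠ 0 := nonZeroDivisors.ne_zero N.2
  choose l' hl' using hN
  refine ⟨fun i => N * l' i, fun d hd => ?_⟩
  have h1 := hl d hd
  have h2 : ((∑ i, (N * l' i) * d i : ℤ) : ℚ) = (N : ℚ) ^ 2 * ∑ i, l i * d i := by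
    push_cast
    rw [Finset.mul_sum]
    refine Finset.sum_congr rfl fun i _ => ?_
    have := hl' i
    simp only [algebraMap_int_eq, eq_intCast, Algebra.smul_def] at this
    rw [this]; ring
  have h3 : (0 : ℚ) < (N : ℚ) ^ 2 := by
    have : (N : ℚ) ≠ 0 := by exact_mod_cast hN0
    positivity
  have : (0 : ℚ) < ((∑ i, (N * l' i) * d i : ℤ) : ℚ) := by rw [h2]; exact mul_pos h3 h1
  exact_mod_cast this

theorem sign_lemma {Γ : Type*} [AddCommGroup Γ] [LinearOrder Γ] [IsOrderedAddMonoid Γ] (n : ℕ) (ν : (Fin n → ℤ) →+ Γ)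
    (D : Finset (Fin n → ℤ)) : ∃ φ : (Fin n → ℤ) →+ ℤ, (∀ χ, ν χ = 0 → φ χ = 0) ∧ ∀ d ∈ D, 0 < ν d → 0 < φ d := by
  classical
  let R := LinearMap.range ν.toIntLinearMap
  have : Module.Finite ℤ R := inferInstance
  have : Module.IsTorsionFree ℤ R := inferInstance
  have : Module.Free ℤ R := Module.free_of_finite_type_torsion_free'
  let B := Module.finBasis ℤ R
  let ν' : (Fin n → ℤ) →ₗ[ℤ] R := ν.toIntLinearMap.rangeRestrict
  let μ : (Fin (Module.finrank ℤ R) → ℤ) →+ Γ := (R.subtype.comp B.equivFun.symm.toLinearMap).toAddMonoidHom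
  have hμ : ∀ χ, μ (B.equivFun (ν' χ)) = ν χ := by
    intro χ
    change ((B.equivFun.symm (B.equivFun (ν' χ)) : R) : Γ) = ν χ
    rw [LinearEquiv.symm_apply_apply]; rfl
  obtain ⟨l, hl⟩ := sign_int _ μ ((D.filter (fun d => 0 < ν d)).image (fun d => B.equivFun (ν' d))) (by
    intro d hd
    obtain ⟨d, hd', rfl⟩ := Finset.mem_image.1 hd
    rw [hμ]; exact (Finset.mem_filter.1 hd').2)
  refine ⟨{ toFun := fun χ => ∑ i, l i * B.equivFun (ν' χ) i
            map_zero' := by simp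
            map_add' := by intro a b; simp [mul_add, Finset.sum_add_distrib] }, ?_, ?_⟩
  · intro χ hχ
    have : ν' χ = 0 := Subtype.ext hχ
    simp [this]
  · intro d hd h0
    exact hl _ (Finset.mem_image_of_mem _ (Finset.mem_filter.2 ⟨hd, h0⟩))

/-- Torus characters. -/
theorem char_indep {k : Type} [Field k] [CharZero k] {n : ℕ} (s : Finset (Fin n → ℤ)) (c : (Fin n → ℤ) → k)
    (h : ∀ t : Fin n → kˣ, ∑ χ ∈ s, ((∏ i, t i ^ χ i : kˣ) : k) * c χ = 0) : ∀ χ ∈ s, c χ = 0 := by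
  classical
  let ch : (Fin n → ℤ) → ((Fin n → kˣ) →* k) := fun χ =>
    (Units.coeHom k).comp
      { toFun := fun t => ∏ i, t i ^ χ i
        map_one' := by simp
        map_mul' := by intro a b; simp [mul_zpow, Finset.prod_mul_distrib] }
  have hinj : Function.Injective ch := by
    intro χ χ' hc
    funext i
    have h2 : (2 : k) ≠ 0 := two_ne_zero
    have := DFunLike.congr_fun hc (Pi.mulSingle i (Units.mk0 2 h2))
    change ((∏ j, (Pi.mulSingle i (Units.mk0 2 h2) : Fin n → kˣ) j ^ χ j : kˣ) : k) = ((∏ j, (Pi.mulSingle i (Units.mk0 2 h2) : Fin n → kˣ) j ^ χ' j : kˣ) : k) at this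
    rw [Finset.prod_eq_single i (by intro j _ hj; simp [hj]) (by simp),
      Finset.prod_eq_single i (by intro j _ hj; simp [hj]) (by simp)] at this
    simp only [Pi.mulSingle_eq_same, Units.val_zpow_eq_zpow_val, Units.val_mk0] at this
    have h3 : ((2:ℚ) ^ χ i) = (2:ℚ) ^ χ' i := by
      apply (algebraMap ℚ k).injective
      simpa using this
    exact zpow_right_injective₀ (by norm_num) (by norm_num) h3
  have hli := (linearIndependent_monoidHom (Fin n → kˣ) k).comp ch hinj
  rw [linearIndependent_iff'] at hli
  refine hli s c ?_
  funext t
  have := h t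
  rw [Finset.sum_apply, Pi.zero_apply, ← this]
  refine Finset.sum_congr rfl fun χ _ => ?_
  simp only [Pi.smul_apply, Function.comp, smul_eq_mul]
  rw [mul_comm]; rfl

/-- Express a family through finitely many of its members. -/
theorem translate_basis {k : Type} [Field k] {P V : Type} [AddCommGroup V] [Module k V] (T : P → V)
    (A : Subalgebra k (P → k)) {N : ℕ} (φ : Fin N → P → k) (hφ : ∀ i, φ i ∈ A) (v : Fin N → V)
    (h : ∀ p, T p = ∑ i, φ i p • v i) :
    ∃ (r : ℕ) (a : Fin r → P) (ψ : Fin r → P → k), (∀ j, ψ j ∈ A) ∧ ∀ p, T p = ∑ j, ψ j p • T (a j) := by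
  let W := Submodule.span k (Set.range T)
  have hle : W ≤ Submodule.span k (Set.range v) := by
    rw [Submodule.span_le]
    rintro _ ⟨p, rfl⟩
    rw [h p]
    exact Submodule.sum_mem _ fun i _ => Submodule.smul_mem _ _ (Submodule.subset_span ⟨i, rfl⟩)
  have : FiniteDimensional k (Submodule.span k (Set.range v)) := FiniteDimensional.span_of_finite k (Set.finite_range v)
  have : FiniteDimensional k W := Submodule.finiteDimensional_of_le hle
  have hfg : W.FG := Module.Finite.iff_fg.1 this
  obtain ⟨s, hs1, hs2⟩ := (Submodule.fg_span_iff_fg_span_finset_subset _).1 hfg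
  have ha : ∀ j : Fin s.card, ∃ p, T p = (s.equivFin.symm j : V) := fun j => hs1 (s.equivFin.symm j).2
  choose a ha using ha
  have hs3 : Submodule.span k (Set.range fun j => T (a j)) = W := by
    change _ = Submodule.span k (Set.range T)
    rw [hs2]
    congr 1
    ext w
    constructor
    · rintro ⟨j, rfl⟩
      change T (a j) ∈ _
      rw [ha j]; exact (s.equivFin.symm j).2
    · intro hw
      refine ⟨s.equivFin ⟨w, hw⟩, ?_⟩
      change T (a _) = _
      rw [ha]; simp
  let L : (Fin s.card → k) →ₗ[k] V := Fintype.linearCombination k (fun j => T (a j))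
  have hL : LinearMap.range L = W := by
    rw [← hs3]; exact Fintype.range_linearCombination k _
  obtain ⟨R0, hR0⟩ := L.rangeRestrict.exists_rightInverse_of_surjective (LinearMap.range_rangeRestrict L)
  obtain ⟨R, hR⟩ := R0.exists_extend
  refine ⟨s.card, a, fun j p => R (T p) j, fun j => ?_, fun p => ?_⟩
  · have : (fun p => R (T p) j) = ∑ i, (R (v i) j) • φ i := by
      funext p
      rw [h p, map_sum, Finset.sum_apply, Finset.sum_apply]
      refine Finset.sum_congr rfl fun i _ => ?_
      simp [mul_comm]
    change (fun p => R (T p) j) ∈ A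
    rw [this]
    exact A.sum_mem fun i _ => A.smul_mem (hφ i) _
  · have hp : T p ∈ LinearMap.range L := by rw [hL]; exact Submodule.subset_span ⟨p, rfl⟩
    have h1 : R (T p) = R0 ⟨T p, hp⟩ := by rw [← hR]; rfl
    have h2 := LinearMap.congr_fun hR0 ⟨T p, hp⟩
    have h3 : L (R0 ⟨T p, hp⟩) = T p := congrArg Subtype.val h2
    rw [← h1] at h3
    exact h3.symm

end Gen

end PaperGIT

namespace PaperGIT

section Smith

variable {K : Type} [Field K]

/-- Matrices invertible over the subring `R`. -/
def IsRU {ι κ : Type} [Fintype κ] [DecidableEq ι] (R : Subring K) (a : Matrix ι κ K) : Prop :=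
  (∀ i j, a i j ∈ R) ∧ ∃ a' : Matrix κ ι K, (∀ i j, a' i j ∈ R) ∧ a * a' = 1

theorem IsRU.mul {ι : Type} [Fintype ι] [DecidableEq ι] {R : Subring K} {a b : Matrix ι ι K}
    (ha : IsRU R a) (hb : IsRU R b) : IsRU R (a * b) := by
  obtain ⟨ha, a', ha', h⟩ := ha
  obtain ⟨hb, b', hb', h'⟩ := hb
  refine ⟨fun i j => ?_, b' * a', fun i j => ?_, ?_⟩
  · rw [Matrix.mul_apply]; exact R.sum_mem fun l _ => R.mul_mem (ha _ _) (hb _ _)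
  · rw [Matrix.mul_apply]; exact R.sum_mem fun l _ => R.mul_mem (hb' _ _) (ha' _ _)
  · rw [Matrix.mul_assoc, ← Matrix.mul_assoc b, h', Matrix.one_mul, h]

theorem mem_one {ι : Type} [DecidableEq ι] (R : Subring K) (i j : ι) : (1 : Matrix ι ι K) i j ∈ R := by
  rw [Matrix.one_apply]; split_ifs
  · exact R.one_mem
  · exact R.zero_mem

theorem IsRU.one {ι : Type} [Fintype ι] [DecidableEq ι] {R : Subring K} : IsRU R (1 : Matrix ι ι K) :=
  ⟨mem_one R, 1, mem_one R, Matrix.one_mul _⟩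

theorem IsRU.sub {ι κ : Type} [Fintype ι] [DecidableEq ι] [Fintype κ] [DecidableEq κ] {R : Subring K} {a : Matrix ι ι K}
    (ha : IsRU R a) (e e' : κ ≃ ι) : IsRU R (a.submatrix e e') := by
  obtain ⟨ha, a', ha', h⟩ := ha
  refine ⟨fun i j => ha _ _, a'.submatrix e' e, fun i j => ha' _ _, ?_⟩
  rw [Matrix.submatrix_mul_equiv, h, Matrix.submatrix_one_equiv]

theorem exists_equiv_fin (N : ℕ) (i : Fin (N+1)) : ∃ e : Unit ⊕ Fin N ≃ Fin (N+1), e (Sum.inl ()) = i := by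
  let e0 : Unit ⊕ Fin N ≃ Fin (N+1) := Fintype.equivOfCardEq (by simp [add_comm])
  exact ⟨e0.trans (Equiv.swap (e0 (Sum.inl ())) i), by simp⟩

theorem smith (R : ValuationSubring K) (n : ℕ) : ∀ g : Matrix (Fin n) (Fin n) K, ∃ (a b : Matrix (Fin n) (Fin n) K) (d : Fin n → K),
    IsRU R.toSubring a ∧ IsRU R.toSubring b ∧ g = a * Matrix.diagonal d * b := by
  induction n with
  | zero => intro g; exact ⟨1, 1, 0, IsRU.one, IsRU.one, Subsingleton.elim _ _⟩
  | succ N ih =>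
    intro g
    obtain ⟨⟨i0, j0⟩, hmax⟩ := Finite.exists_max (fun z : Fin (N+1) × Fin (N+1) => R.valuation (g z.1 z.2))
    by_cases hp : g i0 j0 = 0
    · refine ⟨1, 1, 0, IsRU.one, IsRU.one, ?_⟩
      ext i j
      have := hmax (i, j)
      simp only [hp, map_zero] at this
      have : g i j = 0 := by simpa using this
      simp [this]
    have hdiv : ∀ i j, g i j * (g i0 j0)⁻¹ ∈ R.toSubring := by
      intro i j
      change _ ∈ R
      rw [← ValuationSubring.valuation_le_one_iff, map_mul, map_inv₀]
      exact mul_inv_le_one_of_le₀ (hmax (i, j)) zero_le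
    obtain ⟨e1, he1⟩ := exists_equiv_fin N i0
    obtain ⟨e2, he2⟩ := exists_equiv_fin N j0
    obtain ⟨B, hB⟩ : ∃ B : Matrix Unit (Fin N) K, B = Matrix.of (fun _ j => g i0 (e2 (Sum.inr j))) := ⟨_, rfl⟩
    obtain ⟨C, hC⟩ : ∃ C : Matrix (Fin N) Unit K, C = Matrix.of (fun i _ => g (e1 (Sum.inr i)) j0 * (g i0 j0)⁻¹) := ⟨_, rfl⟩
    obtain ⟨B', hB'⟩ : ∃ B' : Matrix Unit (Fin N) K, B' = Matrix.of (fun _ j => g i0 (e2 (Sum.inr j)) * (g i0 j0)⁻¹) := ⟨_, rfl⟩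
    obtain ⟨D, hD⟩ : ∃ D : Matrix (Fin N) (Fin N) K, D = Matrix.of (fun i j => g (e1 (Sum.inr i)) (e2 (Sum.inr j))) := ⟨_, rfl⟩
    obtain ⟨a, b, d, ⟨ha, a', ha', haa⟩, ⟨hb, b', hb', hbb⟩, hab⟩ := ih (D - C * B)
    have hCR : ∀ i j, C i j ∈ R.toSubring := by intro i j; rw [hC]; exact hdiv _ _
    have hBR : ∀ i j, B' i j ∈ R.toSubring := by intro i j; rw [hB']; exact hdiv _ _
    have h1 : IsRU R.toSubring (Matrix.fromBlocks (1 : Matrix Unit Unit K) 0 C a) := by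
      refine ⟨?_, Matrix.fromBlocks 1 0 (-(a' * C)) a', ?_, ?_⟩
      · rintro (i | i) (j | j)
        · exact mem_one (ι := Unit) _ i j
        · exact R.toSubring.zero_mem
        · exact hCR _ _
        · exact ha _ _
      · rintro (i | i) (j | j)
        · exact mem_one (ι := Unit) _ i j
        · exact R.toSubring.zero_mem
        · refine R.toSubring.neg_mem ?_
          rw [Matrix.mul_apply]; exact R.toSubring.sum_mem fun l _ => R.toSubring.mul_mem (ha' _ _) (hCR _ _)
        · exact ha' _ _
      · rw [Matrix.fromBlocks_multiply]
        simp [← Matrix.mul_assoc, haa, Matrix.fromBlocks_one]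
    have h2 : IsRU R.toSubring (Matrix.fromBlocks (1 : Matrix Unit Unit K) B' 0 b) := by
      refine ⟨?_, Matrix.fromBlocks 1 (-(B' * b')) 0 b', ?_, ?_⟩
      · rintro (i | i) (j | j)
        · exact mem_one (ι := Unit) _ i j
        · exact hBR _ _
        · exact R.toSubring.zero_mem
        · exact hb _ _
      · rintro (i | i) (j | j)
        · exact mem_one (ι := Unit) _ i j
        · refine R.toSubring.neg_mem ?_
          rw [Matrix.mul_apply]; exact R.toSubring.sum_mem fun l _ => R.toSubring.mul_mem (hBR _ _) (hb' _ _)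
        · exact R.toSubring.zero_mem
        · exact hb' _ _
      · rw [Matrix.fromBlocks_multiply]
        simp [hbb, Matrix.fromBlocks_one]
    have key : g.submatrix e1 e2 = Matrix.fromBlocks (1 : Matrix Unit Unit K) 0 C a * Matrix.diagonal (Sum.elim (fun _ => g i0 j0) d) * Matrix.fromBlocks (1 : Matrix Unit Unit K) B' 0 b := by
      rw [← Matrix.fromBlocks_diagonal, Matrix.fromBlocks_multiply, Matrix.fromBlocks_multiply]
      simp only [Matrix.one_mul, Matrix.zero_mul, add_zero, Matrix.mul_zero, zero_add, Matrix.mul_one]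
      rw [← hab]
      ext (i | i) (j | j)
      · simp [he1, he2]
      · simp [he1, hB']; field_simp
      · simp [he2, hC, Matrix.mul_apply, Matrix.diagonal]; field_simp
      · simp [hC, hB, hB', hD, Matrix.mul_apply, Matrix.diagonal]; field_simp; ring
    refine ⟨_, _, fun i => Sum.elim (fun _ => g i0 j0) d (e1.symm i), h1.sub e1.symm e1.symm, h2.sub e1.symm e2.symm, ?_⟩
    have : Matrix.diagonal (fun i => Sum.elim (fun _ => g i0 j0) d (e1.symm i)) = (Matrix.diagonal (Sum.elim (fun _ => g i0 j0) d)).submatrix e1.symm e1.symm := by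
      rw [Matrix.submatrix_diagonal_equiv]; rfl
    rw [this, Matrix.submatrix_mul_equiv, Matrix.submatrix_mul_equiv, ← key]
    ext i j; simp

end Smith

section LU

variable {k : Type} [Field k]

theorem lu {Γ : Type*} [LinearOrder Γ] (n : ℕ) : ∀ γ : Fin n → Γ, ∃ Δ : MvPolynomial (Fin n × Fin n) k,
    MvPolynomial.eval (mat2pt (1 : Matrix (Fin n) (Fin n) k)) Δ ≠ 0 ∧ ∀ A : Matrix (Fin n) (Fin n) k, MvPolynomial.eval (mat2pt A) Δ ≠ 0 →
      ∃ p q : Matrix (Fin n) (Fin n) k, A = p * q ∧ (∀ i j, γ i < γ j → p i j = 0) ∧ (∀ i j, γ j < γ i → q i j = 0) := by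
  induction n with
  | zero => intro γ; exact ⟨1, by simp, fun A _ => ⟨1, 1, Subsingleton.elim _ _, fun i => i.elim0, fun i => i.elim0⟩⟩
  | succ N ih =>
    intro γ
    obtain ⟨i0, hmin⟩ := Finite.exists_min γ
    obtain ⟨e, he⟩ := exists_equiv_fin N i0
    obtain ⟨Δ, hΔ1, hΔ⟩ := ih (fun i => γ (e (Sum.inr i)))
    let s : Fin N × Fin N → MvPolynomial (Fin (N+1) × Fin (N+1)) k := fun z =>
      MvPolynomial.X (i0, i0) * MvPolynomial.X (e (Sum.inr z.1), e (Sum.inr z.2)) - MvPolynomial.X (e (Sum.inr z.1), i0) * MvPolynomial.X (i0, e (Sum.inr z.2))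
    have hs : ∀ A : Matrix (Fin (N+1)) (Fin (N+1)) k, MvPolynomial.eval (mat2pt A) (MvPolynomial.X (i0, i0) * MvPolynomial.aeval s Δ) =
        A i0 i0 * MvPolynomial.eval (mat2pt (Matrix.of fun i j => A i0 i0 * A (e (Sum.inr i)) (e (Sum.inr j)) - A (e (Sum.inr i)) i0 * A i0 (e (Sum.inr j)))) Δ := by
      intro A
      rw [map_mul, MvPolynomial.eval_X]
      have := MvPolynomial.comp_aeval_apply (R := k) s (MvPolynomial.aeval (R := k) (mat2pt A)) Δ
      rw [MvPolynomial.aeval_eq_eval] at this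
      rw [this, MvPolynomial.aeval_eq_eval]
      congr 3
      funext z
      simp [s, mat2pt]
    refine ⟨MvPolynomial.X (i0, i0) * MvPolynomial.aeval s Δ, ?_, ?_⟩
    · rw [hs]
      have : (Matrix.of fun i j => (1 : Matrix (Fin (N+1)) (Fin (N+1)) k) i0 i0 * (1 : Matrix (Fin (N+1)) (Fin (N+1)) k) (e (Sum.inr i)) (e (Sum.inr j)) - (1 : Matrix (Fin (N+1)) (Fin (N+1)) k) (e (Sum.inr i)) i0 * (1 : Matrix (Fin (N+1)) (Fin (N+1)) k) i0 (e (Sum.inr j))) = (1 : Matrix (Fin N) (Fin N) k) := by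
        ext i j
        simp [Matrix.one_apply, ← he]
      rw [this]; simpa using hΔ1
    · intro A hA
      rw [hs] at hA
      have ha := left_ne_zero_of_mul hA
      obtain ⟨p, q, hpq, hp, hq⟩ := hΔ _ (right_ne_zero_of_mul hA)
      obtain ⟨C, hC⟩ : ∃ C : Matrix (Fin N) Unit k, C = Matrix.of (fun i _ => A (e (Sum.inr i)) i0 * (A i0 i0)⁻¹) := ⟨_, rfl⟩
      obtain ⟨B, hB⟩ : ∃ B : Matrix Unit (Fin N) k, B = Matrix.of (fun _ j => A i0 (e (Sum.inr j))) := ⟨_, rfl⟩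
      obtain ⟨a, haa⟩ : ∃ a : Matrix Unit Unit k, a = Matrix.of (fun _ _ => A i0 i0) := ⟨_, rfl⟩
      have key : A.submatrix e e = Matrix.fromBlocks (1 : Matrix Unit Unit k) 0 C ((A i0 i0)⁻¹ • p) * Matrix.fromBlocks a B 0 q := by
        rw [Matrix.fromBlocks_multiply]
        simp only [Matrix.one_mul, Matrix.zero_mul, add_zero, Matrix.mul_zero, Matrix.smul_mul]
        rw [← hpq]
        ext (i | i) (j | j)
        · simp [he, haa]
        · simp [he, hB]
        · simp [he, hC, haa, Matrix.mul_apply]; field_simp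
        · simp [hC, hB, Matrix.mul_apply]; field_simp; ring
      refine ⟨(Matrix.fromBlocks (1 : Matrix Unit Unit k) 0 C ((A i0 i0)⁻¹ • p)).submatrix e.symm e.symm, (Matrix.fromBlocks a B 0 q).submatrix e.symm e.symm, ?_, ?_, ?_⟩
      · rw [Matrix.submatrix_mul_equiv, ← key]; ext i j; simp
      · intro i j hij
        obtain ⟨i, rfl⟩ := e.surjective i
        obtain ⟨j, rfl⟩ := e.surjective j
        rcases i with i | i <;> rcases j with j | j
        · exact absurd hij (lt_irrefl _)
        · simp
        · exact absurd hij (not_lt.2 (by rw [he]; exact hmin _))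
        · simp [hp i j hij]
      · intro i j hij
        obtain ⟨i, rfl⟩ := e.surjective i
        obtain ⟨j, rfl⟩ := e.surjective j
        rcases i with i | i <;> rcases j with j | j
        · exact absurd hij (lt_irrefl _)
        · exact absurd hij (not_lt.2 (by rw [he]; exact hmin _))
        · simp
        · simp [hq i j hij]

end LU

end PaperGIT

namespace PaperGIT

section InvGen

variable {k : Type} [Field k] [CharZero k] [IsAlgClosed k] (G : AlgGroup k)

/-- Functions on `Z` with a rational action of `G`. -/
structure RatAct {Z : Type} (B : Subalgebra k (Z → k)) (act : Pt G → Z → Z) : Prop where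
  one : ∀ z, act 1 z = z
  mul : ∀ g h z, act h (act g z) = act (g * h) z
  rat : ∀ F ∈ B, (fun q : Pt G × Z => F (act q.1 q.2)) ∈ tens (gO G) B

variable {G}

theorem RatAct.mem {Z : Type} {B : Subalgebra k (Z → k)} {act : Pt G → Z → Z} (hA : RatAct G B act) {F : Z → k} (hF : F ∈ B) (g) :
    (fun z => F (act g z)) ∈ B := by
  obtain ⟨N, φ, ψ, h⟩ := mem_tens.1 (hA.rat F hF)
  have : (fun z => F (act g z)) = ∑ i, (φ i).1 g • (ψ i).1 := by
    funext z
    rw [Finset.sum_apply]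
    exact h g z
  rw [this]
  exact B.sum_mem fun i _ => B.smul_mem (ψ i).2 _

/-- tuples of elements of `B` -/
def tupS {Z : Type} (B : Subalgebra k (Z → k)) (r : ℕ) : Submodule k (Fin r → Z → k) where
  carrier := {F | ∀ i, F i ∈ B}
  add_mem' h h' i := B.add_mem (h i) (h' i)
  zero_mem' _ := B.zero_mem
  smul_mem' c _ h i := B.smul_mem (h i) c

def RatAct.rep {Z : Type} {B : Subalgebra k (Z → k)} {act : Pt G → Z → Z} (hA : RatAct G B act) (r : ℕ) :
    Representation k (Pt G) (tupS B r) where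
  toFun g :=
    { toFun := fun F => ⟨fun i z => F.1 i (act g z), fun i => hA.mem (F.2 i) g⟩
      map_add' := fun _ _ => rfl
      map_smul' := fun _ _ => rfl }
  map_one' := by
    apply LinearMap.ext; intro F; apply Subtype.ext; funext i z
    change F.1 i (act 1 z) = F.1 i z
    rw [hA.one]
  map_mul' g h := by
    apply LinearMap.ext; intro F; apply Subtype.ext; funext i z
    change F.1 i (act (g * h) z) = F.1 i (act h (act g z))
    rw [hA.mul]

theorem RatAct.isRat {Z : Type} {B : Subalgebra k (Z → k)} {act : Pt G → Z → Z} (hA : RatAct G B act) (r : ℕ) :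
    IsRat (gO G) (hA.rep r) := by
  classical
  intro F
  have := fun i => mem_tens.1 (hA.rat (F.1 i) (F.2 i))
  choose N φ ψ h using this
  let E := Fintype.equivFin (Σ i : Fin r, Fin (N i))
  refine ⟨Fintype.card (Σ i : Fin r, Fin (N i)), fun a => φ (E.symm a).1 (E.symm a).2,
    fun a => ⟨Pi.single (E.symm a).1 (ψ (E.symm a).1 (E.symm a).2).1, ?_⟩, fun g => ?_⟩
  · intro i
    by_cases hi : i = (E.symm a).1
    · subst hi; rw [Pi.single_eq_same]; exact (ψ _ _).2
    · rw [Pi.single_eq_of_ne hi]; exact B.zero_mem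
  · apply Subtype.ext
    rw [AddSubmonoidClass.coe_finsetSum]
    funext i z
    change F.1 i (act g z) = _
    rw [h i g z, Finset.sum_apply, Finset.sum_apply]
    change _ = ∑ c, ((φ (E.symm c).1 (E.symm c).2).1 g • (Pi.single (E.symm c).1 (ψ (E.symm c).1 (E.symm c).2).1 : Fin r → Z → k)) i z
    rw [Equiv.sum_comp E.symm (fun s : (Σ i : Fin r, Fin (N i)) => ((φ s.1 s.2).1 g • (Pi.single s.1 (ψ s.1 s.2).1 : Fin r → Z → k)) i z), Fintype.sum_sigma]
    rw [Finset.sum_eq_single i]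
    · simp
    · intro j _ hj
      refine Finset.sum_eq_zero fun l _ => ?_
      simp [Pi.single_eq_of_ne hj.symm]
    · simp

theorem RatAct.inv (hG : IsReductive G) {Z : Type} {B : Subalgebra k (Z → k)} {act : Pt G → Z → Z} (hA : RatAct G B act) {r : ℕ}
    (U : Submodule k (Fin r → Z → k)) (b : Fin r → Z → k) (hb : ∀ i, b i ∈ B)
    (hU : ∀ g, (fun i z => b i (act g z) - b i z) ∈ U) :
    ∃ F : Fin r → Z → k, (∀ i, F i ∈ B) ∧ (∀ i g z, F i (act g z) = F i z) ∧ b - F ∈ U := by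
  obtain ⟨u, hu, h⟩ := linRedG G hG (hA.isRat r) (U.comap (tupS B r).subtype) ⟨b, hb⟩ (fun g => hU g)
  refine ⟨b - u.1, fun i => B.sub_mem (hb i) (u.2 i), fun i g z => ?_, ?_⟩
  · have := congrFun (congrFun (congrArg Subtype.val (h g)) i) z
    exact this
  · rw [sub_sub_cancel]; exact hu

theorem RatAct.inv1 (hG : IsReductive G) {Z : Type} {B : Subalgebra k (Z → k)} {act : Pt G → Z → Z} (hA : RatAct G B act)
    (U : Submodule k (Z → k)) (b : Z → k) (hb : b ∈ B)
    (hU : ∀ g, (fun z => b (act g z) - b z) ∈ U) :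
    ∃ F : Z → k, F ∈ B ∧ (∀ g z, F (act g z) = F z) ∧ b - F ∈ U := by
  obtain ⟨F, h1, h2, h3⟩ := hA.inv hG (r := 1) (U.comap (LinearMap.proj 0)) (fun _ => b) (fun _ => hb) (fun g => hU g)
  exact ⟨F 0, h1 0, h2 0, h3⟩

/-- functions vanishing on a subset -/
def vanS {Z : Type} (k : Type) [Field k] (C : Set Z) : Submodule k (Z → k) where
  carrier := {F | ∀ z ∈ C, F z = 0}
  add_mem' h h' z hz := by rw [Pi.add_apply, h z hz, h' z hz, add_zero]
  zero_mem' z _ := rfl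
  smul_mem' c _ h z hz := by rw [Pi.smul_apply, h z hz, smul_zero]

/-- Invariant Nullstellensatz. -/
theorem RatAct.invNS (hG : IsReductive G) {Z : Type} {B : Subalgebra k (Z → k)} {act : Pt G → Z → Z} (hA : RatAct G B act)
    (hfg : Algebra.FiniteType k B) (hpt : ∀ χ : B →ₐ[k] k, ∃ z, ∀ F, χ F = F.1 z)
    (C : Set Z) (hC : ∀ g, ∀ z ∈ C, act g z ∈ C) (J : Set B) (hJ : ∀ z, (∀ F ∈ J, F.1 z = 0) → z ∈ C)
    (T : Set B) (hT : ∀ F ∈ T, ∀ g z, F.1 (act g z) = F.1 z) (hno : ∀ z ∈ C, ∃ F ∈ T, F.1 z ≠ 0) (hJC : ∀ F ∈ J, ∀ z ∈ C, F.1 z = 0) :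
    ∃ (r : ℕ) (F : Fin r → B) (H : Fin r → Z → k), (∀ i, F i ∈ T) ∧ (∀ i, H i ∈ B) ∧ (∀ i g z, H i (act g z) = H i z) ∧
      ∀ z ∈ C, ∑ i, H i z * (F i).1 z = 1 := by
  have htop : Ideal.span T ⊔ Ideal.span J = ⊤ := by
    by_contra hne
    obtain ⟨χ, hχ⟩ := exists_algHom_of_ne_top (k := k) (A := B) _ hne
    obtain ⟨z, hz⟩ := hpt χ
    have h1 : z ∈ C := hJ z fun F hF => by rw [← hz]; exact hχ F (Ideal.mem_sup_right (Ideal.subset_span hF))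
    obtain ⟨F, hF, hF'⟩ := hno z h1
    apply hF'
    rw [← hz]; exact hχ F (Ideal.mem_sup_left (Ideal.subset_span hF))
  have h1 : (1 : B) ∈ Ideal.span T ⊔ Ideal.span J := by rw [htop]; trivial
  obtain ⟨a, ha, c, hc, hac⟩ := Submodule.mem_sup.1 h1
  obtain ⟨r, b, F, hb⟩ := Submodule.mem_span_set'.1 ha
  have hcz : ∀ z ∈ C, c.1 z = 0 := by
    intro z hz
    let ev : B →ₐ[k] k := (Pi.evalAlgHom k (fun _ : Z => k) z).comp B.val
    have : Ideal.span J ≤ RingHom.ker ev := by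
      rw [Ideal.span_le]; exact fun F hF => hJC F hF z hz
    exact this hc
  have hsum : ∀ z ∈ C, ∑ i, (b i).1 z * (F i).1.1 z = 1 := by
    intro z hz
    have e1 := congrFun (congrArg Subtype.val hac) z
    have e2 := congrFun (congrArg Subtype.val hb) z
    rw [AddSubmonoidClass.coe_finsetSum, Finset.sum_apply] at e2
    change a.1 z + c.1 z = 1 at e1
    rw [hcz z hz, add_zero] at e1
    exact e2.trans e1
  let L : (Fin r → Z → k) →ₗ[k] (Z → k) :=
    { toFun := fun H z => ∑ i, H i z * (F i).1.1 z
      map_add' := by intro H H'; funext z; simp [add_mul, Finset.sum_add_distrib]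
      map_smul' := by intro t H; funext z; simp [Finset.mul_sum, mul_assoc] }
  obtain ⟨H, hH1, hH2, hH3⟩ := hA.inv hG ((vanS k C).comap L) (fun i => (b i).1) (fun i => (b i).2) (by
    intro g z hz
    change ∑ i, ((b i).1 (act g z) - (b i).1 z) * (F i).1.1 z = 0
    simp only [sub_mul, Finset.sum_sub_distrib]
    rw [hsum z hz, sub_eq_zero, ← hsum _ (hC g z hz)]
    refine Finset.sum_congr rfl fun i _ => ?_
    rw [hT _ (F i).2])
  refine ⟨r, fun i => (F i).1, H, fun i => (F i).2, hH1, hH2, fun z hz => ?_⟩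
  have e := hH3 z hz
  change ∑ i, ((b i).1 z - H i z) * (F i).1.1 z = 0 at e
  simp only [sub_mul, Finset.sum_sub_distrib] at e
  rw [hsum z hz, sub_eq_zero] at e
  exact e.symm

end InvGen

section ZX

variable {k : Type} [Field k] {G : AlgGroup k} {m : ℕ}

/-- coordinate index set for `GL n × k^m` -/
abbrev Sg (n m : ℕ) : Type := (Fin n × Fin n) ⊕ (Unit ⊕ Fin m)

def ept {n m : ℕ} (h : GL (Fin n) k) (x : Fin m → k) : Sg n m → k :=
  Sum.elim (mat2pt (h : Matrix (Fin n) (Fin n) k)) (Sum.elim (fun _ => ((h⁻¹ : GL (Fin n) k) : Matrix (Fin n) (Fin n) k).det) x)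

abbrev ZT (X : GVariety G m) : Type := GL (Fin G.n) k × X.carrier

noncomputable def zO (X : GVariety G m) : Subalgebra k (ZT X → k) := reg (fun z : ZT X => ept z.1 z.2.1)

theorem zO_gpt (X : GVariety G m) (s) : (fun z : ZT X => gpt z.1 s) ∈ zO X := by
  rcases s with ⟨i, j⟩ | ⟨⟩
  · exact coord_mem_reg (fun z : ZT X => ept z.1 z.2.1) (Sum.inl (i, j))
  · exact coord_mem_reg (fun z : ZT X => ept z.1 z.2.1) (Sum.inr (Sum.inl ()))

theorem zO_x (X : GVariety G m) (i : Fin m) : (fun z : ZT X => z.2.1 i) ∈ zO X :=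
  coord_mem_reg (fun z : ZT X => ept z.1 z.2.1) (Sum.inr (Sum.inr i))

theorem ept_mem {P : Type} {n m : ℕ} {S : Subalgebra k (P → k)} {u : P → GL (Fin n) k} {v : P → Fin m → k}
    (hu : ∀ s, (fun p => gpt (u p) s) ∈ S) (hv : ∀ i, (fun p => v p i) ∈ S) (s) :
    (fun p => ept (u p) (v p) s) ∈ S := by
  rcases s with ⟨i, j⟩ | ⟨⟨⟩ | i⟩
  · exact hu (Sum.inl (i, j))
  · exact hu (Sum.inr ())
  · exact hv i

def zact (X : GVariety G m) (g : Pt G) (z : ZT X) : ZT X :=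
  (z.1 * g.1, ⟨X.act g.1⁻¹ z.2.1, X.act_mem _ (G.toSubgroup.inv_mem g.2) _ z.2.2⟩)

theorem act_coord_mem (X : GVariety G m) {P : Type} {S : Subalgebra k (P → k)} {u : P → GL (Fin G.n) k} {v : P → Fin m → k}
    (hu : ∀ s, (fun p => gpt (u p) s) ∈ S) (hv : ∀ i, (fun p => v p i) ∈ S) (hu' : ∀ p, u p ∈ G.toSubgroup)
    (hv' : ∀ p, v p ∈ X.carrier) (i) : (fun p => X.act (u p) (v p) i) ∈ S := by
  obtain ⟨q, hq⟩ := X.regular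
  have : (fun p => X.act (u p) (v p) i) = fun p => MvPolynomial.eval (ept (u p) (v p)) (q i) := by
    funext p; exact hq _ (hu' p) _ (hv' p) i
  rw [this]
  exact reg_le (S := S) (ept_mem hu hv) (eval_mem_reg (fun p => ept (u p) (v p)) (q i))

theorem zRat (X : GVariety G m) : RatAct G (zO X) (zact X) where
  one z := by
    apply Prod.ext
    · exact mul_one _
    · apply Subtype.ext
      change X.act (1 : GL (Fin G.n) k)⁻¹ z.2.1 = z.2.1
      rw [inv_one]; exact X.act_one _ z.2.2
  mul g h z := by
    apply Prod.ext
    · exact mul_assoc _ _ _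
    · apply Subtype.ext
      change X.act h.1⁻¹ (X.act g.1⁻¹ z.2.1) = X.act (g.1 * h.1)⁻¹ z.2.1
      rw [mul_inv_rev]
      exact (X.act_mul _ (G.toSubgroup.inv_mem h.2) _ (G.toSubgroup.inv_mem g.2) _ z.2.2).symm
  rat F hF := by
    have hg : ∀ s, (fun q : Pt G × ZT X => gpt q.1.1 s) ∈ tens (gO G) (zO X) := fun s =>
      tens_left (zO X) (coord_mem_reg (fun g : Pt G => gpt g.1) s)
    have hz : ∀ s, (fun q : Pt G × ZT X => gpt q.2.1 s) ∈ tens (gO G) (zO X) := fun s =>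
      tens_right (gO G) (zO_gpt X s)
    have hx : ∀ i, (fun q : Pt G × ZT X => q.2.2.1 i) ∈ tens (gO G) (zO X) := fun i =>
      tens_right (gO G) (zO_x X i)
    refine reg_pull (e := fun z : ZT X => ept z.1 z.2.1) (fun q : Pt G × ZT X => zact X q.1 q.2) ?_ hF
    exact ept_mem (gpt_mul_mem hz hg) (act_coord_mem X (gpt_inv_mem hg) hx (fun q => G.toSubgroup.inv_mem q.1.2) (fun q => q.2.2.2))

/-- Invariance of a function on `GL n × X`. -/
def ZInv (X : GVariety G m) (F : ZT X → k) : Prop := F ∈ zO X ∧ ∀ g z, F (zact X g z) = F z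

theorem zpt (X : GVariety G m) (χ : zO X →ₐ[k] k) : ∃ z, ∀ F, χ F = F.1 z := by
  let e := fun z : ZT X => ept z.1 z.2.1
  have hco : ∀ s, (fun z => e z s) ∈ zO X := fun s => coord_mem_reg e s
  let p : Sg G.n m → k := fun s => χ ⟨_, hco s⟩
  have hp : ∀ f : MvPolynomial (Sg G.n m) k, χ ⟨_, eval_mem_reg e f⟩ = MvPolynomial.eval p f := by
    intro f
    have h1 := MvPolynomial.comp_aeval_apply (R := k) (fun s => (⟨_, hco s⟩ : zO X)) χ f
    rw [MvPolynomial.aeval_eq_eval] at h1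
    rw [← h1]
    congr 1
    apply Subtype.ext
    funext z
    have h2 := MvPolynomial.comp_aeval_apply (R := k) (fun s => (⟨_, hco s⟩ : zO X)) ((Pi.evalAlgHom k (fun _ : ZT X => k) z).comp (zO X).val) f
    rw [MvPolynomial.aeval_eq_eval] at h2
    exact h2.symm
  obtain ⟨h, hh⟩ := exists_gpt (n := G.n) (fun s => p (Sum.elim (fun a => Sum.inl a) (fun _ => Sum.inr (Sum.inl ())) s)) (by
    let M : Matrix (Fin G.n) (Fin G.n) (MvPolynomial (Sg G.n m) k) := Matrix.of fun i j => MvPolynomial.X (Sum.inl (i, j))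
    have h1 := hp (M.det * MvPolynomial.X (Sum.inr (Sum.inl ())) - 1)
    have h2 : (⟨_, eval_mem_reg e (M.det * MvPolynomial.X (Sum.inr (Sum.inl ())) - 1)⟩ : zO X) = 0 := by
      apply Subtype.ext
      funext z
      change MvPolynomial.eval (e z) _ = 0
      rw [map_sub, map_mul, MvPolynomial.eval_X, RingHom.map_det, map_one, sub_eq_zero]
      have h3 : (MvPolynomial.eval (e z)).mapMatrix M = (z.1 : Matrix (Fin G.n) (Fin G.n) k) := by
        ext i j
        simp only [RingHom.mapMatrix_apply, Matrix.map_apply, M, Matrix.of_apply, MvPolynomial.eval_X]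
        rfl
      rw [h3]; exact det_mul_inv z.1
    rw [h2, map_zero, map_sub, map_mul, MvPolynomial.eval_X, RingHom.map_det, map_one] at h1
    rw [eq_comm, sub_eq_zero] at h1
    convert h1 using 3
    swap
    · rfl
    ext i j
    simp only [RingHom.mapMatrix_apply, Matrix.map_apply, M, Matrix.of_apply, MvPolynomial.eval_X, Sum.elim_inl])
  have hx : (fun i => p (Sum.inr (Sum.inr i))) ∈ X.carrier := by
    obtain ⟨I, hI⟩ := X.closed
    rw [hI]
    intro f hf
    have h1 := hp (MvPolynomial.rename (fun i => Sum.inr (Sum.inr i)) f)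
    have h2 : (⟨_, eval_mem_reg e (MvPolynomial.rename (fun i => Sum.inr (Sum.inr i)) f)⟩ : zO X) = 0 := by
      apply Subtype.ext
      funext z
      change MvPolynomial.eval (e z) _ = 0
      rw [MvPolynomial.eval_rename]
      have := hI.subset z.2.2
      exact this f hf
    rw [h2, map_zero, MvPolynomial.eval_rename] at h1
    exact h1.symm
  refine ⟨(h, ⟨_, hx⟩), fun F => ?_⟩
  obtain ⟨f, hf⟩ := mem_reg.1 F.2
  have hF : F = ⟨_, eval_mem_reg e f⟩ := Subtype.ext (funext hf)
  rw [hf, hF]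
  refine (hp f).trans ?_
  change _ = MvPolynomial.eval (ept h _) f
  congr 2
  funext s
  rcases s with a | ⟨⟨⟩ | i⟩
  · exact (congrFun hh (Sum.inl a)).symm
  · exact (congrFun hh (Sum.inr ())).symm
  · rfl

end ZX

end PaperGIT

namespace PaperGIT

section Weights

variable {k : Type} [Field k] {n m : ℕ}

/-- weights of the coordinates -/
def wS : Sg n m → (Fin n → ℤ) :=
  Sum.elim (fun p => Pi.single p.1 1) (Sum.elim (fun _ => fun _ => -1) (fun _ => 0))

noncomputable def wt (d : Sg n m →₀ ℕ) : Fin n → ℤ := ∑ s, d s • wS s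

open Classical in
noncomputable def wts (f : MvPolynomial (Sg n m) k) : Finset (Fin n → ℤ) := f.support.image wt

open Classical in
noncomputable def comp (f : MvPolynomial (Sg n m) k) (χ : Fin n → ℤ) : MvPolynomial (Sg n m) k :=
  ∑ d ∈ f.support with wt d = χ, MvPolynomial.monomial d (f.coeff d)

theorem comp_eq_zero {f : MvPolynomial (Sg n m) k} {χ} (h : χ ∉ wts f) : comp f χ = 0 := by
  classical
  rw [comp, Finset.sum_eq_zero]
  intro d hd
  rw [Finset.mem_filter] at hd
  exact absurd (Finset.mem_image.2 ⟨d, hd.1, hd.2⟩) h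

section
variable {K : Type} [Field K]

def tp (t : Fin n → Kˣ) (χ : Fin n → ℤ) : Kˣ := ∏ i, t i ^ χ i

theorem tp_zero (t : Fin n → Kˣ) : tp t 0 = 1 := by simp [tp]

theorem tp_add (t : Fin n → Kˣ) (χ ψ) : tp t (χ + ψ) = tp t χ * tp t ψ := by
  simp [tp, zpow_add, Finset.prod_mul_distrib]

theorem tp_nsmul (t : Fin n → Kˣ) (a : ℕ) (χ) : tp t (a • χ) = tp t χ ^ a := by
  induction a with
  | zero => simp [tp_zero]
  | succ a ih => rw [succ_nsmul, tp_add, ih, pow_succ]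

theorem tp_sum (t : Fin n → Kˣ) {ι : Type} (s : Finset ι) (χ : ι → Fin n → ℤ) : tp t (∑ i ∈ s, χ i) = ∏ i ∈ s, tp t (χ i) := by
  classical
  induction s using Finset.induction_on with
  | empty => simp [tp_zero]
  | insert a s ha ih => rw [Finset.sum_insert ha, Finset.prod_insert ha, tp_add, ih]

theorem tp_single (t : Fin n → Kˣ) (i) : tp t (Pi.single i 1) = t i := by
  classical
  rw [tp, Finset.prod_eq_single i]
  · simp
  · intro j _ hj; simp [Pi.single_eq_of_ne hj]
  · simp

/-- the diagonal matrix -/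
def dU (t : Fin n → Kˣ) : GL (Fin n) K where
  val := Matrix.diagonal fun i => (t i : K)
  inv := Matrix.diagonal fun i => ((t i)⁻¹ : Kˣ)
  val_inv := by simp [Matrix.diagonal_mul_diagonal]
  inv_val := by simp [Matrix.diagonal_mul_diagonal]

theorem dU_mul (t u : Fin n → Kˣ) : dU (t * u) = dU t * dU u := by
  apply Units.ext
  simp [dU, Matrix.diagonal_mul_diagonal]

theorem dU_one : dU (1 : Fin n → Kˣ) = 1 := by
  apply Units.ext
  simp [dU]

theorem ept_dU (t : Fin n → Kˣ) (h : GL (Fin n) K) (x : Fin m → K) (s) :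
    ept (dU t * h) x s = (tp t (wS s) : Kˣ) * ept h x s := by
  rcases s with ⟨i, j⟩ | ⟨⟨⟩ | i⟩
  · change (Matrix.diagonal (fun i => (t i : K)) * (h : Matrix (Fin n) (Fin n) K)) i j = (tp t (Pi.single i 1) : Kˣ) * _
    rw [tp_single, Matrix.diagonal_mul]
    rfl
  · change ((dU t * h)⁻¹ : GL (Fin n) K).val.det = (tp t (fun _ => -1) : Kˣ) * (h⁻¹ : GL (Fin n) K).val.det
    rw [mul_inv_rev, Units.val_mul, Matrix.det_mul, mul_comm]
    congr 1
    change (Matrix.diagonal fun i => (((t i)⁻¹ : Kˣ) : K)).det = _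
    rw [Matrix.det_diagonal, tp]
    simp
  · change x i = (tp t 0 : Kˣ) * x i
    rw [tp_zero]; simp

variable [Algebra k K]

theorem aeval_mono_scale (t : Fin n → Kˣ) (p p' : Sg n m → K) (hp : ∀ s, p' s = (tp t (wS s) : Kˣ) * p s) (d) (c : k) :
    MvPolynomial.aeval (R := k) p' (MvPolynomial.monomial d c) =
      (tp t (wt d) : Kˣ) * MvPolynomial.aeval (R := k) p (MvPolynomial.monomial d c) := by
  rw [MvPolynomial.aeval_monomial, MvPolynomial.aeval_monomial, Finsupp.prod_fintype _ _ (by simp), Finsupp.prod_fintype _ _ (by simp),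
    wt, tp_sum]
  simp only [hp, mul_pow, Finset.prod_mul_distrib, tp_nsmul, Units.coe_prod, Units.val_pow_eq_pow_val]
  ring

theorem aeval_comp_scale (t : Fin n → Kˣ) (p p' : Sg n m → K) (hp : ∀ s, p' s = (tp t (wS s) : Kˣ) * p s) (f : MvPolynomial (Sg n m) k) (χ) :
    MvPolynomial.aeval (R := k) p' (comp f χ) =
      (tp t χ : Kˣ) * MvPolynomial.aeval (R := k) p (comp f χ) := by
  classical
  rw [comp, map_sum, map_sum, Finset.mul_sum]
  refine Finset.sum_congr rfl fun d hd => ?_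
  rw [Finset.mem_filter] at hd
  rw [aeval_mono_scale t p p' hp, hd.2]

theorem sum_comp (f : MvPolynomial (Sg n m) k) : ∑ χ ∈ wts f, comp f χ = f := by
  classical
  simp only [comp]
  rw [Finset.sum_fiberwise_of_maps_to (g := wt)]
  · exact (MvPolynomial.as_sum f).symm
  · intro d hd; exact Finset.mem_image_of_mem _ hd

theorem aeval_scale (t : Fin n → Kˣ) (p p' : Sg n m → K) (hp : ∀ s, p' s = (tp t (wS s) : Kˣ) * p s) (f : MvPolynomial (Sg n m) k) :
    MvPolynomial.aeval (R := k) p' f =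
      ∑ χ ∈ wts f, (tp t χ : Kˣ) * MvPolynomial.aeval (R := k) p (comp f χ) := by
  conv_lhs => rw [← sum_comp f]
  rw [map_sum]
  exact Finset.sum_congr rfl fun χ _ => aeval_comp_scale t p p' hp f χ

end

theorem eval_dU (t : Fin n → kˣ) (h : GL (Fin n) k) (x : Fin m → k) (f : MvPolynomial (Sg n m) k) :
    MvPolynomial.eval (ept (dU t * h) x) f = ∑ χ ∈ wts f, (tp t χ : kˣ) * MvPolynomial.eval (ept h x) (comp f χ) := by
  have := aeval_scale t (ept h x) (ept (dU t * h) x) (ept_dU t h x) f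
  simpa only [MvPolynomial.aeval_eq_eval] using this

variable [CharZero k] 

theorem comp_eq_of (f : MvPolynomial (Sg n m) k) (h h' : GL (Fin n) k) (x x' : Fin m → k)
    (H : ∀ t : Fin n → kˣ, MvPolynomial.eval (ept (dU t * h) x) f = MvPolynomial.eval (ept (dU t * h') x') f) (χ) :
    MvPolynomial.eval (ept h x) (comp f χ) = MvPolynomial.eval (ept h' x') (comp f χ) := by
  by_cases hχ : χ ∈ wts f
  · rw [← sub_eq_zero]
    refine char_indep (wts f) (fun χ => MvPolynomial.eval (ept h x) (comp f χ) - MvPolynomial.eval (ept h' x') (comp f χ)) ?_ χ hχ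
    intro t
    have := H t
    rw [eval_dU, eval_dU, ← sub_eq_zero, ← Finset.sum_sub_distrib] at this
    rw [← this]
    refine Finset.sum_congr rfl fun χ _ => ?_
    rw [mul_sub]; rfl
  · rw [comp_eq_zero hχ, map_zero, map_zero]

theorem comp_zero_of (f : MvPolynomial (Sg n m) k) (x : Fin m → k) 
    (H : ∀ h, MvPolynomial.eval (ept h x) f = 0) (χ h) :
    MvPolynomial.eval (ept h x) (comp f χ) = 0 := by
  by_cases hχ : χ ∈ wts f
  · refine char_indep (wts f) (fun χ => MvPolynomial.eval (ept h x) (comp f χ)) ?_ χ hχ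
    intro t
    have := H (dU t * h)
    rw [eval_dU] at this
    exact this
  · rw [comp_eq_zero hχ, map_zero]

/-- invariant polynomials -/
def PInv {G : AlgGroup k} (X : GVariety G m) (f : MvPolynomial (Sg G.n m) k) : Prop :=
  ∀ g ∈ G.toSubgroup, ∀ h, ∀ x ∈ X.carrier, MvPolynomial.eval (ept (h * g) x) f = MvPolynomial.eval (ept h (X.act g x)) f

theorem PInv.comp {G : AlgGroup k} {X : GVariety G m} {f : MvPolynomial (Sg G.n m) k} (hf : PInv X f) (χ) : PInv X (comp f χ) := by
  intro g hg h x hx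
  apply comp_eq_of
  intro t
  rw [← mul_assoc]
  exact hf g hg _ x hx

theorem PInv.zInv {G : AlgGroup k} {X : GVariety G m} {f : MvPolynomial (Sg G.n m) k} (hf : PInv X f) :
    ZInv X (fun z => MvPolynomial.eval (ept z.1 z.2.1) f) := by
  refine ⟨eval_mem_reg (fun z : ZT X => ept z.1 z.2.1) f, fun g z => ?_⟩
  change MvPolynomial.eval (ept (z.1 * g.1) (X.act g.1⁻¹ z.2.1)) f = _
  rw [hf g.1 g.2 z.1 _ (X.act_mem _ (G.toSubgroup.inv_mem g.2) _ z.2.2)]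
  rw [← X.act_mul _ g.2 _ (G.toSubgroup.inv_mem g.2) _ z.2.2, mul_inv_cancel, X.act_one _ z.2.2]

theorem ZInv.exists {G : AlgGroup k} {X : GVariety G m} {F : ZT X → k} (hF : ZInv X F) :
    ∃ f, PInv X f ∧ ∀ z : ZT X, F z = MvPolynomial.eval (ept z.1 z.2.1) f := by
  obtain ⟨f, hf⟩ := mem_reg.1 hF.1
  refine ⟨f, fun g hg h x hx => ?_, hf⟩
  have h1 := hF.2 ⟨g, hg⟩ (h, ⟨X.act g x, X.act_mem _ hg _ hx⟩)
  rw [hf, hf] at h1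
  change MvPolynomial.eval (ept (h * g) (X.act g⁻¹ (X.act g x))) f = _ at h1
  rwa [← X.act_mul _ (G.toSubgroup.inv_mem hg) _ hg _ hx, inv_mul_cancel, X.act_one _ hx] at h1

end Weights

end PaperGIT

namespace PaperGIT

section RStep

variable {k : Type} [Field k] {G : AlgGroup k} {m : ℕ}

theorem val_gen {A B : Type} [CommRing A] [CommRing B] [Algebra k A] [Algebra k B] (μ : A →ₐ[k] B) (my : Ideal A) [hmy : my.IsPrime]
    (hle : ∀ f, μ f = 0 → f ∈ my) : ∃ (K : Type) (_ : Field K) (_ : Algebra k K) (ρ : B →ₐ[k] K) (R : ValuationSubring K),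
      (∀ f, ρ (μ f) ∈ R) ∧ ∀ f ∈ my, ρ (μ f) ∈ R.nonunits := by
  have hle : (⊥ : Ideal B).comap μ.toRingHom ≤ my := fun f hf => hle f hf
  obtain ⟨p, hp, hpm⟩ := Ideal.exists_minimalPrimes_le hle
  obtain ⟨Q, hQ, -, hQp⟩ := Ideal.exists_comap_eq_of_mem_minimalPrimes μ.toRingHom p hp
  let K := FractionRing (B ⧸ Q)
  let ρ : B →ₐ[k] K := (IsScalarTower.toAlgHom k (B ⧸ Q) K).comp (Ideal.Quotient.mkₐ k Q)
  have hρ : ∀ a, ρ a = 0 ↔ a ∈ Q := by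
    intro a
    change algebraMap (B ⧸ Q) K (Ideal.Quotient.mk Q a) = 0 ↔ _
    rw [map_eq_zero_iff _ (IsFractionRing.injective (B ⧸ Q) K), Ideal.Quotient.eq_zero_iff_mem]
  let ψ : A →+* K := ρ.toRingHom.comp μ.toRingHom
  have hψ : ∀ f, ψ f = 0 → f ∈ my := by
    intro f hf
    apply hpm
    rw [← hQp]
    exact (hρ _).1 hf
  let I : Ideal ψ.range := my.map ψ.rangeRestrict
  have hI : I ≠ ⊤ := by
    intro h
    have h1 : (1 : ψ.range) ∈ I := by rw [h]; trivial
    obtain ⟨f, hf, hf1⟩ := (Ideal.mem_map_iff_of_surjective _ ψ.rangeRestrict_surjective).1 h1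
    have h2 : ψ f = 1 := congrArg Subtype.val hf1
    have h3 : f - 1 ∈ my := hψ _ (by rw [map_sub, h2, map_one, sub_self])
    exact hmy.ne_top ((Ideal.eq_top_iff_one _).2 (by simpa using my.sub_mem hf h3))
  obtain ⟨R, hR1, hR2⟩ := Ideal.image_subset_nonunits_valuationSubring I hI
  exact ⟨K, inferInstance, inferInstance, ρ, R, fun f => hR1 ⟨f, rfl⟩, fun f hf =>
    hR2 ⟨⟨ψ f, ⟨f, rfl⟩⟩, Ideal.mem_map_of_mem ψ.rangeRestrict hf, rfl⟩⟩

theorem exists_val (X : GVariety G m) (x y : Fin m → k)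
    (hy : ∀ f : MvPolynomial (Fin m) k, (∀ g ∈ G.toSubgroup, MvPolynomial.eval (X.act g x) f = 0) → MvPolynomial.eval y f = 0)
    (q : Fin m → MvPolynomial (Sg G.n m) k)
    (hq : ∀ g ∈ G.toSubgroup, ∀ i, X.act g x i = MvPolynomial.eval (ept g x) (q i)) :
    ∃ (K : Type) (_ : Field K) (_ : Algebra k K) (R : ValuationSubring K) (g : GL (Fin G.n) K),
      (∀ c : k, algebraMap k K c ∈ R) ∧
      (∀ Φ : MvPolynomial ((Fin G.n × Fin G.n) ⊕ Unit) k, (∀ g ∈ G.toSubgroup, MvPolynomial.eval (gpt g) Φ = 0) →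
        MvPolynomial.aeval (R := k) (gpt g) Φ = 0) ∧
      ∀ i, MvPolynomial.aeval (R := k) (ept g (fun i => algebraMap k K (x i))) (q i) - algebraMap k K (y i) ∈ R.nonunits := by
  have hco : ∀ i, (fun g : Pt G => X.act g.1 x i) ∈ gO G := by
    intro i
    have : (fun g : Pt G => X.act g.1 x i) = fun g => MvPolynomial.eval (ept g.1 x) (q i) := by
      funext g; exact hq g.1 g.2 i
    rw [this]
    exact reg_le (ept_mem (fun s => coord_mem_reg (fun g : Pt G => gpt g.1) s) (fun i => (gO G).algebraMap_mem (x i)))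
      (eval_mem_reg (fun g : Pt G => ept g.1 x) (q i))
  let μ : MvPolynomial (Fin m) k →ₐ[k] gO G := MvPolynomial.aeval (R := k) (fun i => ⟨_, hco i⟩)
  have hμ : ∀ f g, (μ f).1 g = MvPolynomial.eval (X.act g.1 x) f := by
    intro f g
    have h2 := MvPolynomial.comp_aeval_apply (R := k) (fun i => (⟨_, hco i⟩ : gO G)) ((Pi.evalAlgHom k (fun _ : Pt G => k) g).comp (gO G).val) f
    rw [MvPolynomial.aeval_eq_eval] at h2
    exact h2
  let my : Ideal (MvPolynomial (Fin m) k) := RingHom.ker (MvPolynomial.eval y)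
  have hmy : my.IsPrime := RingHom.ker_isPrime _
  have hle : (⊥ : Ideal (gO G)).comap μ ≤ my := by
    intro f hf
    apply hy
    intro g hg
    rw [Ideal.mem_comap, Ideal.mem_bot] at hf
    rw [← hμ f ⟨g, hg⟩, hf]
    rfl
  obtain ⟨K, iK, iA, ρ, R, hR1, hR2⟩ := val_gen μ my (fun f hf => hle hf)
  let ψ : MvPolynomial (Fin m) k →ₐ[k] K := ρ.comp μ
  have hcg : ∀ s, (fun g : Pt G => gpt g.1 s) ∈ gO G := fun s => coord_mem_reg (fun g : Pt G => gpt g.1) s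
  have hρP : ∀ Φ : MvPolynomial ((Fin G.n × Fin G.n) ⊕ Unit) k, MvPolynomial.aeval (R := k) (fun s => ρ ⟨_, hcg s⟩) Φ =
      ρ ⟨_, eval_mem_reg (fun g : Pt G => gpt g.1) Φ⟩ := by
    intro Φ
    rw [← MvPolynomial.comp_aeval_apply]
    congr 1
    apply Subtype.ext
    funext g
    have h2 := MvPolynomial.comp_aeval_apply (R := k) (fun s => (⟨_, hcg s⟩ : gO G)) ((Pi.evalAlgHom k (fun _ : Pt G => k) g).comp (gO G).val) Φ
    rw [MvPolynomial.aeval_eq_eval] at h2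
    exact h2
  have hρ0 : ∀ Φ : MvPolynomial ((Fin G.n × Fin G.n) ⊕ Unit) k, (∀ g ∈ G.toSubgroup, MvPolynomial.eval (gpt g) Φ = 0) →
        MvPolynomial.aeval (R := k) (fun s => ρ ⟨_, hcg s⟩) Φ = 0 := by
    intro Φ h
    rw [hρP]
    have : (⟨_, eval_mem_reg (fun g : Pt G => gpt g.1) Φ⟩ : gO G) = 0 := by
      apply Subtype.ext; funext g; exact h g.1 g.2
    rw [this, map_zero]
  obtain ⟨gK, hgK⟩ := exists_gpt (n := G.n) (fun s => ρ ⟨_, hcg s⟩) (by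
    let M : Matrix (Fin G.n) (Fin G.n) (MvPolynomial ((Fin G.n × Fin G.n) ⊕ Unit) k) := Matrix.of fun i j => MvPolynomial.X (Sum.inl (i, j))
    have h1 := hρ0 (M.det * MvPolynomial.X (Sum.inr ()) - 1) (by
      intro g hg
      rw [map_sub, map_mul, MvPolynomial.eval_X, RingHom.map_det, map_one, sub_eq_zero]
      have h3 : (MvPolynomial.eval (gpt g)).mapMatrix M = (g : Matrix (Fin G.n) (Fin G.n) k) := by
        ext i j
        simp only [RingHom.mapMatrix_apply, Matrix.map_apply, M, Matrix.of_apply, MvPolynomial.eval_X]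
        rfl
      rw [h3]; exact det_mul_inv g)
    rw [map_sub, map_mul, MvPolynomial.aeval_X, AlgHom.map_det, map_one, sub_eq_zero] at h1
    convert h1 using 3
    ext i j
    simp only [AlgHom.mapMatrix_apply, Matrix.map_apply, M, Matrix.of_apply, MvPolynomial.aeval_X])
  refine ⟨K, iK, iA, R, gK, ?_, ?_, ?_⟩
  · intro c
    have := hR1 (MvPolynomial.C c)
    rwa [show ρ (μ (MvPolynomial.C c)) = algebraMap k K c from ψ.commutes c] at this
  · intro Φ h
    rw [hgK]; exact hρ0 Φ h
  · intro i
    have h1 : MvPolynomial.aeval (R := k) (ept gK (fun i => algebraMap k K (x i))) (q i) = ψ (MvPolynomial.X i) := by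
      change _ = ρ (μ (MvPolynomial.X i))
      have h2 : ept gK (fun i => algebraMap k K (x i)) = fun s => ρ ⟨_, ept_mem hcg (fun i => (gO G).algebraMap_mem (x i)) s⟩ := by
        funext s
        rcases s with a | ⟨⟨⟩ | i⟩
        · exact congrFun hgK (Sum.inl a)
        · exact congrFun hgK (Sum.inr ())
        · exact (ρ.commutes (x i)).symm
      rw [h2, ← MvPolynomial.comp_aeval_apply]
      congr 1
      apply Subtype.ext
      funext g
      rw [hμ, MvPolynomial.eval_X, hq g.1 g.2]
      have h2 := MvPolynomial.comp_aeval_apply (R := k) (fun s => (⟨_, ept_mem hcg (fun i => (gO G).algebraMap_mem (x i)) s⟩ : gO G)) ((Pi.evalAlgHom k (fun _ : Pt G => k) g).comp (gO G).val) (q i)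
      rw [MvPolynomial.aeval_eq_eval] at h2
      exact h2
    rw [h1]
    have h3 := hR2 (MvPolynomial.X i - MvPolynomial.C (y i)) (by
        change MvPolynomial.eval y _ = 0
        simp)
    rw [map_sub, map_sub, show ρ (μ (MvPolynomial.C (y i))) = algebraMap k K (y i) from ψ.commutes (y i)] at h3
    exact h3

end RStep

end PaperGIT

namespace PaperGIT

section Transport

variable {k : Type} [Field k] {n m : ℕ} {K : Type} [Field K] [Algebra k K]

abbrev Tau (n : ℕ) : Type := (Fin n × Fin n) ⊕ Unit

/-- substitute a group variable and a constant vector -/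
noncomputable def sub0 {ρ : Type} (e : Tau n → ρ) (x : Fin m → k) : Sg n m → MvPolynomial ρ k :=
  Sum.elim (fun p => MvPolynomial.X (e (Sum.inl p))) (Sum.elim (fun _ => MvPolynomial.X (e (Sum.inr ()))) (fun i => MvPolynomial.C (x i)))

theorem aeval_sub0 {ρ : Type} (e : Tau n → ρ) (x : Fin m → k) (P : ρ → K) (h : GL (Fin n) K) (hP : ∀ s, P (e s) = gpt h s) (f : MvPolynomial (Sg n m) k) :
    MvPolynomial.aeval (R := k) P (MvPolynomial.bind₁ (sub0 e x) f) =
      MvPolynomial.aeval (R := k) (ept h (fun i => algebraMap k K (x i))) f := by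
  rw [MvPolynomial.aeval_bind₁]
  congr 2
  funext s
  rcases s with a | ⟨⟨⟩ | i⟩
  · simp only [sub0, Sum.elim_inl, MvPolynomial.aeval_X, hP]; rfl
  · simp only [sub0, Sum.elim_inl, Sum.elim_inr, MvPolynomial.aeval_X, hP]; rfl
  · simp only [sub0, Sum.elim_inr, MvPolynomial.algHom_C]; rfl

noncomputable def sub1 (x : Fin m → k) : Sg n m → MvPolynomial (Tau n ⊕ Tau n) k :=
  Sum.elim (fun p => ∑ l, MvPolynomial.X (Sum.inl (Sum.inl (p.1, l))) * MvPolynomial.X (Sum.inr (Sum.inl (l, p.2))))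
    (Sum.elim (fun _ => MvPolynomial.X (Sum.inl (Sum.inr ())) * MvPolynomial.X (Sum.inr (Sum.inr ()))) (fun i => MvPolynomial.C (x i)))

theorem aeval_sub1 (x : Fin m → k) (h g : GL (Fin n) K) (f : MvPolynomial (Sg n m) k) :
    MvPolynomial.aeval (R := k) (Sum.elim (gpt h) (gpt g)) (MvPolynomial.bind₁ (sub1 x) f) =
      MvPolynomial.aeval (R := k) (ept (h * g) (fun i => algebraMap k K (x i))) f := by
  rw [MvPolynomial.aeval_bind₁]
  congr 2
  funext s
  rcases s with ⟨i, j⟩ | ⟨⟨⟩ | i⟩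
  · simp only [sub1, Sum.elim_inl, map_sum, map_mul, MvPolynomial.aeval_X, Sum.elim_inr]
    change _ = ((h : Matrix (Fin n) (Fin n) K) * (g : Matrix (Fin n) (Fin n) K)) i j
    rw [Matrix.mul_apply]; rfl
  · simp only [sub1, Sum.elim_inl, Sum.elim_inr, map_mul, MvPolynomial.aeval_X]
    change (h⁻¹ : GL (Fin n) K).val.det * (g⁻¹ : GL (Fin n) K).val.det = ((h * g)⁻¹ : GL (Fin n) K).val.det
    rw [mul_inv_rev, Units.val_mul, Matrix.det_mul, mul_comm]
  · simp only [sub1, Sum.elim_inr, MvPolynomial.algHom_C]; rfl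

noncomputable def sub2 (x : Fin m → k) (q : Fin m → MvPolynomial (Sg n m) k) : Sg n m → MvPolynomial (Tau n ⊕ Tau n) k :=
  Sum.elim (fun p => MvPolynomial.X (Sum.inl (Sum.inl p)))
    (Sum.elim (fun _ => MvPolynomial.X (Sum.inl (Sum.inr ()))) (fun i => MvPolynomial.bind₁ (sub0 Sum.inr x) (q i)))

theorem aeval_sub2 (x : Fin m → k) (q : Fin m → MvPolynomial (Sg n m) k) (h g : GL (Fin n) K) (f : MvPolynomial (Sg n m) k) :
    MvPolynomial.aeval (R := k) (Sum.elim (gpt h) (gpt g)) (MvPolynomial.bind₁ (sub2 x q) f) =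
      MvPolynomial.aeval (R := k) (ept h (fun i => MvPolynomial.aeval (R := k) (ept g (fun i => algebraMap k K (x i))) (q i))) f := by
  rw [MvPolynomial.aeval_bind₁]
  congr 2
  funext s
  rcases s with ⟨i, j⟩ | ⟨⟨⟩ | i⟩
  · simp only [sub2, Sum.elim_inl, MvPolynomial.aeval_X]; rfl
  · simp only [sub2, Sum.elim_inl, Sum.elim_inr, MvPolynomial.aeval_X]; rfl
  · simp only [sub2, Sum.elim_inr]
    exact aeval_sub0 Sum.inr x _ g (fun _ => rfl) (q i)

noncomputable def detP (n : ℕ) (k : Type) [Field k] : MvPolynomial (Tau n) k :=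
  (Matrix.of fun i j => MvPolynomial.X (Sum.inl (i, j)) : Matrix (Fin n) (Fin n) (MvPolynomial (Tau n) k)).det * MvPolynomial.X (Sum.inr ()) - 1

theorem aeval_detP (p : Tau n → K) : MvPolynomial.aeval (R := k) p (detP n k) = (Matrix.of fun i j => p (Sum.inl (i, j))).det * p (Sum.inr ()) - 1 := by
  rw [detP, map_sub, map_mul, MvPolynomial.aeval_X, AlgHom.map_det, map_one]
  congr 3
  ext i j
  simp only [AlgHom.mapMatrix_apply, Matrix.map_apply, Matrix.of_apply, MvPolynomial.aeval_X]

theorem aeval_detP_gpt (h : GL (Fin n) K) : MvPolynomial.aeval (R := k) (gpt h) (detP n k) = 0 := by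
  rw [aeval_detP, sub_eq_zero]
  exact det_mul_inv h

theorem exists_gpt' (p : Tau n → k) (hp : MvPolynomial.eval p (detP n k) = 0) : ∃ g : GL (Fin n) k, gpt g = p := by
  apply exists_gpt
  rw [← MvPolynomial.aeval_eq_eval, aeval_detP, sub_eq_zero] at hp
  exact hp

variable [IsAlgClosed k]

theorem gl_transport (y : Fin m → k) (f : MvPolynomial (Sg n m) k) (hf : ∀ h : GL (Fin n) k, MvPolynomial.eval (ept h y) f = 0) (h : GL (Fin n) K) :
    MvPolynomial.aeval (R := k) (ept h (fun i => algebraMap k K (y i))) f = 0 := by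
  rw [← aeval_sub0 id y (gpt h) h (fun _ => rfl)]
  refine ns_transport {detP n k} _ (fun p hp => ?_) (gpt h) ?_
  · obtain ⟨g, rfl⟩ := exists_gpt' p (hp _ rfl)
    have := aeval_sub0 id y (gpt g) g (fun _ => rfl) f
    rw [MvPolynomial.aeval_eq_eval, MvPolynomial.aeval_eq_eval] at this
    rw [this]; exact hf g
  · rintro _ rfl
    exact aeval_detP_gpt h

variable {G : AlgGroup k}

theorem mem_of_van (p : Tau G.n → k)
    (hp : ∀ Φ : MvPolynomial (Tau G.n) k, (∀ g ∈ G.toSubgroup, MvPolynomial.eval (gpt g) Φ = 0) → MvPolynomial.eval p Φ = 0) :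
    ∃ g ∈ G.toSubgroup, gpt g = p := by
  obtain ⟨g, rfl⟩ := exists_gpt' p (hp _ fun g _ => by
    rw [← MvPolynomial.aeval_eq_eval]; exact aeval_detP_gpt g)
  refine ⟨g, ?_, rfl⟩
  obtain ⟨I, hI⟩ := G.closed
  rw [hI]
  intro f hf
  have h1 : ∀ g : GL (Fin G.n) k, MvPolynomial.eval (gpt g) (MvPolynomial.rename Sum.inl f) = MvPolynomial.eval (mat2pt (g : Matrix (Fin G.n) (Fin G.n) k)) f := by
    intro g
    rw [MvPolynomial.eval_rename]; rfl
  rw [← h1]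
  apply hp
  intro g' hg'
  rw [h1]
  exact (hI g').1 hg' f hf

theorem pinv_transport {X : GVariety G m} {f : MvPolynomial (Sg G.n m) k} (hf : PInv X f) (x : Fin m → k) (hx : x ∈ X.carrier)
    (q : Fin m → MvPolynomial (Sg G.n m) k)
    (hq : ∀ g ∈ G.toSubgroup, ∀ i, X.act g x i = MvPolynomial.eval (ept g x) (q i))
    (g : GL (Fin G.n) K) (hg : ∀ Φ : MvPolynomial (Tau G.n) k, (∀ g ∈ G.toSubgroup, MvPolynomial.eval (gpt g) Φ = 0) →
        MvPolynomial.aeval (R := k) (gpt g) Φ = 0) (h : GL (Fin G.n) K) :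
    MvPolynomial.aeval (R := k) (ept (h * g) (fun i => algebraMap k K (x i))) f =
      MvPolynomial.aeval (R := k) (ept h (fun i => MvPolynomial.aeval (R := k) (ept g (fun i => algebraMap k K (x i))) (q i))) f := by
  rw [← aeval_sub1, ← aeval_sub2, ← sub_eq_zero, ← map_sub]
  refine ns_transport ({MvPolynomial.rename Sum.inl (detP G.n k)} ∪
    {Ψ | ∃ Φ : MvPolynomial (Tau G.n) k, (∀ g ∈ G.toSubgroup, MvPolynomial.eval (gpt g) Φ = 0) ∧ Ψ = MvPolynomial.rename Sum.inr Φ}) _ (fun p hp => ?_) _ ?_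
  · obtain ⟨h0, hh0⟩ := exists_gpt' (fun s => p (Sum.inl s)) (by
      have := hp _ (Or.inl rfl)
      rwa [MvPolynomial.eval_rename] at this)
    obtain ⟨g0, hg0, hg0'⟩ := mem_of_van (G := G) (fun s => p (Sum.inr s)) (by
      intro Φ hΦ
      have := hp _ (Or.inr ⟨Φ, hΦ, rfl⟩)
      rwa [MvPolynomial.eval_rename] at this)
    have hpe : p = Sum.elim (gpt h0) (gpt g0) := by
      rw [hh0, hg0']; funext s; rcases s with s | s <;> rfl
    have e1 := aeval_sub1 (K := k) x h0 g0 f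
    have e2 := aeval_sub2 (K := k) x q h0 g0 f
    rw [MvPolynomial.aeval_eq_eval, MvPolynomial.aeval_eq_eval] at e1 e2
    rw [hpe, map_sub, sub_eq_zero]
    refine e1.trans (Eq.trans ?_ e2.symm)
    refine (hf g0 hg0 h0 x hx).trans ?_
    congr 2
    congr 1
    funext i
    rw [hq g0 hg0 i, MvPolynomial.aeval_eq_eval]
    rfl
  · rintro _ (rfl | ⟨Φ, hΦ, rfl⟩)
    · rw [MvPolynomial.aeval_rename]; exact aeval_detP_gpt h
    · rw [MvPolynomial.aeval_rename]; exact hg Φ hΦ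

end Transport

end PaperGIT

namespace PaperGIT

section Red

variable {k : Type} [Field k] {n m : ℕ} {K : Type} [Field K] [Algebra k K]

theorem res_gen (R : ValuationSubring K) (hk : ∀ c : k, algebraMap k K c ∈ R) :
    ∃ (κ : Type) (_ : Field κ) (_ : Algebra k κ) (π : R →+* κ), (∀ r, π r = 0 ↔ R.valuation (r : K) < 1) ∧
      (∀ c, π ⟨algebraMap k K c, hk c⟩ = algebraMap k κ c) ∧
      ∀ (σ : Type) (r : σ → R) (f : MvPolynomial σ k), ∃ E : R, (E : K) = MvPolynomial.aeval (R := k) (fun s => (r s : K)) f ∧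
        π E = MvPolynomial.aeval (R := k) (fun s => π (r s)) f := by
  let ι : k →+* R := (algebraMap k K).codRestrict R.toSubring hk
  let π := IsLocalRing.residue R
  let iA : Algebra k (IsLocalRing.ResidueField R) := (π.comp ι).toAlgebra
  refine ⟨IsLocalRing.ResidueField R, inferInstance, iA, π, ?_, fun c => rfl, ?_⟩
  · intro r
    rw [IsLocalRing.residue_eq_zero_iff, ValuationSubring.valuation_lt_one_iff]
  · intro σ r f
    refine ⟨MvPolynomial.eval₂ ι r f, ?_, ?_⟩
    · exact MvPolynomial.eval₂_comp_left R.subtype ι r f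
    · exact MvPolynomial.eval₂_comp_left π ι r f

theorem ptR {A : Type} [CommRing A] (b : GL (Fin n) A) (v : Fin m → A) :
    ∃ r : Sg n m → A, ∀ (L : Type) [Field L] (φ : A →+* L),
      (fun s => φ (r s)) = ept (Units.map φ.mapMatrix.toMonoidHom b) (fun i => φ (v i)) := by
  refine ⟨Sum.elim (fun p => b.val p.1 p.2) (Sum.elim (fun _ => (b⁻¹).val.det) v), fun L _ φ => ?_⟩
  funext s
  rcases s with ⟨i, j⟩ | ⟨⟨⟩ | i⟩
  · rfl
  · change φ ((b⁻¹).val.det) = ((Units.map φ.mapMatrix.toMonoidHom b)⁻¹).val.det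
    rw [RingHom.map_det, ← map_inv]
    rfl
  · rfl

theorem IsRU.lift {R : ValuationSubring K} {a : Matrix (Fin n) (Fin n) K} (h : IsRU R.toSubring a) :
    ∃ b : GL (Fin n) R, (Units.map R.subtype.mapMatrix.toMonoidHom b).val = a := by
  obtain ⟨h1, a', h2, h3⟩ := h
  have h4 : a' * a = 1 := mul_eq_one_comm.1 h3
  refine ⟨⟨Matrix.of fun i j => ⟨a i j, h1 i j⟩, Matrix.of fun i j => ⟨a' i j, h2 i j⟩, ?_, ?_⟩, rfl⟩
  · apply Matrix.map_injective (f := R.subtype) R.subtype_injective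
    change R.subtype.mapMatrix _ = R.subtype.mapMatrix 1
    rw [map_one, ← h3, map_mul]
    rfl
  · apply Matrix.map_injective (f := R.subtype) R.subtype_injective
    change R.subtype.mapMatrix _ = R.subtype.mapMatrix 1
    rw [map_one, ← h4, map_mul]
    rfl

variable [IsAlgClosed k] [CharZero k]

theorem rstep {G : AlgGroup k} (X : GVariety G m) (x : Fin m → k) (hx : x ∈ X.carrier) (y : Fin m → k)
    (hy : ∀ f : MvPolynomial (Fin m) k, (∀ g ∈ G.toSubgroup, MvPolynomial.eval (X.act g x) f = 0) → MvPolynomial.eval y f = 0) :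
    ∃ (Γ : Type) (_ : AddCommGroup Γ) (_ : LinearOrder Γ) (_ : IsOrderedAddMonoid Γ) (ν : (Fin G.n → ℤ) →+ Γ) (b : GL (Fin G.n) k),
      (∀ f, PInv X f → ∀ χ, ν χ < 0 → MvPolynomial.eval (ept b x) (comp f χ) = 0) ∧
      (∀ f, PInv X f → (∀ h, MvPolynomial.eval (ept h y) f = 0) → ∀ χ, ν χ = 0 → MvPolynomial.eval (ept b x) (comp f χ) = 0) := by
  obtain ⟨q, hq⟩ := X.regular
  obtain ⟨K, iK, iA, R, g, hk, hgV, hgy⟩ := exists_val X x y hy q (fun g hg i => hq g hg x hx i)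
  obtain ⟨κ, iκ, iκA, π, hπ0, hπk, hπ⟩ := res_gen R hk
  obtain ⟨a, b, d, ha, hb, hab⟩ := smith R G.n g.val
  obtain ⟨aR, haR⟩ := ha.lift
  obtain ⟨bR, hbR⟩ := hb.lift
  set aK := Units.map R.subtype.mapMatrix.toMonoidHom aR with haK
  set bK := Units.map R.subtype.mapMatrix.toMonoidHom bR with hbK
  have hd : ∀ i, d i ≠ 0 := by
    intro i hi
    have h1 : IsUnit g.val.det := (Matrix.isUnit_iff_isUnit_det _).1 g.isUnit
    rw [hab, Matrix.det_mul, Matrix.det_mul, Matrix.det_diagonal, Finset.prod_eq_zero (Finset.mem_univ i) hi] at h1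
    simp at h1
  let dK : Fin G.n → Kˣ := fun i => Units.mk0 (d i) (hd i)
  have hgK : aK⁻¹ * g = dU dK * bK := by
    rw [inv_mul_eq_iff_eq_mul]
    apply Units.ext
    rw [Units.val_mul, Units.val_mul, haR, hbR, hab, mul_assoc]
    rfl
  let ν : (Fin G.n → ℤ) →+ Additive (R.ValueGroupˣ) :=
    { toFun := fun χ => -Additive.ofMul (Units.map (R.valuation : K →* R.ValueGroup) (tp dK χ))
      map_zero' := by rw [tp_zero, map_one]; simp
      map_add' := by intro χ ψ; rw [tp_add, map_mul, ofMul_mul, neg_add] }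
  have hν : ∀ χ, ν χ < 0 ↔ 1 < R.valuation (tp dK χ : Kˣ).val := by
    intro χ
    change -Additive.ofMul _ < 0 ↔ _
    rw [neg_lt_zero]
    rfl
  have hν0 : ∀ χ, ν χ = 0 ↔ R.valuation (tp dK χ : Kˣ).val = 1 := by
    intro χ
    change -Additive.ofMul _ = 0 ↔ _
    rw [neg_eq_zero, ofMul_eq_zero, Units.ext_iff]
    rfl
  -- the vectors
  let xR : Fin m → R := fun i => ⟨_, hk (x i)⟩
  have hyR : ∀ i, MvPolynomial.aeval (R := k) (ept g (fun i => algebraMap k K (x i))) (q i) ∈ R := by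
    intro i
    have h1 := R.add_mem _ _ (R.nonunits_le (hgy i)) (hk (y i))
    rwa [sub_add_cancel] at h1
  let yR : Fin m → R := fun i => ⟨_, hyR i⟩
  have hyπ : ∀ i, π (yR i) = algebraMap k κ (y i) := by
    intro i
    rw [← hπk, ← sub_eq_zero, ← map_sub, hπ0]
    exact (ValuationSubring.mem_nonunits_iff R).1 (hgy i)
  obtain ⟨rb, hrb⟩ := ptR bR xR
  obtain ⟨ra, hra⟩ := ptR aR⁻¹ yR
  have key : ∀ f, PInv X f → ∀ χ, ν χ < 0 ∨ (ν χ = 0 ∧ ∀ h, MvPolynomial.eval (ept h y) f = 0) →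
      MvPolynomial.aeval (R := k) (ept (Units.map π.mapMatrix.toMonoidHom bR) (fun i => algebraMap k κ (x i))) (comp f χ) = 0 := by
    intro f hf χ hχ
    obtain ⟨Eb, hEb1, hEb2⟩ := hπ _ rb (comp f χ)
    obtain ⟨Ea, hEa1, hEa2⟩ := hπ _ ra (comp f χ)
    have e1 := hrb K R.subtype
    have e2 := hra K R.subtype
    have e3 := hrb κ π
    have e4 := hra κ π
    change (fun s => (rb s : K)) = _ at e1
    change (fun s => (ra s : K)) = _ at e2
    rw [e1] at hEb1
    rw [e2, map_inv] at hEa1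
    rw [e3] at hEb2
    rw [e4] at hEa2
    have h1 := pinv_transport (hf.comp χ) x hx q (fun g hg i => hq g hg x hx i) g hgV aK⁻¹
    rw [hgK, aeval_comp_scale dK _ _ (ept_dU dK bK _)] at h1
    have h2 : (tp dK χ : Kˣ).val * (Eb : K) = Ea := by
      rw [hEb1, hEa1]; exact h1
    have h3 : R.valuation (tp dK χ : Kˣ).val * R.valuation (Eb : K) = R.valuation (Ea : K) := by
      rw [← map_mul, h2]
    have h4 : R.valuation (Eb : K) < 1 := by
      rcases hχ with hχ | ⟨hχ, hχ'⟩
      · rw [hν] at hχ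
        by_contra hc
        push Not at hc
        have := R.valuation_le_one Ea
        rw [← h3] at this
        exact absurd (lt_of_lt_of_le hχ (le_mul_of_one_le_right' hc)) (not_lt.2 this)
      · rw [hν0] at hχ
        rw [hχ, one_mul] at h3
        rw [h3, ← hπ0, hEa2]
        have : (fun i => π (yR i)) = fun i => algebraMap k κ (y i) := funext hyπ
        rw [this]
        exact gl_transport y _ (fun h => comp_zero_of f y hχ' χ h) _
    rw [← hπ0, hEb2] at h4
    have : (fun i => π (xR i)) = fun i => algebraMap k κ (x i) := funext fun i => hπk (x i)
    rwa [this] at h4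
  obtain ⟨p, hp⟩ := ns_exists ({detP G.n k} ∪ {Ψ | ∃ f χ, PInv X f ∧ (ν χ < 0 ∨ (ν χ = 0 ∧ ∀ h, MvPolynomial.eval (ept h y) f = 0)) ∧
    Ψ = MvPolynomial.bind₁ (sub0 id x) (comp f χ)}) (gpt (Units.map π.mapMatrix.toMonoidHom bR)) (by
      rintro _ (rfl | ⟨f, χ, hf, hχ, rfl⟩)
      · exact aeval_detP_gpt _
      · rw [aeval_sub0 id x _ _ (fun _ => rfl)]
        exact key f hf χ hχ)
  obtain ⟨b0, rfl⟩ := exists_gpt' p (hp _ (Or.inl rfl))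
  have fin : ∀ f, PInv X f → ∀ χ, ν χ < 0 ∨ (ν χ = 0 ∧ ∀ h, MvPolynomial.eval (ept h y) f = 0) →
      MvPolynomial.eval (ept b0 x) (comp f χ) = 0 := by
    intro f hf χ hχ
    have h1 := hp _ (Or.inr ⟨f, χ, hf, hχ, rfl⟩)
    have h2 := aeval_sub0 (K := k) id x (gpt b0) b0 (fun _ => rfl) (comp f χ)
    rw [MvPolynomial.aeval_eq_eval, MvPolynomial.aeval_eq_eval] at h2
    exact h2.symm.trans h1
  exact ⟨_, inferInstance, inferInstance, inferInstance, ν, b0, fun f hf χ hχ => fin f hf χ (Or.inl hχ),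
    fun f hf h χ hχ => fin f hf χ (Or.inr ⟨hχ, h⟩)⟩

end Red

end PaperGIT

namespace PaperGIT

section HasLim

variable {k : Type} [Field k]

/-- `u` is given by a polynomial with value `a` at `0`. -/
def HasLim (u : kˣ → k) (a : k) : Prop :=
  ∃ Q : Polynomial k, (∀ s : kˣ, u s = Q.eval (s : k)) ∧ Q.eval 0 = a

theorem poly_eq [Infinite k] {P Q : Polynomial k} (h : ∀ s : kˣ, P.eval (s : k) = Q.eval (s : k)) : P = Q := by
  have h1 : (P - Q) * Polynomial.X = 0 := by
    apply Polynomial.funext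
    intro r
    by_cases hr : r = 0
    · simp [hr]
    · have := h (Units.mk0 r hr)
      simp only [Units.val_mk0] at this
      simp [this]
  exact sub_eq_zero.1 ((mul_eq_zero.1 h1).resolve_right Polynomial.X_ne_zero)

theorem HasLim.unique [Infinite k] {u : kˣ → k} {a a' : k} (h : HasLim u a) (h' : HasLim u a') : a = a' := by
  obtain ⟨Q, h1, rfl⟩ := h
  obtain ⟨Q', h1', rfl⟩ := h'
  rw [poly_eq (P := Q) (Q := Q') fun s => by rw [← h1, ← h1']]

theorem HasLim.const (a : k) : HasLim (fun _ => a) a := ⟨Polynomial.C a, by simp, by simp⟩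

theorem HasLim.add {u v : kˣ → k} {a c : k} (h : HasLim u a) (h' : HasLim v c) : HasLim (fun s => u s + v s) (a + c) := by
  obtain ⟨Q, h1, rfl⟩ := h
  obtain ⟨Q', h1', rfl⟩ := h'
  exact ⟨Q + Q', by simp [h1, h1'], by simp⟩

theorem HasLim.mul {u v : kˣ → k} {a c : k} (h : HasLim u a) (h' : HasLim v c) : HasLim (fun s => u s * v s) (a * c) := by
  obtain ⟨Q, h1, rfl⟩ := h
  obtain ⟨Q', h1', rfl⟩ := h'
  exact ⟨Q * Q', by simp [h1, h1'], by simp⟩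

theorem HasLim.sub {u v : kˣ → k} {a c : k} (h : HasLim u a) (h' : HasLim v c) : HasLim (fun s => u s - v s) (a - c) := by
  obtain ⟨Q, h1, rfl⟩ := h
  obtain ⟨Q', h1', rfl⟩ := h'
  exact ⟨Q - Q', by simp [h1, h1'], by simp⟩

theorem HasLim.sum {ι : Type} (t : Finset ι) {u : ι → kˣ → k} {a : ι → k} (h : ∀ i ∈ t, HasLim (u i) (a i)) :
    HasLim (fun s => ∑ i ∈ t, u i s) (∑ i ∈ t, a i) := by
  classical
  induction t using Finset.induction_on with
  | empty => simpa using HasLim.const (0 : k)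
  | insert i t hi ih =>
    simp only [Finset.sum_insert hi]
    exact (h i (Finset.mem_insert_self _ _)).add (ih fun j hj => h j (Finset.mem_insert_of_mem hj))

theorem HasLim.zpow {z : ℤ} (hz : 0 < z) : HasLim (fun s : kˣ => ((s ^ z : kˣ) : k)) 0 := by
  obtain ⟨a, rfl⟩ := Int.eq_ofNat_of_zero_le hz.le
  have ha : a ≠ 0 := by rintro rfl; simp at hz
  refine ⟨Polynomial.X ^ a, fun s => ?_, by simp [ha]⟩
  simp

theorem HasLim.congr {u v : kˣ → k} {a : k} (h : HasLim u a) (huv : ∀ s, v s = u s) : HasLim v a := by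
  obtain ⟨Q, h1, h2⟩ := h
  exact ⟨Q, fun s => (huv s).trans (h1 s), h2⟩

theorem HasLim.eval {σ : Type} {u : kˣ → σ → k} {a : σ → k} (h : ∀ i, HasLim (fun s => u s i) (a i)) (f : MvPolynomial σ k) :
    HasLim (fun s => MvPolynomial.eval (u s) f) (MvPolynomial.eval a f) := by
  induction f using MvPolynomial.induction_on with
  | C c => simpa using HasLim.const c
  | add p q hp hq => simpa using hp.add hq
  | mul_X p i hp => simpa using hp.mul (h i)

end HasLim

section Core

variable {k : Type} [Field k] {n m : ℕ}

def lamF (φ : (Fin n → ℤ) →+ ℤ) (s : kˣ) : Fin n → kˣ := fun i => s ^ φ (Pi.single i 1)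

theorem tp_lamF (φ : (Fin n → ℤ) →+ ℤ) (s : kˣ) (χ) : tp (lamF φ s) χ = s ^ φ χ := by
  classical
  have h1 : χ = ∑ i, χ i • (Pi.single i 1 : Fin n → ℤ) := by
    funext j
    rw [Finset.sum_apply, Finset.sum_eq_single j]
    · simp
    · intro i _ hi; simp [Pi.single_eq_of_ne hi.symm]
    · simp
  conv_rhs => rw [h1, map_sum]
  have h2 : ∀ (u : Finset (Fin n)) (a : Fin n → ℤ), s ^ (∑ i ∈ u, a i) = ∏ i ∈ u, s ^ a i := by
    intro u a
    induction u using Finset.induction_on with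
    | empty => simp
    | insert i u hi ih => rw [Finset.sum_insert hi, Finset.prod_insert hi, zpow_add, ih]
  rw [tp, h2]
  refine Finset.prod_congr rfl fun i _ => ?_
  rw [map_zsmul, smul_eq_mul, lamF, mul_comm, zpow_mul]

theorem ltr_exists (a : GL (Fin n) k) (f : MvPolynomial (Sg n m) k) :
    ∃ f' : MvPolynomial (Sg n m) k, ∀ h x, MvPolynomial.eval (ept h x) f' = MvPolynomial.eval (ept (a * h) x) f := by
  let e := fun z : GL (Fin n) k × (Fin m → k) => ept z.1 z.2
  have h1 : ∀ s, (fun z : GL (Fin n) k × (Fin m → k) => gpt z.1 s) ∈ reg e := by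
    intro s
    rcases s with ⟨i, j⟩ | ⟨⟩
    · exact coord_mem_reg e (Sum.inl (i, j))
    · exact coord_mem_reg e (Sum.inr (Sum.inl ()))
  have h2 : (fun z : GL (Fin n) k × (Fin m → k) => MvPolynomial.eval (ept (a * z.1) z.2) f) ∈ reg e := by
    refine reg_pull (e := e) (fun z : GL (Fin n) k × (Fin m → k) => (a * z.1, z.2)) ?_ (eval_mem_reg e f)
    exact ept_mem (gpt_mul_mem (u := fun _ => a) (fun s => (reg e).algebraMap_mem (gpt a s)) h1) (fun i => coord_mem_reg e (Sum.inr (Sum.inr i)))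
  obtain ⟨f', hf'⟩ := mem_reg.1 h2
  exact ⟨f', fun h x => (hf' (h, x)).symm⟩

noncomputable def ltr (a : GL (Fin n) k) (f : MvPolynomial (Sg n m) k) : MvPolynomial (Sg n m) k := (ltr_exists a f).choose

theorem eval_ltr (a : GL (Fin n) k) (f : MvPolynomial (Sg n m) k) (h x) :
    MvPolynomial.eval (ept h x) (ltr a f) = MvPolynomial.eval (ept (a * h) x) f := (ltr_exists a f).choose_spec h x

variable {Γ : Type} [AddCommGroup Γ] [LinearOrder Γ] [IsOrderedAddMonoid Γ]

structure Good (ν : (Fin n → ℤ) →+ Γ) (D : Finset (Fin n → ℤ)) (φ : (Fin n → ℤ) →+ ℤ) : Prop where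
  zero : ∀ χ, ν χ = 0 → φ χ = 0
  pos : ∀ d ∈ D, 0 < ν d → 0 < φ d

theorem Good.mono {ν : (Fin n → ℤ) →+ Γ} {D D' : Finset (Fin n → ℤ)} {φ : (Fin n → ℤ) →+ ℤ} (h : Good ν D φ) (hD : D' ⊆ D) : Good ν D' φ :=
  ⟨h.zero, fun d hd => h.pos d (hD hd)⟩

theorem good_exists (ν : (Fin n → ℤ) →+ Γ) (D : Finset (Fin n → ℤ)) : ∃ φ, Good ν D φ := by
  obtain ⟨φ, h1, h2⟩ := sign_lemma n ν D
  exact ⟨φ, h1, h2⟩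

open Classical in
noncomputable def theta (ν : (Fin n → ℤ) →+ Γ) (b : GL (Fin n) k) (x : Fin m → k) (f : MvPolynomial (Sg n m) k) : k :=
  ∑ χ ∈ wts f with ν χ = 0, MvPolynomial.eval (ept b x) (comp f χ)

variable {G : AlgGroup k} 

theorem PInv.ltr {X : GVariety G m} {f : MvPolynomial (Sg G.n m) k} (hf : PInv X f) (a) : PInv X (ltr a f) := by
  intro g hg h x hx
  rw [eval_ltr, eval_ltr, ← mul_assoc]
  exact hf g hg _ x hx

/-- The output of the valuative step -/
structure RData (X : GVariety G m) (x : Fin m → k) (S : Set (Fin m → k)) (ν : (Fin G.n → ℤ) →+ Γ) (b : GL (Fin G.n) k) : Prop where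
  neg : ∀ f, PInv X f → ∀ χ, ν χ < 0 → MvPolynomial.eval (ept b x) (comp f χ) = 0
  zero : ∀ f, PInv X f → (∀ h, ∀ y ∈ S, MvPolynomial.eval (ept h y) f = 0) → ∀ χ, ν χ = 0 → MvPolynomial.eval (ept b x) (comp f χ) = 0

variable {X : GVariety G m} {x : Fin m → k} {S : Set (Fin m → k)} {ν : (Fin G.n → ℤ) →+ Γ} {b : GL (Fin G.n) k}

theorem RData.star (H : RData X x S ν b) {f} (hf : PInv X f) {φ} (hφ : Good ν (wts f) φ) (t : Fin G.n → kˣ) (ht : ∀ χ, ν χ = 0 → tp t χ = 1) :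
    HasLim (fun s => MvPolynomial.eval (ept (dU t * (dU (lamF φ s) * b)) x) f) (theta ν b x f) := by
  classical
  have h1 : ∀ s, MvPolynomial.eval (ept (dU t * (dU (lamF φ s) * b)) x) f =
      ∑ χ ∈ wts f, ((s ^ φ χ : kˣ) : k) * ((tp t χ : kˣ) * MvPolynomial.eval (ept b x) (comp f χ)) := by
    intro s
    rw [← mul_assoc, ← dU_mul, eval_dU]
    refine Finset.sum_congr rfl fun χ _ => ?_
    rw [← tp_lamF]
    simp only [tp, Pi.mul_apply, mul_zpow, Finset.prod_mul_distrib, Units.val_mul]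
    ring
  refine HasLim.congr ?_ h1
  rw [theta, Finset.sum_filter]
  refine HasLim.sum _ fun χ hχ => ?_
  rcases lt_trichotomy (ν χ) 0 with h | h | h
  · rw [if_neg h.ne, H.neg f hf χ h]
    simpa using HasLim.const (0 : k)
  · rw [if_pos h]
    simp only [hφ.zero χ h, ht χ h, zpow_zero, Units.val_one, one_mul]
    exact HasLim.const _
  · rw [if_neg h.ne']
    simpa using (HasLim.zpow (k := k) (hφ.pos χ hχ h)).mul (HasLim.const ((tp t χ : kˣ) * MvPolynomial.eval (ept b x) (comp f χ)))

theorem RData.star1 (H : RData X x S ν b) {f} (hf : PInv X f) {φ} (hφ : Good ν (wts f) φ) :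
    HasLim (fun s => MvPolynomial.eval (ept (dU (lamF φ s) * b) x) f) (theta ν b x f) := by
  have := H.star hf hφ 1 (by simp [tp])
  simpa only [dU_one, one_mul] using this

variable [Infinite k]

theorem RData.theta_ltr (H : RData X x S ν b) {f} (hf : PInv X f) (t : Fin G.n → kˣ) (ht : ∀ χ, ν χ = 0 → tp t χ = 1) :
    theta ν b x (ltr (dU t) f) = theta ν b x f := by
  classical
  obtain ⟨φ, hφ⟩ := good_exists ν (wts f ∪ wts (ltr (dU t) f))
  have h1 := H.star1 (hf.ltr (dU t)) (hφ.mono Finset.subset_union_right)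
  simp only [eval_ltr] at h1
  exact h1.unique (H.star hf (hφ.mono Finset.subset_union_left) t ht)

theorem RData.theta_van (H : RData X x S ν b) {f} (hf : PInv X f) (hv : ∀ h, ∀ y ∈ S, MvPolynomial.eval (ept h y) f = 0) :
    theta ν b x f = 0 := by
  classical
  rw [theta]
  refine Finset.sum_eq_zero fun χ hχ => ?_
  exact H.zero f hf hv χ (Finset.mem_filter.1 hχ).2

variable [IsAlgClosed k] [CharZero k]

theorem RData.core2 (H : RData X x S ν b) (hG : IsReductive G) (hSX : S ⊆ X.carrier) (hSc : IsZClosed S)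
    (hSG : ∀ g ∈ G.toSubgroup, ∀ y ∈ S, X.act g y ∈ S) :
    ∃ (c : GL (Fin G.n) k) (s0 : Fin m → k), s0 ∈ S ∧ ∀ f, PInv X f → MvPolynomial.eval (ept c s0) f = theta ν b x f := by
  classical
  by_contra hcon
  push Not at hcon
  obtain ⟨IS, hIS⟩ := hSc
  obtain ⟨r, F, Hf, hF, hH1, hH2, hH3⟩ := (zRat X).invNS hG (reg_fg _) (zpt X) {z | z.2.1 ∈ S}
    (fun g z hz => hSG _ (G.toSubgroup.inv_mem g.2) _ hz)
    {F | ∀ z : ZT X, z.2.1 ∈ S → F.1 z = 0} (by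
      intro z hz
      change z.2.1 ∈ S
      rw [hIS]
      intro p hp
      have h1 := hz ⟨_, eval_mem_reg (fun z : ZT X => ept z.1 z.2.1) (MvPolynomial.rename (fun i => Sum.inr (Sum.inr i)) p)⟩ (by
        intro z' hz'
        change MvPolynomial.eval _ _ = 0
        rw [MvPolynomial.eval_rename]
        rw [hIS] at hz'
        exact hz' p hp)
      change MvPolynomial.eval _ _ = 0 at h1
      rw [MvPolynomial.eval_rename] at h1
      exact h1)
    {F | ∃ f, PInv X f ∧ ∀ z : ZT X, F.1 z = MvPolynomial.eval (ept z.1 z.2.1) f - theta ν b x f} (by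
      rintro F ⟨f, hf, hFf⟩ g z
      rw [hFf, hFf]
      have := hf.zInv.2 g z
      exact congrArg (· - _) this) (by
      intro z hz
      obtain ⟨f, hf, hne⟩ := hcon z.1 z.2.1 hz
      refine ⟨⟨_, (zO X).sub_mem (eval_mem_reg (fun z : ZT X => ept z.1 z.2.1) f) ((zO X).algebraMap_mem (theta ν b x f))⟩, ⟨f, hf, fun _ => rfl⟩, ?_⟩
      exact sub_ne_zero.2 hne) (fun F hF z hz => hF z hz)
  choose f hf hFf using hF
  have : ∀ i, ∃ p, PInv X p ∧ ∀ z : ZT X, Hf i z = MvPolynomial.eval (ept z.1 z.2.1) p := fun i => ZInv.exists ⟨hH1 i, hH2 i⟩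
  choose p hp hpH using this
  let P : MvPolynomial (Sg G.n m) k := ∑ i, p i * (f i - MvPolynomial.C (theta ν b x (f i))) - 1
  have hPe : ∀ h y, MvPolynomial.eval (ept h y) P = ∑ i, MvPolynomial.eval (ept h y) (p i) * (MvPolynomial.eval (ept h y) (f i) - theta ν b x (f i)) - 1 := by
    intro h y; simp [P]
  have hP : PInv X P := by
    intro g hg h y hy
    rw [hPe, hPe]
    congr 1
    refine Finset.sum_congr rfl fun i _ => ?_
    rw [hp i g hg h y hy, hf i g hg h y hy]
  have h0 : theta ν b x P = 0 := by
    apply H.theta_van hP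
    intro h y hy
    rw [hPe, ← hH3 (h, ⟨y, hSX hy⟩) hy, sub_eq_zero]
    refine Finset.sum_congr rfl fun i _ => ?_
    rw [hpH, hFf]
  obtain ⟨φ, hφ⟩ := good_exists ν (wts P ∪ Finset.univ.biUnion (fun i => wts (p i) ∪ wts (f i)))
  have l1 := H.star1 hP (hφ.mono Finset.subset_union_left)
  have lf : ∀ i, HasLim (fun s => MvPolynomial.eval (ept (dU (lamF φ s) * b) x) (f i)) (theta ν b x (f i)) := fun i =>
    H.star1 (hf i) (hφ.mono ((Finset.subset_union_right.trans (Finset.subset_biUnion_of_mem (fun i => wts (p i) ∪ wts (f i)) (Finset.mem_univ i))).trans Finset.subset_union_right))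
  have lp : ∀ i, HasLim (fun s => MvPolynomial.eval (ept (dU (lamF φ s) * b) x) (p i)) (theta ν b x (p i)) := fun i =>
    H.star1 (hp i) (hφ.mono ((Finset.subset_union_left.trans (Finset.subset_biUnion_of_mem (fun i => wts (p i) ∪ wts (f i)) (Finset.mem_univ i))).trans Finset.subset_union_right))
  have l2 := (HasLim.sum Finset.univ fun i _ => (lp i).mul ((lf i).sub (HasLim.const (theta ν b x (f i))))).sub (HasLim.const (1 : k))
  have l3 := l1.unique (l2.congr fun s => hPe _ _)
  rw [h0] at l3
  simp at l3

end Core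

end PaperGIT

namespace PaperGIT

section Sep

variable {k : Type} [Field k] {n m : ℕ}

theorem gtr_exists (a c : GL (Fin n) k) (f : MvPolynomial (Tau n) k) :
    ∃ f' : MvPolynomial (Tau n) k, ∀ h : GL (Fin n) k, MvPolynomial.eval (gpt h) f' = MvPolynomial.eval (gpt (a * h * c)) f := by
  let e := fun h : GL (Fin n) k => gpt h
  have h2 : (fun h : GL (Fin n) k => MvPolynomial.eval (gpt (a * h * c)) f) ∈ reg e := by
    refine reg_pull (e := e) (fun h : GL (Fin n) k => a * h * c) ?_ (eval_mem_reg e f)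
    refine gpt_mul_mem (u := fun h => a * h) (v := fun _ => c) ?_ (fun s => (reg e).algebraMap_mem (gpt c s))
    exact gpt_mul_mem (u := fun _ => a) (fun s => (reg e).algebraMap_mem (gpt a s)) (fun s => coord_mem_reg e s)
  obtain ⟨f', hf'⟩ := mem_reg.1 h2
  exact ⟨f', fun h => (hf' h).symm⟩

theorem gpt_inj {h h' : GL (Fin n) k} (e : gpt h = gpt h') : h = h' := by
  apply Units.ext
  ext i j
  exact congrFun e (Sum.inl (i, j))

variable [IsAlgClosed k] [CharZero k] {G : AlgGroup k}

theorem coset_zero (c h : GL (Fin G.n) k) (H : ∀ Φ : MvPolynomial (Tau G.n) k, (∀ g ∈ G.toSubgroup, MvPolynomial.eval (gpt (c * g)) Φ = 0) → MvPolynomial.eval (gpt h) Φ = 0) :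
    c⁻¹ * h ∈ G.toSubgroup := by
  obtain ⟨g, hg, e⟩ := mem_of_van (G := G) (gpt (c⁻¹ * h)) (by
    intro Φ hΦ
    obtain ⟨Φ', hΦ'⟩ := gtr_exists c⁻¹ 1 Φ
    have := H Φ' (fun g hg => by
      rw [hΦ']
      simpa using hΦ g hg)
    rw [hΦ'] at this
    simpa using this)
  rw [← gpt_inj e]; exact hg

theorem gpt_eval_mem (X : GVariety G m) (f : MvPolynomial (Tau G.n) k) : (fun z : ZT X => MvPolynomial.eval (gpt z.1) f) ∈ zO X :=
  reg_le (S := zO X) (e := fun z : ZT X => gpt z.1) (zO_gpt X) (eval_mem_reg (fun z : ZT X => gpt z.1) f)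

theorem sepA (hG : IsReductive G) (X : GVariety G m) (P1 : Set (MvPolynomial (Tau G.n) k))
    (hst : ∀ h : GL (Fin G.n) k, (∀ f ∈ P1, MvPolynomial.eval (gpt h) f = 0) → ∀ g ∈ G.toSubgroup, ∀ f ∈ P1, MvPolynomial.eval (gpt (h * g)) f = 0)
    (c : GL (Fin G.n) k) (hc : ∃ f ∈ P1, MvPolynomial.eval (gpt c) f ≠ 0) :
    ∃ f, PInv X f ∧ (∀ h, ∀ x ∈ X.carrier, ∀ x' ∈ X.carrier, MvPolynomial.eval (ept h x) f = MvPolynomial.eval (ept h x') f) ∧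
      (∀ h : GL (Fin G.n) k, (∀ f ∈ P1, MvPolynomial.eval (gpt h) f = 0) → ∀ x ∈ X.carrier, MvPolynomial.eval (ept h x) f = 1) ∧
      (∀ x ∈ X.carrier, MvPolynomial.eval (ept c x) f = 0) := by
  let J1 : Ideal (MvPolynomial (Tau G.n) k) := Ideal.span (P1 ∪ {detP G.n k})
  let J2 : Ideal (MvPolynomial (Tau G.n) k) := Ideal.span {Φ | ∀ g ∈ G.toSubgroup, MvPolynomial.eval (gpt (c * g)) Φ = 0}
  have htop : J1 ⊔ J2 = ⊤ := by
    by_contra hne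
    obtain ⟨χ, hχ⟩ := exists_algHom_of_ne_top (k := k) (A := MvPolynomial (Tau G.n) k) _ hne
    let p : Tau G.n → k := fun s => χ (MvPolynomial.X s)
    have hp : ∀ f, χ f = MvPolynomial.eval p f := by
      intro f
      rw [← MvPolynomial.aeval_eq_eval]
      have : χ = MvPolynomial.aeval p := MvPolynomial.algHom_ext fun i => by simp [p]
      exact congrArg (fun ψ : MvPolynomial (Tau G.n) k →ₐ[k] k => ψ f) this
    obtain ⟨h, hh⟩ := exists_gpt' p (by
      rw [← hp]; exact hχ _ (Ideal.mem_sup_left (Ideal.subset_span (Or.inr rfl))))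
    have h1 : c⁻¹ * h ∈ G.toSubgroup := coset_zero c h (fun Φ hΦ => by
      rw [hh, ← hp]; exact hχ _ (Ideal.mem_sup_right (Ideal.subset_span hΦ)))
    obtain ⟨f, hf, hf'⟩ := hc
    apply hf'
    have h2 := hst h (fun f hf => by
      rw [hh, ← hp]; exact hχ _ (Ideal.mem_sup_left (Ideal.subset_span (Or.inl hf)))) _ (G.toSubgroup.inv_mem h1) f hf
    rwa [mul_inv_rev, inv_inv, mul_inv_cancel_left] at h2
  have h1 : (1 : MvPolynomial (Tau G.n) k) ∈ J1 ⊔ J2 := by rw [htop]; trivial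
  obtain ⟨b1, hb1, b2, hb2, hb⟩ := Submodule.mem_sup.1 h1
  have v1 : ∀ h : GL (Fin G.n) k, (∀ f ∈ P1, MvPolynomial.eval (gpt h) f = 0) → MvPolynomial.eval (gpt h) b2 = 1 := by
    intro h hh
    have : J1 ≤ RingHom.ker (MvPolynomial.eval (gpt h)) := by
      rw [Ideal.span_le]
      rintro f (hf | rfl)
      · exact hh f hf
      · change MvPolynomial.eval (gpt h) _ = 0
        rw [← MvPolynomial.aeval_eq_eval]; exact aeval_detP_gpt h
    have e1 : MvPolynomial.eval (gpt h) b1 = 0 := this hb1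
    have e2 := congrArg (MvPolynomial.eval (gpt h)) hb
    rwa [map_add, e1, zero_add, map_one] at e2
  have v2 : ∀ g ∈ G.toSubgroup, MvPolynomial.eval (gpt (c * g)) b2 = 0 := by
    intro g hg
    have : J2 ≤ RingHom.ker (MvPolynomial.eval (gpt (c * g))) := by
      rw [Ideal.span_le]
      intro f hf
      exact hf g hg
    exact this hb2
  let b : ZT X → k := fun z => MvPolynomial.eval (gpt z.1) b2
  let C : Set (ZT X) := {z | (∀ f ∈ P1, MvPolynomial.eval (gpt z.1) f = 0) ∨ ∃ g ∈ G.toSubgroup, z.1 = c * g}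
  let U0 : Submodule k (ZT X → k) :=
    { carrier := {F | ∀ h x x', F (h, x) = F (h, x')}
      add_mem' := by
        intro F F' hF hF' h x x'
        rw [Pi.add_apply, Pi.add_apply, hF h x x', hF' h x x']
      zero_mem' := fun _ _ _ => rfl
      smul_mem' := by
        intro t F hF h x x'
        rw [Pi.smul_apply, Pi.smul_apply, hF h x x'] }
  obtain ⟨F, hF1, hF2, hF3⟩ := (zRat X).inv1 hG (vanS k C ⊓ U0) b (gpt_eval_mem X b2) (by
    intro g
    refine ⟨?_, fun h x x' => rfl⟩
    rintro z (hz | ⟨g', hg', hz⟩)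
    · change MvPolynomial.eval (gpt (z.1 * g.1)) b2 - MvPolynomial.eval (gpt z.1) b2 = 0
      rw [v1 _ hz, v1 _ (hst _ hz _ g.2), sub_self]
    · change MvPolynomial.eval (gpt (z.1 * g.1)) b2 - MvPolynomial.eval (gpt z.1) b2 = 0
      rw [hz, mul_assoc, v2 _ hg', v2 _ (G.toSubgroup.mul_mem hg' g.2), sub_self])
  obtain ⟨f, hf, hfF⟩ := ZInv.exists (X := X) ⟨hF1, hF2⟩
  have hFb : ∀ z ∈ C, F z = b z := fun z hz => (sub_eq_zero.1 (hF3.1 z hz)).symm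
  refine ⟨f, hf, ?_, ?_, ?_⟩
  · intro h x hx x' hx'
    rw [← hfF (h, ⟨x, hx⟩), ← hfF (h, ⟨x', hx'⟩)]
    have := hF3.2 h ⟨x, hx⟩ ⟨x', hx'⟩
    exact sub_right_injective (b := MvPolynomial.eval (gpt h) b2) this
  · intro h hh x hx
    rw [← hfF (h, ⟨x, hx⟩)]
    exact (hFb (h, ⟨x, hx⟩) (Or.inl hh)).trans (v1 h hh)
  · intro x hx
    rw [← hfF (c, ⟨x, hx⟩)]
    have := v2 1 G.toSubgroup.one_mem
    rw [mul_one] at this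
    exact (hFb (c, ⟨x, hx⟩) (Or.inr ⟨1, G.toSubgroup.one_mem, (mul_one _).symm⟩)).trans this

/-- invariants depending only on the group variable separate cosets -/
theorem sep_coset (hG : IsReductive G) (X : GVariety G m) {x : Fin m → k} (hx : x ∈ X.carrier) (c h : GL (Fin G.n) k)
    (H : ∀ f, PInv X f → (∀ h, ∀ x ∈ X.carrier, ∀ x' ∈ X.carrier, MvPolynomial.eval (ept h x) f = MvPolynomial.eval (ept h x') f) →
      MvPolynomial.eval (ept h x) f = MvPolynomial.eval (ept c x) f) : c⁻¹ * h ∈ G.toSubgroup := by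
  by_contra hn
  have hn' : ¬ h⁻¹ * c ∈ G.toSubgroup := by
    intro h'
    apply hn
    have := G.toSubgroup.inv_mem h'
    rwa [mul_inv_rev, inv_inv] at this
  obtain ⟨f, h1, h2, h3, h4⟩ := sepA hG X {Φ | ∀ g ∈ G.toSubgroup, MvPolynomial.eval (gpt (h * g)) Φ = 0} (by
    intro h' hh' g hg f hf
    have h1 := coset_zero h h' (fun Φ hΦ => hh' Φ hΦ)
    have h2 := hf _ (G.toSubgroup.mul_mem h1 hg)
    rwa [← mul_assoc, mul_inv_cancel_left] at h2) c (by
    by_contra hcc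
    push Not at hcc
    exact hn' (coset_zero h c (fun Φ hΦ => hcc Φ hΦ)))
  have e1 := h3 h (fun Φ hΦ => by simpa using hΦ 1 G.toSubgroup.one_mem) x hx
  rw [H f h1 h2, h4 x hx] at e1
  exact zero_ne_one e1

/-- the extension of the orbit map -/
theorem xi_exists (hG : IsReductive G) (X : GVariety G m) (i : Fin m) : ∃ f, PInv X f ∧ ∀ g ∈ G.toSubgroup, ∀ x ∈ X.carrier, MvPolynomial.eval (ept g x) f = X.act g x i := by
  obtain ⟨q, hq⟩ := X.regular
  let b : ZT X → k := fun z => MvPolynomial.eval (ept z.1 z.2.1) (q i)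
  have hb : ∀ z : ZT X, z.1 ∈ G.toSubgroup → b z = X.act z.1 z.2.1 i := fun z hz => (hq z.1 hz z.2.1 z.2.2 i).symm
  obtain ⟨F, hF1, hF2, hF3⟩ := (zRat X).inv1 hG (vanS k {z | z.1 ∈ G.toSubgroup}) b (eval_mem_reg _ _) (by
    intro g z hz
    change b _ - b z = 0
    rw [hb z hz, hb _ (show (zact X g z).1 ∈ G.toSubgroup from G.toSubgroup.mul_mem hz g.2)]
    rw [sub_eq_zero]
    change X.act (z.1 * g.1) (X.act g.1⁻¹ z.2.1) i = _
    rw [← X.act_mul _ (G.toSubgroup.mul_mem hz g.2) _ (G.toSubgroup.inv_mem g.2) _ z.2.2, mul_assoc, mul_inv_cancel, mul_one])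
  obtain ⟨f, hf, hfF⟩ := ZInv.exists (X := X) ⟨hF1, hF2⟩
  refine ⟨f, hf, fun g hg x hx => ?_⟩
  rw [← hfF (g, ⟨x, hx⟩), ← hb (g, ⟨x, hx⟩) hg]
  exact (sub_eq_zero.1 (hF3 (g, ⟨x, hx⟩) hg)).symm

end Sep

end PaperGIT

namespace PaperGIT

section Limit

variable {k : Type} [Field k]

theorem HasLim.two_sided [Infinite k] {u : kˣ → k} {a a' : k} (h : HasLim u a) (h' : HasLim (fun s => u s⁻¹) a') (s : kˣ) : u s = a := by
  obtain ⟨P, h1, rfl⟩ := h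
  obtain ⟨Q, h1', rfl⟩ := h'
  have key : Polynomial.X ^ Q.natDegree * P = Q.reverse := by
    apply poly_eq
    intro s
    have e1 := h1 s
    have e2 := h1' s⁻¹
    simp only [inv_inv] at e2
    let _ : Invertible ((s⁻¹ : kˣ) : k) := ⟨(s : k), by simp, by simp⟩
    have e3 := Polynomial.eval₂_reverse_mul_pow (RingHom.id k) ((s⁻¹ : kˣ) : k) Q
    change Polynomial.eval (s : k) Q.reverse * _ = Polynomial.eval _ Q at e3
    rw [← e2, e1] at e3
    simp only [Polynomial.eval_mul, Polynomial.eval_pow, Polynomial.eval_X]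
    rw [← e3, mul_comm, mul_assoc, ← mul_pow]
    simp
  have hd : P.natDegree = 0 := by
    by_cases hP : P = 0
    · simp [hP]
    have := Polynomial.natDegree_mul (p := (Polynomial.X ^ Q.natDegree : Polynomial k)) (q := P) (pow_ne_zero _ Polynomial.X_ne_zero) hP
    rw [key, Polynomial.natDegree_X_pow] at this
    have h2 := Polynomial.reverse_natDegree_le Q
    omega
  obtain ⟨r, rfl⟩ := Polynomial.natDegree_eq_zero.1 hd
  rw [h1]; simp

variable {n m : ℕ}

theorem dU_inv (t : Fin n → kˣ) : (dU t)⁻¹ = dU t⁻¹ := by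
  rw [inv_eq_iff_mul_eq_one, ← dU_mul, mul_inv_cancel, dU_one]

theorem dU_conj_apply (t : Fin n → kˣ) (a : GL (Fin n) k) (i j) :
    (dU t * a * (dU t)⁻¹ : GL (Fin n) k).1 i j = (t i * (t j)⁻¹ : kˣ) * a.1 i j := by
  rw [dU_inv]
  change (Matrix.diagonal (fun i => (t i : k)) * a.1 * Matrix.diagonal (fun i => (t⁻¹ i : kˣ) : Fin n → k)) i j = _
  rw [Matrix.mul_diagonal, Matrix.diagonal_mul]
  simp only [Pi.inv_apply, Units.val_mul]
  ring

open Classical in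
/-- differences of standard basis vectors -/
noncomputable def DE (n : ℕ) : Finset (Fin n → ℤ) :=
  Finset.univ.image fun p : Fin n × Fin n => Pi.single p.1 1 - Pi.single p.2 1

theorem mem_DE (i j : Fin n) : (Pi.single i 1 - Pi.single j 1 : Fin n → ℤ) ∈ DE n :=
  Finset.mem_image.2 ⟨(i, j), Finset.mem_univ _, rfl⟩

variable {Γ : Type} [AddCommGroup Γ] [LinearOrder Γ] [IsOrderedAddMonoid Γ]

/-- the weight of the `i`-th basis vector -/
def gam (ν : (Fin n → ℤ) →+ Γ) (i : Fin n) : Γ := ν (Pi.single i 1)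

theorem conjLim [Infinite k] (ν : (Fin n → ℤ) →+ Γ) (a : GL (Fin n) k) (ha : ∀ i j, gam ν i < gam ν j → a.1 i j = 0) :
    ∃ a0 : GL (Fin n) k, (∀ i j, gam ν i ≠ gam ν j → a0.1 i j = 0) ∧ ∀ φ, Good ν (DE n) φ → ∀ τ,
      HasLim (fun s : kˣ => gpt (dU (lamF φ s) * a * (dU (lamF φ s))⁻¹) τ) (gpt a0 τ) := by
  classical
  let M : Matrix (Fin n) (Fin n) k := fun i j => if gam ν i = gam ν j then a.1 i j else 0
  have hM : ∀ φ, Good ν (DE n) φ → ∀ i j, HasLim (fun s : kˣ => (dU (lamF φ s) * a * (dU (lamF φ s))⁻¹ : GL (Fin n) k).1 i j) (M i j) := by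
    intro φ hφ i j
    have e : ∀ s : kˣ, (lamF φ s i * (lamF φ s j)⁻¹ : kˣ) = s ^ φ (Pi.single i 1 - Pi.single j 1) := by
      intro s
      rw [map_sub, zpow_sub]; rfl
    simp only [dU_conj_apply, e]
    have hν : ν (Pi.single i 1 - Pi.single j 1) = gam ν i - gam ν j := map_sub _ _ _
    rcases lt_trichotomy (gam ν i) (gam ν j) with h | h | h
    · simp only [M, if_neg h.ne, ha i j h, mul_zero]
      exact HasLim.const 0
    · rw [hφ.zero _ (by rw [hν, h, sub_self])]
      simp only [M, if_pos h, zpow_zero, Units.val_one, one_mul]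
      exact HasLim.const _
    · simp only [M, if_neg h.ne']
      have := (HasLim.zpow (k := k) (hφ.pos _ (mem_DE i j) (by rw [hν]; exact sub_pos.2 h))).mul (HasLim.const (a.1 i j))
      simpa using this
  have hdet : M.det = a.1.det := by
    obtain ⟨φ, hφ⟩ := good_exists ν (DE n)
    have h1 := HasLim.eval (u := fun s : kˣ => mat2pt (dU (lamF φ s) * a * (dU (lamF φ s))⁻¹ : GL (Fin n) k).1) (a := mat2pt M)
      (fun ij => hM φ hφ ij.1 ij.2) (Matrix.of fun i j => MvPolynomial.X (i, j) : Matrix (Fin n) (Fin n) (MvPolynomial (Fin n × Fin n) k)).det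
    have h2 : ∀ A : Matrix (Fin n) (Fin n) k, MvPolynomial.eval (mat2pt A) (Matrix.of fun i j => MvPolynomial.X (i, j) : Matrix (Fin n) (Fin n) (MvPolynomial (Fin n × Fin n) k)).det = A.det := by
      intro A
      rw [RingHom.map_det]
      congr 1
      ext i j
      simp [mat2pt]
    simp only [h2] at h1
    refine h1.unique ((HasLim.const a.1.det).congr fun s => ?_)
    rw [Units.val_mul, Units.val_mul, Matrix.det_mul, Matrix.det_mul, mul_right_comm, det_mul_inv, one_mul]
  have hu : IsUnit M := by
    rw [Matrix.isUnit_iff_isUnit_det, hdet]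
    exact IsUnit.of_mul_eq_one _ (det_mul_inv a)
  obtain ⟨a0, ha0⟩ := hu
  refine ⟨a0, fun i j hij => ?_, fun φ hφ τ => ?_⟩
  · rw [ha0]; simp only [M, if_neg hij]
  · rcases τ with ⟨i, j⟩ | ⟨⟩
    · have := hM φ hφ i j
      rw [← ha0] at this
      exact this
    · change HasLim (fun s : kˣ => ((dU (lamF φ s) * a * (dU (lamF φ s))⁻¹)⁻¹ : GL (Fin n) k).1.det) (a0⁻¹).1.det
      have h3 : (a0⁻¹).1.det = (a⁻¹).1.det := by
        have e1 := det_mul_inv a0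
        have e2 := det_mul_inv a
        rw [ha0, hdet] at e1
        exact mul_left_cancel₀ (left_ne_zero_of_mul (e2.trans_ne one_ne_zero)) (e1.trans e2.symm)
      rw [h3]
      refine (HasLim.const _).congr fun s => ?_
      rw [mul_inv_rev, mul_inv_rev, inv_inv, Units.val_mul, Units.val_mul, Matrix.det_mul, Matrix.det_mul, mul_left_comm, mul_comm (Matrix.det _) (Matrix.det _)]
      rw [mul_comm _ (Matrix.det (dU _).1), det_mul_inv, mul_one]

theorem expand (f : MvPolynomial (Sg n m) k) : ∃ (r : ℕ) (a : Fin r → GL (Fin n) k) (P : Fin r → MvPolynomial (Tau n) k),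
    ∀ (p h : GL (Fin n) k) (x : Fin m → k), MvPolynomial.eval (ept (p * h) x) f = ∑ j, MvPolynomial.eval (gpt p) (P j) * MvPolynomial.eval (ept (a j * h) x) f := by
  let e := fun z : GL (Fin n) k × (Fin m → k) => ept z.1 z.2
  let A := reg (fun h : GL (Fin n) k => gpt h)
  have hz : ∀ s, (fun q : GL (Fin n) k × (GL (Fin n) k × (Fin m → k)) => gpt q.2.1 s) ∈ tens A (reg e) := by
    intro s
    refine tens_right A (F := fun z : GL (Fin n) k × (Fin m → k) => gpt z.1 s) ?_
    rcases s with ⟨i, j⟩ | ⟨⟩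
    · exact coord_mem_reg e (Sum.inl (i, j))
    · exact coord_mem_reg e (Sum.inr (Sum.inl ()))
  have hx : ∀ i, (fun q : GL (Fin n) k × (GL (Fin n) k × (Fin m → k)) => q.2.2 i) ∈ tens A (reg e) := fun i =>
    tens_right A (coord_mem_reg e (Sum.inr (Sum.inr i)))
  have hg : ∀ s, (fun q : GL (Fin n) k × (GL (Fin n) k × (Fin m → k)) => gpt q.1 s) ∈ tens A (reg e) := fun s =>
    tens_left (reg e) (coord_mem_reg (fun h : GL (Fin n) k => gpt h) s)
  have h1 : (fun q : GL (Fin n) k × (GL (Fin n) k × (Fin m → k)) => MvPolynomial.eval (ept (q.1 * q.2.1) q.2.2) f) ∈ tens A (reg e) := by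
    refine reg_pull (e := e) (fun q : GL (Fin n) k × (GL (Fin n) k × (Fin m → k)) => (q.1 * q.2.1, q.2.2)) ?_ (eval_mem_reg e f)
    exact ept_mem (gpt_mul_mem hg hz) hx
  obtain ⟨N, φ, ψ, h⟩ := mem_tens.1 h1
  obtain ⟨r, a, ψ', h2, h3⟩ := translate_basis (fun p (z : GL (Fin n) k × (Fin m → k)) => MvPolynomial.eval (ept (p * z.1) z.2) f) A (fun i => (φ i).1) (fun i => (φ i).2)
    (fun i => (ψ i).1) (by
      intro p
      funext z
      rw [Finset.sum_apply]
      exact h p z)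
  have : ∀ j, ∃ P : MvPolynomial (Tau n) k, ∀ p, ψ' j p = MvPolynomial.eval (gpt p) P := fun j => mem_reg.1 (h2 j)
  choose P hP using this
  refine ⟨r, a, P, fun p h x => ?_⟩
  have := congrFun (h3 p) (h, x)
  rw [Finset.sum_apply] at this
  refine this.trans (Finset.sum_congr rfl fun j _ => ?_)
  rw [← hP]; rfl

variable {G : AlgGroup k} {X : GVariety G m} {x : Fin m → k} {S : Set (Fin m → k)} {ν : (Fin G.n → ℤ) →+ Γ} {b : GL (Fin G.n) k}

theorem RData.limit (H : RData X x S ν b) {c : GL (Fin G.n) k} {s0 : Fin m → k}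
    (hθ : ∀ f, PInv X f → MvPolynomial.eval (ept c s0) f = theta ν b x f) {f} (hf : PInv X f) :
    ∃ D, ∀ φ, Good ν D φ → ∀ a a0 : GL (Fin G.n) k,
      (∀ τ, HasLim (fun s : kˣ => gpt (dU (lamF φ s) * a * (dU (lamF φ s))⁻¹) τ) (gpt a0 τ)) →
      HasLim (fun s : kˣ => MvPolynomial.eval (ept (dU (lamF φ s) * (a * b)) x) f) (MvPolynomial.eval (ept (a0 * c) s0) f) := by
  classical
  obtain ⟨r, A, P, h⟩ := expand f
  refine ⟨Finset.univ.biUnion fun j => wts (ltr (A j) f), fun φ hφ a a0 hl => ?_⟩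
  rw [h]
  have : ∀ s : kˣ, MvPolynomial.eval (ept (dU (lamF φ s) * (a * b)) x) f =
      ∑ j, MvPolynomial.eval (gpt (dU (lamF φ s) * a * (dU (lamF φ s))⁻¹)) (P j) * MvPolynomial.eval (ept (A j * (dU (lamF φ s) * b)) x) f := by
    intro s
    rw [← h]
    congr 2
    group
  refine HasLim.congr (HasLim.sum _ fun j _ => (HasLim.eval hl (P j)).mul ?_) this
  have h2 := H.star1 (hf.ltr (A j)) (hφ.mono (Finset.subset_biUnion_of_mem (fun j => wts (ltr (A j) f)) (Finset.mem_univ j)))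
  rw [← hθ _ (hf.ltr (A j))] at h2
  simpa only [eval_ltr] using h2

end Limit

end PaperGIT

namespace PaperGIT

section Final

variable {k : Type} [Field k] {n m : ℕ}
variable {Γ : Type} [AddCommGroup Γ] [LinearOrder Γ] [IsOrderedAddMonoid Γ]

theorem Good.neg {ν : (Fin n → ℤ) →+ Γ} {φ} (h : Good ν (DE n) φ) : Good (-ν) (DE n) (-φ) := by
  refine ⟨fun χ hχ => ?_, fun d hd hd' => ?_⟩
  · rw [AddMonoidHom.neg_apply, neg_eq_zero] at hχ ⊢
    exact h.zero χ hχ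
  · obtain ⟨⟨i, j⟩, -, rfl⟩ := Finset.mem_image.1 hd
    have := h.pos _ (mem_DE j i) (by
      rw [← neg_sub, map_neg]; exact hd')
    rw [← neg_sub, map_neg] at this
    exact this

theorem lamF_neg (φ : (Fin n → ℤ) →+ ℤ) (s : kˣ) : lamF (-φ) s = lamF φ s⁻¹ := by
  funext i
  simp [lamF]

theorem lamF_mul (φ : (Fin n → ℤ) →+ ℤ) (s t : kˣ) : lamF φ (s * t) = lamF φ s * lamF φ t := by
  funext i
  simp [lamF, mul_zpow]

theorem lamF_one (φ : (Fin n → ℤ) →+ ℤ) : lamF φ (1 : kˣ) = 1 := by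
  funext i
  simp [lamF]

theorem comm_lam {ν : (Fin n → ℤ) →+ Γ} {D} {φ} (h : Good ν D φ) {a0 : GL (Fin n) k} (ha : ∀ i j, gam ν i ≠ gam ν j → a0.1 i j = 0) (s : kˣ) :
    dU (lamF φ s) * a0 = a0 * dU (lamF φ s) := by
  apply Units.ext
  ext i j
  change (Matrix.diagonal (fun i => (lamF φ s i : k)) * a0.1) i j = (a0.1 * Matrix.diagonal (fun i => (lamF φ s i : k))) i j
  rw [Matrix.mul_diagonal, Matrix.diagonal_mul]
  by_cases hij : gam ν i = gam ν j
  · have h1 := h.zero (Pi.single i 1 - Pi.single j 1) (by rw [map_sub]; exact sub_eq_zero.2 hij)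
    rw [map_sub, sub_eq_zero] at h1
    rw [lamF, lamF, h1, mul_comm]
  · rw [ha i j hij]; simp

variable {G : AlgGroup k} {X : GVariety G m} {x : Fin m → k} {S : Set (Fin m → k)} {ν : (Fin G.n → ℤ) →+ Γ} {b : GL (Fin G.n) k}
variable [IsAlgClosed k] [CharZero k]

theorem RData.lam_mem (H : RData X x S ν b) (hG : IsReductive G) {c : GL (Fin G.n) k} {s0 : Fin m → k} (hs0 : s0 ∈ X.carrier)
    (hθ : ∀ f, PInv X f → MvPolynomial.eval (ept c s0) f = theta ν b x f) {D} {φ} (hφ : Good ν D φ) (s : kˣ) :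
    c⁻¹ * (dU (lamF φ s) * c) ∈ G.toSubgroup := by
  refine sep_coset hG X hs0 c _ fun f hf _ => ?_
  rw [← eval_ltr, hθ _ (hf.ltr _), hθ _ hf]
  refine H.theta_ltr hf _ fun χ hχ => ?_
  rw [tp_lamF, hφ.zero χ hχ, zpow_zero]

theorem RData.core3 (H : RData X x S ν b) (hG : IsReductive G) {c : GL (Fin G.n) k} {s0 : Fin m → k} (hs0 : s0 ∈ X.carrier) (hx : x ∈ X.carrier)
    (hθ : ∀ f, PInv X f → MvPolynomial.eval (ept c s0) f = theta ν b x f) :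
    ∃ a a0 : GL (Fin G.n) k, (a0 * c)⁻¹ * (a * b) ∈ G.toSubgroup ∧ (∀ i j, gam ν i ≠ gam ν j → a0.1 i j = 0) ∧
      ∀ φ, Good ν (DE G.n) φ → ∀ τ, HasLim (fun s : kˣ => gpt (dU (lamF φ s) * a * (dU (lamF φ s))⁻¹) τ) (gpt a0 τ) := by
  classical
  obtain ⟨Δ, hΔ1, hΔ⟩ := lu (k := k) G.n (gam ν)
  have hren : ∀ h : GL (Fin G.n) k, MvPolynomial.eval (gpt h) (MvPolynomial.rename Sum.inl Δ) = MvPolynomial.eval (mat2pt h.1) Δ := by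
    intro h
    rw [MvPolynomial.eval_rename]; rfl
  obtain ⟨f, hf1, hf2, hf3, hf4⟩ := sepA hG X {Φ | ∃ g ∈ G.toSubgroup, ∀ h : GL (Fin G.n) k, MvPolynomial.eval (gpt h) Φ = MvPolynomial.eval (mat2pt (h * (g * c⁻¹)).1) Δ} (by
    rintro h hh g hg Φ ⟨g', hg', hΦ⟩
    obtain ⟨Φ', hΦ'⟩ := gtr_exists 1 (g * g' * c⁻¹) (MvPolynomial.rename Sum.inl Δ)
    have := hh Φ' ⟨g * g', G.toSubgroup.mul_mem hg hg', fun h' => by rw [hΦ', hren, one_mul]⟩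
    rw [hΦ', hren, one_mul] at this
    rw [hΦ, ← this]
    simp only [mul_assoc]) c (by
    obtain ⟨Φ', hΦ'⟩ := gtr_exists 1 (1 * c⁻¹) (MvPolynomial.rename Sum.inl Δ)
    refine ⟨Φ', ⟨1, G.toSubgroup.one_mem, fun h' => by rw [hΦ', hren, one_mul]⟩, ?_⟩
    rw [hΦ', hren]
    simpa using hΔ1)
  have hθf : theta ν b x f = 0 := by rw [← hθ f hf1]; exact hf4 s0 hs0
  obtain ⟨φ0, hφ0⟩ := good_exists ν (wts f)
  obtain ⟨t, g, hg, htg⟩ : ∃ t : kˣ, ∃ g ∈ G.toSubgroup, MvPolynomial.eval (mat2pt (dU (lamF φ0 t) * b * (g * c⁻¹)).1) Δ ≠ 0 := by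
    by_contra hcon
    push Not at hcon
    have h1 := H.star1 hf1 hφ0
    rw [hθf] at h1
    have h2 := h1.unique ((HasLim.const (1 : k)).congr fun s => hf3 _ (by
      rintro Φ ⟨g, hg, hΦ⟩
      rw [hΦ]; exact hcon s g hg) x hx)
    exact zero_ne_one h2
  obtain ⟨p, q, hpq, hp, hq⟩ := hΔ _ htg
  have hdet : p.det * q.det ≠ 0 := by
    rw [← Matrix.det_mul, ← hpq]
    exact left_ne_zero_of_mul ((det_mul_inv _).trans_ne one_ne_zero)
  obtain ⟨p', rfl⟩ : IsUnit p := (Matrix.isUnit_iff_isUnit_det _).2 (isUnit_iff_ne_zero.2 (left_ne_zero_of_mul hdet))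
  obtain ⟨q', rfl⟩ : IsUnit q := (Matrix.isUnit_iff_isUnit_det _).2 (isUnit_iff_ne_zero.2 (right_ne_zero_of_mul hdet))
  have hpq' : dU (lamF φ0 t) * b * (g * c⁻¹) = p' * q' := Units.ext hpq
  let a : GL (Fin G.n) k := p'⁻¹ * dU (lamF φ0 t)
  have hab : a * b = q' * c * g⁻¹ := by
    have : dU (lamF φ0 t) * b = p' * q' * (g * c⁻¹)⁻¹ := by rw [← hpq', mul_inv_cancel_right]
    change p'⁻¹ * dU (lamF φ0 t) * b = _
    rw [mul_assoc, this]
    group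
  have ha : ∀ i j, gam ν i < gam ν j → a.1 i j = 0 := by
    intro i j hij
    change (p'⁻¹.1 * Matrix.diagonal (fun i => (lamF φ0 t i : k))) i j = 0
    rw [Matrix.mul_diagonal]
    let _ : Invertible p'.1 := p'.invertible
    have h1 : Matrix.BlockTriangular p'.1 (fun i => OrderDual.toDual (gam ν i)) := fun i j hij => hp i j hij
    have h2 := Matrix.blockTriangular_inv_of_blockTriangular h1
    have h3 : p'⁻¹.1 i j = 0 := by
      rw [Matrix.coe_units_inv]; exact h2 hij
    rw [h3, zero_mul]
  obtain ⟨a0, h01, h02⟩ := conjLim ν a ha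
  obtain ⟨q0, -, hq0⟩ := conjLim (-ν) q' (fun i j hij => hq i j (neg_lt_neg_iff.1 hij))
  refine ⟨a, a0, ?_, h01, h02⟩
  have hmain : (a0 * c)⁻¹ * (q' * c) ∈ G.toSubgroup := by
    refine sep_coset hG X hs0 _ _ fun f hf hfi => ?_
    obtain ⟨D, hD⟩ := H.limit hθ hf
    obtain ⟨φ, hφ⟩ := good_exists ν (D ∪ DE G.n)
    have hφ2 := hφ.mono (Finset.subset_union_right (s₁ := D) (s₂ := DE G.n))
    have l1 := hD φ (hφ.mono Finset.subset_union_left) a a0 (h02 φ hφ2)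
    have l2 : HasLim (fun s : kˣ => MvPolynomial.eval (ept (dU (lamF φ s) * (q' * c)) s0) f) (MvPolynomial.eval (ept (a0 * c) s0) f) := by
      refine l1.congr fun s => ?_
      rw [hab, ← mul_assoc (dU _) (q' * c) g⁻¹, hf _ (G.toSubgroup.inv_mem hg) _ _ hx]
      exact hfi _ _ hs0 _ (X.act_mem _ (G.toSubgroup.inv_mem hg) _ hx)
    have l3 : HasLim (fun s : kˣ => MvPolynomial.eval (ept (dU (lamF φ s⁻¹) * (q' * c)) s0) f) (MvPolynomial.eval (ept (q0 * c) s0) f) := by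
      obtain ⟨r, A, P, h⟩ := expand f
      rw [h]
      refine (HasLim.sum Finset.univ fun j _ => (HasLim.eval (hq0 (-φ) hφ2.neg) (P j)).mul (HasLim.const (MvPolynomial.eval (ept (A j * c) s0) f))).congr fun s => ?_
      rw [← h, lamF_neg]
      have e : dU (lamF φ s⁻¹) * (q' * c) = dU (lamF φ s⁻¹) * q' * (dU (lamF φ s⁻¹))⁻¹ * c * (c⁻¹ * (dU (lamF φ s⁻¹) * c)) := by group
      have hm := H.lam_mem hG hs0 hθ hφ s⁻¹
      rw [e, hf _ hm _ _ hs0]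
      exact hfi _ _ (X.act_mem _ hm _ hs0) _ hs0
    have := l2.two_sided l3 1
    rwa [lamF_one, dU_one, one_mul] at this
  rw [hab, ← mul_assoc]
  exact G.toSubgroup.mul_mem hmain (G.toSubgroup.inv_mem hg)

/-- The one-parameter subgroup `s ↦ w⁻¹ λ_φ(s) w`. -/
noncomputable def conjPS (φ : (Fin G.n → ℤ) →+ ℤ) (w : GL (Fin G.n) k) (hw : ∀ s : kˣ, w⁻¹ * (dU (lamF φ s) * w) ∈ G.toSubgroup) : OnePS G where
  toFun :=
    { toFun := fun s => w⁻¹ * (dU (lamF φ s) * w)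
      map_one' := by simp [lamF_one, dU_one]
      map_mul' := by
        intro s t
        rw [lamF_mul, dU_mul]
        group }
  mem := hw
  regular := by
    classical
    refine ⟨fun ij => ∑ l, MvPolynomial.C (w⁻¹.1 ij.1 l * w.1 l ij.2) *
      (MvPolynomial.X true ^ (φ (Pi.single l 1)).toNat * MvPolynomial.X false ^ (-φ (Pi.single l 1)).toNat), fun t ij => ?_⟩
    change (w⁻¹.1 * (Matrix.diagonal (fun i => (lamF φ t i : k)) * w.1)) ij.1 ij.2 = _
    rw [Matrix.mul_apply, map_sum]
    refine Finset.sum_congr rfl fun l _ => ?_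
    rw [Matrix.diagonal_mul]
    have h1 : (lamF φ t l : k) = (t : k) ^ (φ (Pi.single l 1)).toNat * ((t⁻¹ : kˣ) : k) ^ (-φ (Pi.single l 1)).toNat := by
      rw [lamF, ← Units.val_pow_eq_pow_val, ← Units.val_pow_eq_pow_val, ← Units.val_mul]
      congr 1
      rw [inv_pow, ← zpow_natCast, ← zpow_natCast, ← zpow_neg, ← zpow_add]
      congr 1
      omega
    rw [h1]
    simp
    ring

theorem RData.final (H : RData X x S ν b) (hG : IsReductive G) (hSX : S ⊆ X.carrier) (hSc : IsZClosed S)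
    (hSG : ∀ g ∈ G.toSubgroup, ∀ y ∈ S, X.act g y ∈ S) (hx : x ∈ X.carrier) :
    ∃ (lam : OnePS G) (y : Fin m → k), y ∈ S ∧ XLimit X lam x y := by
  classical
  obtain ⟨c, s0, hs0S, hθ⟩ := H.core2 hG hSX hSc hSG
  have hs0 := hSX hs0S
  obtain ⟨a, a0, hg1, ha0, hlim⟩ := H.core3 hG hs0 hx hθ
  let g1 := (a0 * c)⁻¹ * (a * b)
  have hab : a * b = a0 * c * g1 := by rw [mul_inv_cancel_left]
  choose Ξ hΞ1 hΞ2 using fun i => xi_exists hG X i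
  let w0 := g1⁻¹ * c⁻¹ * a0⁻¹
  choose D hD using fun i => H.limit hθ ((hΞ1 i).ltr w0)
  obtain ⟨φ, hφ⟩ := good_exists ν (DE G.n ∪ Finset.univ.biUnion D)
  have hw : ∀ s : kˣ, (c * g1)⁻¹ * (dU (lamF φ s) * (c * g1)) ∈ G.toSubgroup := by
    intro s
    have := G.toSubgroup.mul_mem (G.toSubgroup.mul_mem (G.toSubgroup.inv_mem hg1) (H.lam_mem hG hs0 hθ hφ s)) hg1
    convert this using 1
    change _ = g1⁻¹ * _ * g1
    group
  have hy := hSG _ (G.toSubgroup.inv_mem hg1) _ hs0S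
  refine ⟨conjPS φ (c * g1) hw, X.act g1⁻¹ s0, hy, hSX hy, ?_⟩
  have hL : ∀ i, HasLim (fun s : kˣ => X.act ((c * g1)⁻¹ * (dU (lamF φ s) * (c * g1))) x i) (X.act g1⁻¹ s0 i) := by
    intro i
    have h1 := hD i φ (hφ.mono ((Finset.subset_biUnion_of_mem D (Finset.mem_univ i)).trans Finset.subset_union_right)) a a0 (hlim φ (hφ.mono Finset.subset_union_left))
    simp only [eval_ltr] at h1
    have e1 : w0 * (a0 * c) = g1⁻¹ := by
      change g1⁻¹ * c⁻¹ * a0⁻¹ * (a0 * c) = g1⁻¹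
      group
    rw [e1, hΞ2 i _ (G.toSubgroup.inv_mem hg1) _ hs0] at h1
    refine h1.congr fun s => ?_
    rw [← hΞ2 i _ (hw s) _ hx]
    congr 2
    rw [hab, ← mul_assoc (dU _) (a0 * c), ← mul_assoc (dU _) a0, comm_lam hφ ha0 s]
    have e2 : (c * g1)⁻¹ * (dU (lamF φ s) * (c * g1)) = g1⁻¹ * c⁻¹ * a0⁻¹ * (a0 * dU (lamF φ s) * c * g1) := by group
    rw [e2]
  choose q hq1 hq2 using hL
  exact ⟨q, fun t i => hq1 i t, fun i => (hq2 i).symm⟩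

end Final

end PaperGIT

namespace PaperGIT

section OpenGen

theorem open_gen {A B : Type} [CommRing A] [CommRing B] [IsNoetherianRing A] [Nontrivial B] (f : A →+* B) (hf : f.FiniteType) :
    ∃ h : A, f h ≠ 0 ∧ ∀ P : Ideal A, P.IsPrime → (∀ a, f a = 0 → a ∈ P) → h ∉ P → ∃ Q : Ideal B, Q.IsPrime ∧ Q.comap f = P := by
  classical
  have hker : (⊥ : Ideal B).comap f ≠ ⊤ := Ideal.comap_ne_top f bot_ne_top
  have hfin := Ideal.finite_minimalPrimes_of_isNoetherianRing A ((⊥ : Ideal B).comap f)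
  obtain ⟨M, hM, hMle⟩ := Ideal.exists_le_maximal _ hker
  have hMp := hM.isPrime
  obtain ⟨p, hp, -⟩ := Ideal.exists_minimalPrimes_le hMle
  obtain ⟨p', hp', -, hpp⟩ := Ideal.exists_comap_eq_of_mem_minimalPrimes f p hp
  have hpP : p.IsPrime := hp.isPrime
  have hFP : f.FinitePresentation := RingHom.FinitePresentation.of_finiteType.1 hf
  obtain ⟨S, hS⟩ := PrimeSpectrum.exists_constructibleSetData_iff.mpr (PrimeSpectrum.isConstructible_range_comap hFP)
  have hmem : (⟨p, hpP⟩ : PrimeSpectrum A) ∈ S.toSet := by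
    rw [hS]; exact ⟨⟨p', hp'⟩, PrimeSpectrum.ext hpp⟩
  obtain ⟨C, hC, hpC⟩ : ∃ C ∈ S, (⟨p, hpP⟩ : PrimeSpectrum A) ∈ C.toSet := by
    simpa [PrimeSpectrum.ConstructibleSetData.toSet] using hmem
  have hpC' : Set.range C.g ⊆ p ∧ C.f ∉ p := by
    simpa [PrimeSpectrum.BasicConstructibleSetData.toSet, PrimeSpectrum.mem_zeroLocus] using hpC
  let s := hfin.toFinset.erase p
  obtain ⟨h2, h2s, h2p⟩ : ∃ h2 : A, (∀ q ∈ s, h2 ∈ q) ∧ h2 ∉ p := by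
    by_contra hcon
    push Not at hcon
    have : s.inf (fun q => q) ≤ p := fun a ha => hcon a (fun q hq => (Finset.inf_le (f := fun q : Ideal A => q) hq) ha)
    obtain ⟨q, hq, hqp⟩ := (Ideal.IsPrime.inf_le' hpP).1 this
    have hq1 : q ∈ ((⊥ : Ideal B).comap f).minimalPrimes := hfin.mem_toFinset.1 (Finset.mem_of_mem_erase hq)
    exact Finset.ne_of_mem_erase hq (le_antisymm hqp (hp.2 hq1.1 hqp))
  refine ⟨C.f * h2, ?_, ?_⟩
  · intro h0
    have : C.f * h2 ∈ p := hp.1.2 (by rw [Ideal.mem_comap, h0]; exact Ideal.zero_mem _)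
    exact (hpP.mem_or_mem this).elim hpC'.2 h2p
  · intro P hP hle hn
    obtain ⟨q, hq, hqP⟩ := Ideal.exists_minimalPrimes_le (I := (⊥ : Ideal B).comap f) (J := P)
      (fun a ha => hle a (by simpa using ha))
    have hqp : q = p := by
      by_contra hne
      exact hn (P.mul_mem_left _ (hqP (h2s q (Finset.mem_erase.2 ⟨hne, hfin.mem_toFinset.2 hq⟩))))
    subst hqp
    have hPC : (⟨P, hP⟩ : PrimeSpectrum A) ∈ C.toSet := by
      have : Set.range C.g ⊆ P ∧ C.f ∉ P := ⟨fun a ha => hqP (hpC'.1 ha), fun h => hn (P.mul_mem_right _ h)⟩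
      simpa [PrimeSpectrum.BasicConstructibleSetData.toSet, PrimeSpectrum.mem_zeroLocus] using this
    have : (⟨P, hP⟩ : PrimeSpectrum A) ∈ S.toSet := by
      simp only [PrimeSpectrum.ConstructibleSetData.toSet, Set.mem_iUnion]
      exact ⟨C, hC, hPC⟩
    rw [hS] at this
    obtain ⟨Q, hQ⟩ := this
    exact ⟨Q.asIdeal, Q.2, congrArg PrimeSpectrum.asIdeal hQ⟩

/-- Version for algebras of finite type: maximal points lift. -/
theorem open_pts {k : Type} [Field k] [IsAlgClosed k] {m : ℕ} {B : Type} [CommRing B] [Algebra k B] [Algebra.FiniteType k B] [Nontrivial B]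
    (φ : MvPolynomial (Fin m) k →ₐ[k] B) :
    ∃ h, φ h ≠ 0 ∧ ∀ z : Fin m → k, (∀ f, φ f = 0 → MvPolynomial.eval z f = 0) → MvPolynomial.eval z h ≠ 0 →
      ∃ χ : B →ₐ[k] k, ∀ f, χ (φ f) = MvPolynomial.eval z f := by
  have hf : φ.toRingHom.FiniteType := by
    have h1 : (φ.toRingHom.comp (algebraMap k (MvPolynomial (Fin m) k))).FiniteType := by
      have h2 : φ.toRingHom.comp (algebraMap k (MvPolynomial (Fin m) k)) = algebraMap k B := φ.comp_algebraMap
      rw [h2]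
      exact RingHom.finiteType_algebraMap.2 inferInstance
    exact RingHom.FiniteType.of_comp_finiteType h1
  obtain ⟨h, h0, hh⟩ := open_gen φ.toRingHom hf
  refine ⟨h, h0, fun z hz hzh => ?_⟩
  obtain ⟨Q, hQ, hQP⟩ := hh (RingHom.ker (MvPolynomial.eval z)) (RingHom.ker_isPrime _) hz hzh
  obtain ⟨χ, hχ⟩ := exists_algHom_of_ne_top (k := k) Q hQ.ne_top
  have hmem : ∀ f, MvPolynomial.eval z f = 0 → χ (φ f) = 0 := by
    intro f hf
    have : f ∈ Q.comap φ.toRingHom := by rw [hQP]; exact hf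
    exact hχ _ this
  refine ⟨χ, fun f => ?_⟩
  have := hmem (f - MvPolynomial.C (MvPolynomial.eval z f)) (by simp)
  rw [map_sub, map_sub, sub_eq_zero] at this
  rw [this, ← MvPolynomial.algebraMap_eq, φ.commutes, χ.commutes]; rfl

end OpenGen

section Main

variable {k : Type} [Field k] {m : ℕ} {G : AlgGroup k}

/-- `z` lies in the Zariski closure of the orbit of `x`. -/
def InCl (X : GVariety G m) (x z : Fin m → k) : Prop :=
  ∀ f : MvPolynomial (Fin m) k, (∀ g ∈ G.toSubgroup, MvPolynomial.eval (X.act g x) f = 0) → MvPolynomial.eval z f = 0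

theorem pullback (X : GVariety G m) {g : GL (Fin G.n) k} (hg : g ∈ G.toSubgroup) (f : MvPolynomial (Fin m) k) :
    ∃ f' : MvPolynomial (Fin m) k, ∀ z ∈ X.carrier, MvPolynomial.eval (X.act g z) f = MvPolynomial.eval z f' := by
  let e : X.carrier → Fin m → k := fun p => p.1
  have h1 : ∀ i, (fun p : X.carrier => X.act g p.1 i) ∈ reg e := fun i =>
    act_coord_mem X (P := X.carrier) (S := reg e) (u := fun _ => g) (v := fun p => p.1)
      (fun s => (reg e).algebraMap_mem (gpt g s)) (fun i => coord_mem_reg e i) (fun _ => hg) (fun p => p.2) i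
  obtain ⟨f', hf'⟩ := mem_reg.1 (reg_le h1 (eval_mem_reg (fun p : X.carrier => X.act g p.1) f))
  exact ⟨f', fun z hz => hf' ⟨z, hz⟩⟩

theorem InCl.mem {X : GVariety G m} {x z : Fin m → k} (hx : x ∈ X.carrier) (h : InCl X x z) : z ∈ X.carrier := by
  obtain ⟨I, hI⟩ := X.closed
  rw [hI]
  intro f hf
  refine h f fun g hg => ?_
  have := X.act_mem g hg x hx
  rw [hI] at this
  exact this f hf

theorem InCl.act {X : GVariety G m} {x z : Fin m → k} (hx : x ∈ X.carrier) (h : InCl X x z) {g : GL (Fin G.n) k} (hg : g ∈ G.toSubgroup) :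
    InCl X x (X.act g z) := by
  intro f hf
  obtain ⟨f', hf'⟩ := pullback X hg f
  rw [hf' z (h.mem hx)]
  refine h f' fun g' hg' => ?_
  rw [← hf' _ (X.act_mem g' hg' x hx), ← X.act_mul g hg g' hg' x hx]
  exact hf _ (mul_mem hg hg')

theorem InCl.self {X : GVariety G m} {x : Fin m → k} (hx : x ∈ X.carrier) : InCl X x x := by
  intro f hf
  have := hf 1 (one_mem _)
  rwa [X.act_one x hx] at this

variable [IsAlgClosed k] [CharZero k]

theorem hm_main (hG : IsReductive G) (X : GVariety G m) {x y : Fin m → k} (hx : x ∈ X.carrier) (hy : InCl X x y) {S : Set (Fin m → k)}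
    (hyS : y ∈ S) (hSX : S ⊆ X.carrier) (hSc : IsZClosed S) (hSG : ∀ g ∈ G.toSubgroup, ∀ y ∈ S, X.act g y ∈ S) :
    ∃ (lam : OnePS G) (y : Fin m → k), y ∈ S ∧ XLimit X lam x y := by
  obtain ⟨Γ, i1, i2, i3, ν, b, h1, h2⟩ := rstep X x hx y hy
  have H : RData X x S ν b := ⟨h1, fun f hf hv => h2 f hf (fun h => hv h y hyS)⟩
  exact H.final hG hSX hSc hSG hx

theorem lemma_open (X : GVariety G m) {x : Fin m → k} (hx : x ∈ X.carrier) :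
    ∃ h, (∃ g ∈ G.toSubgroup, MvPolynomial.eval (X.act g x) h ≠ 0) ∧
      ∀ z, InCl X x z → MvPolynomial.eval z h ≠ 0 → z ∈ orbitSet X x := by
  have hc : ∀ i, (fun g : Pt G => X.act g.1 x i) ∈ gO G := fun i =>
    act_coord_mem X (P := Pt G) (S := gO G) (u := fun g => g.1) (v := fun _ => x)
      (fun s => coord_mem_reg _ s) (fun i => (gO G).algebraMap_mem (x i)) (fun g => g.2) (fun _ => hx) i
  let φ : MvPolynomial (Fin m) k →ₐ[k] gO G := MvPolynomial.aeval (R := k) (fun i => (⟨_, hc i⟩ : gO G))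
  have hφ : ∀ f (g : Pt G), (φ f).1 g = MvPolynomial.eval (X.act g.1 x) f := by
    intro f g
    have h1 := MvPolynomial.comp_aeval_apply (R := k) (fun i => (⟨_, hc i⟩ : gO G)) (gO G).val f
    have h2 := aeval_pts (fun g : Pt G => X.act g.1 x) f g
    rw [← h2]
    exact congrFun h1 g
  have := (gO_affGrp G).fg
  obtain ⟨h, h0, hh⟩ := open_pts φ
  refine ⟨h, ?_, fun z hz hzh => ?_⟩
  · by_contra hcon
    push Not at hcon
    apply h0
    apply Subtype.ext
    funext g
    exact (hφ h g).trans (hcon g.1 g.2)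
  · obtain ⟨χ, hχ⟩ := hh z (fun f hf => hz f fun g hg => by
      rw [← hφ f ⟨g, hg⟩, hf]; rfl) hzh
    obtain ⟨g, hg⟩ := (gO_affGrp G).pts χ
    refine ⟨g.1, g.2, ?_⟩
    funext i
    have h1 := hχ (MvPolynomial.X i)
    rw [hg, hφ] at h1
    simpa using h1.symm

theorem backward (hG : IsReductive G) (X : GVariety G m) {x : Fin m → k} (hx : x ∈ X.carrier)
    (H : ∀ (lam : OnePS G) (y : Fin m → k), XLimit X lam x y → y ∈ orbitSet X x) : Polystable X x := by
  refine ⟨{f | ∀ g ∈ G.toSubgroup, MvPolynomial.eval (X.act g x) f = 0}, ?_⟩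
  apply Set.Subset.antisymm
  · rintro _ ⟨g, hg, rfl⟩ f hf
    exact hf g hg
  intro y hy
  have hy : InCl X x y := hy
  have hyX := hy.mem hx
  obtain ⟨lam, y', hy'S, hlim⟩ := hm_main hG X hx hy (S := {z | InCl X y z}) (InCl.self hyX) (fun z hz => InCl.mem hyX hz)
    ⟨{f | ∀ g ∈ G.toSubgroup, MvPolynomial.eval (X.act g y) f = 0}, rfl⟩ (fun g hg z hz => InCl.act hyX hz hg)
  obtain ⟨g, hg, rfl⟩ := H lam y' hlim
  obtain ⟨h, ⟨g1, hg1, hne⟩, hh⟩ := lemma_open X hx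
  have h1 : InCl X y (X.act g1 x) := by
    have := InCl.act hyX hy'S (mul_mem hg1 (inv_mem hg))
    rwa [← X.act_mul _ (mul_mem hg1 (inv_mem hg)) g hg x hx, inv_mul_cancel_right] at this
  obtain ⟨g2, hg2, hne2⟩ : ∃ g2 ∈ G.toSubgroup, MvPolynomial.eval (X.act g2 y) h ≠ 0 := by
    by_contra hcon
    push Not at hcon
    exact hne (h1 h hcon)
  obtain ⟨g3, hg3, e⟩ := hh _ (hy.act hx hg2) hne2
  refine ⟨g2⁻¹ * g3, mul_mem (inv_mem hg2) hg3, ?_⟩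
  rw [X.act_mul _ (inv_mem hg2) g3 hg3 x hx, ← e, ← X.act_mul _ (inv_mem hg2) g2 hg2 y hyX, inv_mul_cancel, X.act_one y hyX]

theorem forward (X : GVariety G m) {x : Fin m → k} (hP : Polystable X x) (lam : OnePS G) (y : Fin m → k)
    (hy : XLimit X lam x y) : y ∈ orbitSet X x := by
  obtain ⟨I, hI⟩ := hP
  obtain ⟨-, q, hq, hq0⟩ := hy
  rw [hI]
  intro f hf
  have hev : ∀ s : k, (MvPolynomial.aeval (R := k) q f).eval s = MvPolynomial.eval (fun i => (q i).eval s) f := by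
    intro s
    have h1 := MvPolynomial.comp_aeval_apply (R := k) q (Polynomial.aeval (R := k) s) f
    simp only [Polynomial.coe_aeval_eq_eval] at h1
    rw [h1, MvPolynomial.aeval_eq_eval]
  have h0 : MvPolynomial.aeval (R := k) q f = 0 := by
    apply poly_eq
    intro s
    rw [hev, Polynomial.eval_zero]
    have hmem : X.act (lam.toFun s) x ∈ orbitSet X x := ⟨_, lam.mem s, rfl⟩
    rw [hI] at hmem
    have h2 := hmem f hf
    rwa [show X.act (lam.toFun s) x = fun i => (q i).eval (s : k) from funext (hq s)] at h2
  rw [show y = fun i => (q i).eval 0 from funext hq0, ← hev, h0, Polynomial.eval_zero]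

end Main

end PaperGIT

namespace PaperGIT

/-- Proposition 4.3 of the paper. A point `x` of an affine
`G`-variety `X` is polystable if and only if it is 1PS polystable, i.e.
`λ⁺x ∈ G·x` for every one-parameter subgroup `λ` such that `λ⁺x` exists. -/
theorem polystable_iff_onePS_polystable
    {k : Type} [Field k] [IsAlgClosed k] [CharZero k]
    (G : AlgGroup k) (hG : IsReductive G)
    {m : ℕ} (X : GVariety G m) (x : Fin m → k) (hx : x ∈ X.carrier) :
    Polystable X x ↔
      ∀ (lam : OnePS G) (y : Fin m → k), XLimit X lam x y → y ∈ orbitSet X x := by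
  exact ⟨fun h => forward X h, fun h => backward hG X hx h⟩

end PaperGIT
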